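/- arXiv:0706.3842 — 3 statements merged into one kernel-verified Lean document; each statement's English description precedes it below -/
import Mathlib

section
/- Let R be a Cohen-Macaulay ring of prime characteristic p with finite F-representation type by finitely generated R-modules M_1, …, M_t, admitting a canonical module ω_R. Suppose that R_𝔭 is Gorenstein for every prime ideal 𝔭 of R with dim R/𝔭 ≥ 2. Let I be an ideal of R and n an integer. Then every associated prime of H_I^n(R) either lies in ⋃_{i=1}^t Ass_R Ext_R^n(M_i^†/IM_i^†, ω_R) or is a maximal ideal of R, where (−)^† = Hom_R(−, ω_R). In particular, Ass_R H_I^n(R) is a finite set if R is semilocal. -/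
/-!
Statement 6: Let `R` be a Cohen-Macaulay ring of prime characteristic `p` with finite
F-representation type by finitely generated modules `M_1, …, M_t`, admitting a canonical
module `ω_R`, with `R_𝔭` Gorenstein for every prime `𝔭` with `dim R/𝔭 ≥ 2`.  Then for
any ideal `I` and integer `n`, every associated prime of `H_I^n(R)` either lies in
`⋃_i Ass_R Ext_R^n(M_i†/IM_i†, ω_R)` or is a maximal ideal, where `(−)† = Hom_R(−, ω_R)`.
In particular `Ass_R H_I^n(R)` is finite if `R` is semilocal.
-/

open CategoryTheory

open scoped DirectSum

universe u

section Defs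

variable (R : Type u) [CommRing R]

/-- `Ext_R^i(M, N)` via Mathlib's `Ext` functor on `ModuleCat R`. -/
noncomputable def extCat (i : ℕ) (M N : ModuleCat.{u} R) : ModuleCat.{u} R :=
  ((Ext R (ModuleCat.{u} R) i).obj (Opposite.op M)).obj N

/-- `ω` is a canonical (dualizing) module for `R`: finitely generated, of finite
injective dimension, the homothety map `R → End_R(ω)` is bijective and
`Ext_R^i(ω, ω) = 0` for `i > 0`. -/
def IsCanonicalModule (ω : Type u) [AddCommGroup ω] [Module R ω] : Prop :=
  Module.Finite R ω ∧
  (∃ n : ℕ, ∀ (M : ModuleCat.{u} R) (i : ℕ), n < i →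
    Subsingleton (extCat R i M (ModuleCat.of R ω))) ∧
  Function.Bijective (algebraMap R (Module.End R ω)) ∧
  (∀ i : ℕ, 0 < i → Subsingleton (extCat R i (ModuleCat.of R ω) (ModuleCat.of R ω)))

/-- A (weakly) regular sequence generating a proper ideal. -/
def IsRegularSeq (rs : List R) : Prop :=
  (∀ (i : ℕ) (hi : i < rs.length) (a : R),
      rs.get ⟨i, hi⟩ * a ∈ Ideal.span {x | x ∈ rs.take i} →
        a ∈ Ideal.span {x | x ∈ rs.take i}) ∧
  Ideal.span {x | x ∈ rs} ≠ ⊤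

/-- `R` is a Cohen-Macaulay *local* ring. -/
def IsCMLocalRing : Prop :=
  IsLocalRing R ∧ IsNoetherianRing R ∧
  ∃ rs : List R, IsRegularSeq R rs ∧ (∀ x ∈ rs, ¬IsUnit x) ∧
    (rs.length : WithBot (WithTop ℕ)) = ringKrullDim R

/-- `R` is a Cohen-Macaulay ring. -/
def IsCMRing : Prop :=
  IsNoetherianRing R ∧
    ∀ (P : Ideal R) (_ : P.IsPrime), IsCMLocalRing (Localization.AtPrime P)

/-- `R` is a Gorenstein local ring: Noetherian local with finite injective dimension
as a module over itself. -/
def IsGorensteinLocalRing : Prop :=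
  IsLocalRing R ∧ IsNoetherianRing R ∧
  ∃ n : ℕ, ∀ (M : ModuleCat.{u} R) (i : ℕ), n < i →
    Subsingleton (extCat R i M (ModuleCat.of R R))

end Defs

namespace FFRT

section Toolkit

variable {R : Type u} [CommRing R]
variable {L M N K A B C : Type u} [AddCommGroup L] [Module R L] [AddCommGroup M] [Module R M]
  [AddCommGroup N] [Module R N] [AddCommGroup K] [Module R K] [AddCommGroup A] [Module R A]
  [AddCommGroup B] [Module R B] [AddCommGroup C] [Module R C]

/-- Yoneda-type `Ext` groups of unbundled modules. -/
abbrev ExtM (R : Type u) [CommRing R] (M N : Type u) [AddCommGroup M] [Module R M]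
    [AddCommGroup N] [Module R N] (n : ℕ) : Type u :=
  Abelian.Ext (ModuleCat.of R M) (ModuleCat.of R N) n

namespace ExtM

/-- Contravariant functoriality of `Ext`. -/
noncomputable def pre (f : M →ₗ[R] L) {n : ℕ} : ExtM R L N n →ₗ[R] ExtM R M N n where
  toFun x := (Abelian.Ext.mk₀ (ModuleCat.ofHom f)).comp x (zero_add n)
  map_add' _ _ := Abelian.Ext.comp_add _ _ _ _
  map_smul' _ _ := Abelian.Ext.comp_smul _ _ _ _

/-- Covariant functoriality of `Ext`. -/
noncomputable def post (f : M →ₗ[R] L) {n : ℕ} : ExtM R N M n →ₗ[R] ExtM R N L n where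
  toFun x := x.comp (Abelian.Ext.mk₀ (ModuleCat.ofHom f)) (add_zero n)
  map_add' _ _ := Abelian.Ext.add_comp _ _ _ _
  map_smul' _ _ := Abelian.Ext.smul_comp _ _ _ _

lemma pre_id {n : ℕ} (x : ExtM R M N n) : pre (LinearMap.id) x = x :=
  Abelian.Ext.mk₀_id_comp x

lemma post_id {n : ℕ} (x : ExtM R M N n) : post (LinearMap.id) x = x :=
  Abelian.Ext.comp_mk₀_id x

lemma pre_pre (f : K →ₗ[R] M) (g : M →ₗ[R] L) {n : ℕ} (x : ExtM R L N n) :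
    pre f (pre g x) = pre (g ∘ₗ f) x := by
  simp [pre, ModuleCat.ofHom_comp]

lemma post_post (f : K →ₗ[R] M) (g : M →ₗ[R] L) {n : ℕ} (x : ExtM R N K n) :
    post g (post f x) = post (g ∘ₗ f) x := by
  simp [post, ModuleCat.ofHom_comp]

lemma pre_post (f : K →ₗ[R] M) (g : N →ₗ[R] L) {n : ℕ} (x : ExtM R M N n) :
    pre f (post g x) = post g (pre f x) := by
  simp [pre, post]

lemma pre_add (f g : M →ₗ[R] L) {n : ℕ} (x : ExtM R L N n) :
    pre (f + g) x = pre f x + pre g x := by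
  simp [pre, ModuleCat.ofHom_add, Abelian.Ext.mk₀_add, Abelian.Ext.add_comp]

lemma pre_smul (r : R) (f : M →ₗ[R] L) {n : ℕ} (x : ExtM R L N n) :
    pre (r • f) x = r • pre f x := by
  have : ModuleCat.ofHom (r • f) = r • ModuleCat.ofHom f := rfl
  simp [pre, this, Abelian.Ext.mk₀_smul, Abelian.Ext.smul_comp]

lemma post_smul (r : R) (f : M →ₗ[R] L) {n : ℕ} (x : ExtM R N M n) :
    post (r • f) x = r • post f x := by
  have : ModuleCat.ofHom (r • f) = r • ModuleCat.ofHom f := rfl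
  simp [post, this, Abelian.Ext.mk₀_smul, Abelian.Ext.comp_smul]

lemma pre_zero {n : ℕ} (x : ExtM R L N n) : pre (0 : M →ₗ[R] L) x = 0 := by
  simpa using pre_smul (0 : R) (0 : M →ₗ[R] L) x

lemma pre_sum {ι : Type*} (s : Finset ι) (f : ι → M →ₗ[R] L) {n : ℕ} (x : ExtM R L N n) :
    pre (∑ i ∈ s, f i) x = ∑ i ∈ s, pre (f i) x := by
  classical
  induction s using Finset.induction_on with
  | empty => simp [pre_zero]
  | insert a s ha ih => rw [Finset.sum_insert ha, Finset.sum_insert ha, pre_add, ih]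

lemma pre_lsmul (r : R) {n : ℕ} (x : ExtM R M N n) :
    pre (LinearMap.lsmul R M r) x = r • x := by
  have : LinearMap.lsmul R M r = r • LinearMap.id := by ext; simp
  rw [this, pre_smul, pre_id]

lemma post_lsmul (r : R) {n : ℕ} (x : ExtM R M N n) :
    post (LinearMap.lsmul R N r) x = r • x := by
  have : LinearMap.lsmul R N r = r • LinearMap.id := by ext; simp
  rw [this, post_smul, post_id]

/-- Degree zero `Ext` is `Hom`. -/
noncomputable def ofHom : (M →ₗ[R] N) ≃ₗ[R] ExtM R M N 0 where
  toFun f := Abelian.Ext.mk₀ (ModuleCat.ofHom f)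
  map_add' f g := by rw [ModuleCat.ofHom_add, Abelian.Ext.mk₀_add]
  map_smul' r f := by
    have : ModuleCat.ofHom (r • f) = r • ModuleCat.ofHom f := rfl
    simp [this, Abelian.Ext.mk₀_smul]
  invFun x := (Abelian.Ext.homEquiv₀ x).hom
  left_inv f := by
    apply ModuleCat.hom_ext_iff.mp (?_ : _ = ModuleCat.ofHom f)
    exact Abelian.Ext.homEquiv₀.symm_apply_eq.mp rfl |>.symm
  right_inv x := Abelian.Ext.mk₀_homEquiv₀_apply x

lemma pre_ofHom (f : M →ₗ[R] L) (g : L →ₗ[R] N) : pre f (ofHom g) = ofHom (g ∘ₗ f) := by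
  simp [pre, ofHom, ModuleCat.ofHom_comp]

lemma post_ofHom (f : M →ₗ[R] L) (g : L →ₗ[R] N) : post g (ofHom f) = ofHom (g ∘ₗ f) := by
  simp [post, ofHom, ModuleCat.ofHom_comp]

end ExtM

/-- A short exact sequence of modules. -/
structure SES (f : A →ₗ[R] B) (g : B →ₗ[R] C) : Prop where
  inj : Function.Injective f
  exact : Function.Exact f g
  surj : Function.Surjective g

namespace SES

variable {f : A →ₗ[R] B} {g : B →ₗ[R] C} (h : SES f g)
include h

lemma comp_eq_zero : g ∘ₗ f = 0 := LinearMap.ext fun x => h.exact.apply_apply_eq_zero x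

/-- The short complex attached to a short exact sequence. -/
abbrev cx : ShortComplex (ModuleCat.{u} R) :=
  ShortComplex.mk (ModuleCat.ofHom f) (ModuleCat.ofHom g)
    (by rw [← ModuleCat.ofHom_comp, h.comp_eq_zero]; rfl)

lemma shortExact : h.cx.ShortExact where
  exact := (ShortComplex.ShortExact.moduleCat_exact_iff_function_exact _).mpr h.exact
  mono_f := (ModuleCat.mono_iff_injective _).mpr h.inj
  epi_g := (ModuleCat.epi_iff_surjective _).mpr h.surj

/-- The contravariant connecting map. -/
noncomputable def δ {n : ℕ} : ExtM R A N n →ₗ[R] ExtM R C N (n + 1) where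
  toFun x := h.shortExact.extClass.comp x (Nat.add_comm 1 n)
  map_add' _ _ := Abelian.Ext.comp_add _ _ _ _
  map_smul' _ _ := Abelian.Ext.comp_smul _ _ _ _

/-- The covariant connecting map. -/
noncomputable def δ' {n : ℕ} : ExtM R N C n →ₗ[R] ExtM R N A (n + 1) where
  toFun x := x.comp h.shortExact.extClass rfl
  map_add' _ _ := Abelian.Ext.add_comp _ _ _ _
  map_smul' _ _ := Abelian.Ext.smul_comp _ _ _ _

lemma exact_pre {n : ℕ} : Function.Exact (ExtM.pre g : ExtM R C N n →ₗ[R] _) (ExtM.pre f) := by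
  intro x
  refine ⟨fun hx => Abelian.Ext.contravariant_sequence_exact₂ h.shortExact _ x hx, ?_⟩
  rintro ⟨y, rfl⟩
  rw [ExtM.pre_pre, h.comp_eq_zero, ExtM.pre_zero]

lemma exact_pre_δ {n : ℕ} : Function.Exact (ExtM.pre f : ExtM R B N n →ₗ[R] _) h.δ := by
  intro x
  refine ⟨fun hx => Abelian.Ext.contravariant_sequence_exact₁ h.shortExact _ x
    (Nat.add_comm 1 n) hx, ?_⟩
  rintro ⟨y, rfl⟩
  exact h.shortExact.extClass_comp_assoc y (h := Nat.add_comm 1 n)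

lemma exact_δ_pre {n : ℕ} : Function.Exact (h.δ : ExtM R A N n →ₗ[R] _) (ExtM.pre g) := by
  intro x
  refine ⟨fun hx => Abelian.Ext.contravariant_sequence_exact₃ h.shortExact _ x hx
    (Nat.add_comm 1 n), ?_⟩
  rintro ⟨y, rfl⟩
  exact h.shortExact.comp_extClass_assoc y (Nat.add_comm 1 n)

lemma exact_post_δ' {n : ℕ} : Function.Exact (ExtM.post g : ExtM R N B n →ₗ[R] _) h.δ' := by
  intro x
  refine ⟨fun hx => Abelian.Ext.covariant_sequence_exact₃ _ h.shortExact x rfl hx, ?_⟩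
  rintro ⟨y, rfl⟩
  have := h.shortExact.comp_extClass
  dsimp only [δ', ExtM.post, LinearMap.coe_mk, AddHom.coe_mk]
  rw [Abelian.Ext.comp_assoc_of_second_deg_zero]
  exact (congrArg (fun z => Abelian.Ext.comp y z rfl) this).trans (Abelian.Ext.comp_zero _ _ _ _ _)

lemma exact_δ'_post {n : ℕ} : Function.Exact (h.δ' : ExtM R N C n →ₗ[R] _) (ExtM.post f) := by
  intro x
  refine ⟨fun hx => Abelian.Ext.covariant_sequence_exact₁ _ h.shortExact x hx rfl, ?_⟩
  rintro ⟨y, rfl⟩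
  have := h.shortExact.extClass_comp
  dsimp only [δ', ExtM.post, LinearMap.coe_mk, AddHom.coe_mk]
  rw [Abelian.Ext.comp_assoc_of_third_deg_zero]
  exact (congrArg (fun z => Abelian.Ext.comp y z rfl) this).trans (Abelian.Ext.comp_zero _ _ _ _ _)

lemma pre_δ' (φ : L →ₗ[R] N) {n : ℕ} (x : ExtM R N C n) :
    ExtM.pre φ (h.δ' x) = h.δ' (ExtM.pre φ x) := by
  simp only [δ', ExtM.pre, LinearMap.coe_mk, AddHom.coe_mk]
  rw [Abelian.Ext.comp_assoc]
  all_goals omega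

end SES

lemma SES.of_ker {g : B →ₗ[R] C} (hg : Function.Surjective g) :
    SES (LinearMap.ker g).subtype g :=
  ⟨Subtype.val_injective, LinearMap.exact_subtype_ker_map g, hg⟩

lemma SES.of_range {f : A →ₗ[R] B} (hf : Function.Injective f) :
    SES f (LinearMap.range f).mkQ :=
  ⟨hf, LinearMap.exact_map_mkQ_range f, Submodule.mkQ_surjective _⟩


lemma ExtM.eq_zero_of_projective [Module.Projective R M] {n : ℕ} (x : ExtM R M N (n + 1)) :
    x = 0 := by
  have : Projective (ModuleCat.of R M) := (IsProjective.iff_projective M).mp inferInstance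
  exact Abelian.Ext.eq_zero_of_projective x

lemma ExtM.eq_zero_of_injective [Module.Injective R N] {n : ℕ} (x : ExtM R M N (n + 1)) :
    x = 0 := by
  have : Injective (ModuleCat.of R N) :=
    (Module.injective_iff_injective_object R N).mp inferInstance
  exact Abelian.Ext.eq_zero_of_injective x

instance ExtM.finite [IsNoetherianRing R] [Module.Finite R M] [Module.Finite R N] (n : ℕ) :
    Module.Finite R (ExtM R M N n) :=
  ModuleCat.finite_ext R (ModuleCat.of R M) (ModuleCat.of R N) n

end Toolkit

open RingTheory.Sequence
open scoped Pointwise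

section Dies

variable {R : Type u} [CommRing R]

/-- Every element of `X` is killed by some element of the multiplicative set `T`;
in other words the localization of `X` at `T` vanishes. -/
def Dies (T : Submonoid R) (X : Type*) [AddCommGroup X] [Module R X] : Prop :=
  ∀ x : X, ∃ a ∈ T, a • x = 0

variable {T : Submonoid R} {X Y Z : Type*} [AddCommGroup X] [Module R X] [AddCommGroup Y]
  [Module R Y] [AddCommGroup Z] [Module R Z]

lemma Dies.of_exact {f : X →ₗ[R] Y} {g : Y →ₗ[R] Z} (h : Function.Exact f g)
    (hX : Dies T X) (hZ : Dies T Z) : Dies T Y := by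
  intro y
  obtain ⟨a, ha, hay⟩ := hZ (g y)
  obtain ⟨x, hx⟩ := (h (a • y)).mp (by rw [map_smul, hay])
  obtain ⟨b, hb, hbx⟩ := hX x
  exact ⟨b * a, T.mul_mem hb ha, by rw [mul_smul, ← hx, ← map_smul, hbx, map_zero]⟩

lemma Dies.of_surjective {f : X →ₗ[R] Y} (hf : Function.Surjective f) (hX : Dies T X) :
    Dies T Y := by
  intro y
  obtain ⟨x, rfl⟩ := hf y
  obtain ⟨b, hb, hbx⟩ := hX x
  exact ⟨b, hb, by rw [← map_smul, hbx, map_zero]⟩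

lemma Dies.of_subsingleton [Subsingleton X] : Dies T X :=
  fun _ => ⟨1, T.one_mem, Subsingleton.elim _ _⟩

lemma Dies.exists_forall [Module.Finite R X] (h : Dies T X) : ∃ a ∈ T, ∀ x : X, a • x = 0 := by
  classical
  obtain ⟨s, hs⟩ := ‹Module.Finite R X›.fg_top
  choose a ha hax using h
  refine ⟨∏ x ∈ s, a x, T.prod_mem fun x _ => ha x, fun x => ?_⟩
  have hx : x ∈ Submodule.span R (s : Set X) := hs ▸ Submodule.mem_top
  induction hx using Submodule.span_induction with
  | mem x hx =>
    rw [← Finset.prod_erase_mul s a hx, mul_smul, hax, smul_zero]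
  | zero => exact smul_zero _
  | add x y _ _ hx hy => rw [smul_add, hx, hy, add_zero]
  | smul r x _ hx => rw [smul_comm, hx, smul_zero]

lemma Dies.of_exact_smul [Module.Finite R X] {m : Ideal R} [hm : m.IsMaximal] {y : R}
    (hy : y ∈ m) {g : X →ₗ[R] Z} (h : Function.Exact (LinearMap.lsmul R X y) g)
    (hZ : Dies m.primeCompl Z) : Dies m.primeCompl X := by
  have hQ : Dies m.primeCompl (LinearMap.range g) := fun z => by
    obtain ⟨a, ha, haz⟩ := hZ z
    exact ⟨a, ha, Subtype.ext haz⟩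
  obtain ⟨a, ha, hax⟩ := hQ.exists_forall
  obtain ⟨b, hb⟩ := hm.exists_inv ha
  obtain ⟨c, hc, hbc⟩ := hb
  have hle : (⊤ : Submodule R X) ≤ m • ⊤ := by
    intro x _
    have h1 : x = b • a • x + c • x := by rw [← mul_smul, ← add_smul, hbc, one_smul]
    obtain ⟨x', hx'⟩ := (h (a • x)).mp (by
      rw [map_smul]; exact congrArg Subtype.val (hax ⟨g x, x, rfl⟩))
    rw [h1]
    refine Submodule.add_mem _ (Submodule.smul_mem _ _ ?_) ?_
    · rw [← hx']; exact Submodule.smul_mem_smul hy trivial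
    · exact Submodule.smul_mem_smul hc trivial
  obtain ⟨r, hr, hrx⟩ := Submodule.exists_sub_one_mem_and_smul_eq_zero_of_fg_of_le_smul m _
    (Module.Finite.fg_top (R := R) (M := X)) hle
  refine fun x => ⟨r, fun hrm => hm.ne_top ?_, hrx x trivial⟩
  rw [Ideal.eq_top_iff_one]
  simpa using m.sub_mem hrm hr

lemma subsingleton_of_dies (h : ∀ m : Ideal R, m.IsMaximal →
    ∀ x : X, ∃ a ∉ m, a • x = 0) : Subsingleton X := by
  refine subsingleton_of_forall_eq 0 fun x => ?_
  by_contra hx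
  have hne : Ideal.torsionOf R X x ≠ ⊤ := by
    rwa [Ne, Ideal.eq_top_iff_one, Ideal.mem_torsionOf_iff, one_smul]
  obtain ⟨m, hm, hle⟩ := Ideal.exists_le_maximal _ hne
  obtain ⟨a, ha, hax⟩ := h m hm x
  exact ha (hle hax)

lemma subsingleton_of_exact {f : X →ₗ[R] Y} {g : Y →ₗ[R] Z} (h : Function.Exact f g)
    [Subsingleton X] [Subsingleton Z] : Subsingleton Y := by
  refine subsingleton_of_forall_eq 0 fun y => ?_
  obtain ⟨x, rfl⟩ := (h y).mp (Subsingleton.elim _ _)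
  rw [Subsingleton.elim x 0, map_zero]

end Dies

section Vanishing

variable {R : Type u} [CommRing R]

lemma ses_quotSMulTop {N : Type u} [AddCommGroup N] [Module R N] {x : R}
    (hx : IsSMulRegular N x) :
    SES (LinearMap.lsmul R N x) (Submodule.mkQ (x • (⊤ : Submodule R N))) where
  inj := hx
  exact := by
    intro n
    rw [Submodule.mkQ_apply, Submodule.Quotient.mk_eq_zero, Submodule.mem_smul_pointwise_iff_exists]
    simp
  surj := Submodule.mkQ_surjective _

lemma ExtM.pre_lsmul_eq {M N : Type u} [AddCommGroup M] [Module R M] [AddCommGroup N] [Module R N]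
    (x : R) (n : ℕ) :
    (ExtM.pre (LinearMap.lsmul R M x) : ExtM R M N n →ₗ[R] _) = LinearMap.lsmul R _ x :=
  LinearMap.ext fun y => ExtM.pre_lsmul x y

/-- `Ext` is invariant under isomorphism in the first variable. -/
noncomputable def ExtM.preEquiv {M M' N : Type u} [AddCommGroup M] [Module R M] [AddCommGroup M']
    [Module R M'] [AddCommGroup N] [Module R N] (e : M' ≃ₗ[R] M) (n : ℕ) :
    ExtM R M N n ≃ₗ[R] ExtM R M' N n :=
  LinearEquiv.ofLinearMap (ExtM.pre e.toLinearMap) (ExtM.pre e.symm.toLinearMap)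
    (LinearMap.ext fun x => by simp [ExtM.pre_pre, ExtM.pre_id])
    (LinearMap.ext fun x => by simp [ExtM.pre_pre, ExtM.pre_id])

/-- `Ext` is invariant under isomorphism in the second variable. -/
noncomputable def ExtM.postEquiv {M M' N : Type u} [AddCommGroup M] [Module R M] [AddCommGroup M']
    [Module R M'] [AddCommGroup N] [Module R N] (e : M ≃ₗ[R] M') (n : ℕ) :
    ExtM R N M n ≃ₗ[R] ExtM R N M' n :=
  LinearEquiv.ofLinearMap (ExtM.post e.toLinearMap) (ExtM.post e.symm.toLinearMap)
    (LinearMap.ext fun x => by simp [ExtM.post_post, ExtM.post_id])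
    (LinearMap.ext fun x => by simp [ExtM.post_post, ExtM.post_id])

lemma ExtM.smul_eq_zero_of_left {M N : Type u} [AddCommGroup M] [Module R M] [AddCommGroup N]
    [Module R N] {a : R} (ha : ∀ x : M, a • x = 0) {n : ℕ} (y : ExtM R M N n) : a • y = 0 := by
  rw [← ExtM.pre_lsmul, show LinearMap.lsmul R M a = 0 from LinearMap.ext ha, ExtM.pre_zero]

variable {ω : Type u} [AddCommGroup ω] [Module R ω]

lemma subsingleton_ext_quot (xs : List R) (c : ℕ) (N : Type u) [AddCommGroup N] [Module R N]
    (hN : ∀ j > c, Subsingleton (ExtM R N ω j)) (hxs : IsWeaklyRegular N xs) :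
    ∀ j > c + xs.length,
      Subsingleton (ExtM R (N ⧸ (Ideal.ofList xs • ⊤ : Submodule R N)) ω j) := by
  induction xs generalizing N c with
  | nil =>
    intro j hj
    have e : (N ⧸ (Ideal.ofList ([] : List R) • ⊤ : Submodule R N)) ≃ₗ[R] N :=
      Submodule.quotEquivOfEqBot _ (by rw [Ideal.ofList_nil, Submodule.bot_smul])
    have := hN j (by simpa using hj)
    exact (ExtM.preEquiv e j).symm.toEquiv.subsingleton
  | cons x xs ih =>
    rw [isWeaklyRegular_cons_iff] at hxs
    intro j hj
    have h := ih (c + 1) (QuotSMulTop x N) (fun i hi => ?_) hxs.2 j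
      (by simp only [List.length_cons] at hj; omega)
    · exact (ExtM.preEquiv (Submodule.quotOfListConsSMulTopEquivQuotSMulTopInner N x xs)
        j).symm.toEquiv.subsingleton
    · obtain ⟨i, rfl⟩ : ∃ k, i = k + 1 := ⟨i - 1, by omega⟩
      have := hN i (by omega)
      have := hN (i + 1) (by omega)
      exact subsingleton_of_exact (ses_quotSMulTop hxs.1).exact_δ_pre

lemma dies_ext_of_quot [IsNoetherianRing R] [Module.Finite R ω] {m : Ideal R} [m.IsMaximal]
    (xs : List R) (hm : ∀ x ∈ xs, x ∈ m) (c : ℕ) (N : Type u) [AddCommGroup N] [Module R N]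
    [Module.Finite R N] (hxs : IsWeaklyRegular N xs)
    (hN : ∀ j > c + xs.length, Dies m.primeCompl
      (ExtM R (N ⧸ (Ideal.ofList xs • ⊤ : Submodule R N)) ω j)) :
    ∀ j > c, Dies m.primeCompl (ExtM R N ω j) := by
  induction xs generalizing N c with
  | nil =>
    intro j hj
    have e : (N ⧸ (Ideal.ofList ([] : List R) • ⊤ : Submodule R N)) ≃ₗ[R] N :=
      Submodule.quotEquivOfEqBot _ (by rw [Ideal.ofList_nil, Submodule.bot_smul])
    exact (hN j (by simpa using hj)).of_surjective (ExtM.preEquiv e j).symm.surjective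
  | cons x xs ih =>
    rw [isWeaklyRegular_cons_iff] at hxs
    have h := ih (fun y hy => hm y (by simp [hy])) (c + 1) (QuotSMulTop x N) hxs.2 (fun j hj => ?_)
    · intro j hj
      have h1 := (ses_quotSMulTop hxs.1).exact_pre_δ (N := ω) (n := j)
      rw [ExtM.pre_lsmul_eq] at h1
      exact Dies.of_exact_smul (hm x (by simp)) h1 (h (j + 1) (by omega))
    · exact (hN j (by simp only [List.length_cons]; omega)).of_surjective
        (ExtM.preEquiv (Submodule.quotOfListConsSMulTopEquivQuotSMulTopInner N x xs)
          j).symm.surjective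

lemma exists_maximal_weaklyRegular [IsNoetherianRing R] (m : Ideal R) [hm : m.IsMaximal] :
    ∃ xs : List R, (∀ x ∈ xs, x ∈ m) ∧ IsWeaklyRegular R xs ∧
      m ∈ associatedPrimes R (R ⧸ (Ideal.ofList xs • ⊤ : Submodule R R)) := by
  let S : Set (Ideal R) :=
    {J | ∃ xs : List R, (∀ x ∈ xs, x ∈ m) ∧ IsWeaklyRegular R xs ∧ J = Ideal.ofList xs}
  obtain ⟨J, ⟨xs, hxm, hxs, rfl⟩, hmax⟩ := set_has_maximal_iff_noetherian.mpr ‹_› S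
    ⟨_, [], by simp, IsWeaklyRegular.nil R R, rfl⟩
  refine ⟨xs, hxm, hxs, ?_⟩
  have hle : Ideal.ofList xs ≤ m := Ideal.span_le.mpr hxm
  have hzd : ∀ y ∈ m, ¬ IsSMulRegular (R ⧸ (Ideal.ofList xs • ⊤ : Submodule R R)) y := by
    intro y hy hreg
    have hmem : Ideal.ofList (xs ++ [y]) ∈ S :=
      ⟨_, by simpa [or_imp, forall_and] using ⟨hxm, hy⟩,
        (isWeaklyRegular_append_iff R xs [y]).mpr
          ⟨hxs, (isWeaklyRegular_singleton_iff _ _).mpr hreg⟩, rfl⟩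
    refine hmax _ hmem (lt_of_le_of_ne (by simp) fun heq => ?_)
    have hyx : y ∈ Ideal.ofList xs := by
      rw [heq]; exact Ideal.subset_span (by simp)
    have h1 : (Submodule.Quotient.mk 1 : R ⧸ (Ideal.ofList xs • ⊤ : Submodule R R)) = 0 := by
      apply hreg
      simp only [smul_zero, ← Submodule.Quotient.mk_smul]
      rw [Submodule.Quotient.mk_eq_zero]
      exact Submodule.smul_mem_smul hyx trivial
    rw [Submodule.Quotient.mk_eq_zero] at h1
    exact hm.ne_top (Ideal.eq_top_iff_one _ |>.mpr (hle (by simpa using h1)))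
  obtain ⟨Q, hQ, hmQ⟩ := (Ideal.subset_union_prime_finite
    (associatedPrimes.finite R (R ⧸ (Ideal.ofList xs • ⊤ : Submodule R R))) (f := id) (I := m) ⊥ ⊥
    (fun Q hQ _ _ => hQ.isPrime)).mp (by
      simp only [id]
      rw [biUnion_associatedPrimes_eq_compl_regular]
      exact hzd)
  exact hm.eq_of_le hQ.isPrime.ne_top hmQ ▸ hQ

end Vanishing

open RingTheory.Sequence
open scoped Pointwise

section Acyclic

variable {R : Type u} [CommRing R] {ω : Type u} [AddCommGroup ω] [Module R ω]

/-- `ω` has finite injective dimension. -/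
def FinInjDim (R : Type u) [CommRing R] (ω : Type u) [AddCommGroup ω] [Module R ω] : Prop :=
  ∃ s : ℕ, ∀ j > s, ∀ (N : Type u) [AddCommGroup N] [Module R N], Subsingleton (ExtM R N ω j)

/-- The higher `Ext` groups `Ext^j(M, N)`, `j > 0`, vanish. -/
def Acyc (R : Type u) [CommRing R] (M N : Type u) [AddCommGroup M] [Module R M]
    [AddCommGroup N] [Module R N] : Prop :=
  ∀ j > 0, Subsingleton (ExtM R M N j)

/-- Every weakly regular sequence of the ring is weakly regular on `N`. -/
def RegOn (R : Type u) [CommRing R] (N : Type u) [AddCommGroup N] [Module R N] : Prop :=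
  ∀ xs : List R, IsWeaklyRegular R xs → IsWeaklyRegular N xs

lemma dies_ext_quotient_prime [IsNoetherianRing R] [Module.Finite R ω] {m : Ideal R}
    [hm : m.IsMaximal] {j : ℕ}
    (hsucc : ∀ (N : Type u) [AddCommGroup N] [Module R N] [Module.Finite R N],
      Dies m.primeCompl (ExtM R N ω (j + 1)))
    (hres : Dies m.primeCompl (ExtM R (R ⧸ m) ω j)) (Q : Ideal R) [hQ : Q.IsPrime] :
    Dies m.primeCompl (ExtM R (R ⧸ Q) ω j) := by
  by_cases hQm : Q ≤ m
  · rcases eq_or_lt_of_le hQm with rfl | hlt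
    · exact hres
    obtain ⟨y, hym, hyQ⟩ := SetLike.exists_of_lt hlt
    have hreg : IsSMulRegular (R ⧸ Q) y := by
      rw [isSMulRegular_iff_right_eq_zero_of_smul]
      intro x hx
      obtain ⟨x, rfl⟩ := Ideal.Quotient.mk_surjective x
      rw [← Ideal.Quotient.mk_eq_mk, ← Submodule.Quotient.mk_smul, Ideal.Quotient.mk_eq_mk,
        Ideal.Quotient.eq_zero_iff_mem, smul_eq_mul] at hx
      exact Ideal.Quotient.eq_zero_iff_mem.mpr ((hQ.mem_or_mem hx).resolve_left hyQ)
    have h1 := (ses_quotSMulTop hreg).exact_pre_δ (N := ω) (n := j)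
    rw [ExtM.pre_lsmul_eq] at h1
    exact Dies.of_exact_smul hym h1 (hsucc _)
  · obtain ⟨a, haQ, ham⟩ := SetLike.not_le_iff_exists.mp hQm
    refine fun z => ⟨a, ham, ExtM.smul_eq_zero_of_left (fun x => ?_) z⟩
    obtain ⟨x, rfl⟩ := Ideal.Quotient.mk_surjective x
    rw [← Ideal.Quotient.mk_eq_mk, ← Submodule.Quotient.mk_smul, Ideal.Quotient.mk_eq_mk,
      Ideal.Quotient.eq_zero_iff_mem]
    exact Q.mul_mem_right _ haQ

lemma dies_ext_of_prime [IsNoetherianRing R] {T : Submonoid R} {j : ℕ}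
    (h : ∀ Q : Ideal R, Q.IsPrime → Dies T (ExtM R (R ⧸ Q) ω j))
    (N : Type u) [AddCommGroup N] [Module R N] [hN : Module.Finite R N] :
    Dies T (ExtM R N ω j) := by
  induction hN using IsNoetherianRing.induction_on_isQuotientEquivQuotientPrime R with
  | subsingleton N =>
    refine fun z => ⟨1, T.one_mem, ?_⟩
    exact ExtM.smul_eq_zero_of_left (fun x => Subsingleton.elim _ _) z
  | quotient N p f =>
    exact (h p.1 p.2).of_surjective (ExtM.preEquiv f j).surjective
  | exact N₁ N₂ N₃ f g hf hg hfg h₁ h₃ =>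
    exact Dies.of_exact (SES.mk hf hfg hg).exact_pre h₃ h₁

lemma dies_ext_of_length_lt [IsNoetherianRing R] [Module.Finite R ω] {m : Ideal R}
    [hm : m.IsMaximal] {xs : List R} (hxs : IsWeaklyRegular R xs)
    (hass : m ∈ associatedPrimes R (R ⧸ (Ideal.ofList xs • ⊤ : Submodule R R)))
    {s : ℕ} (hs : ∀ j > s, ∀ (N : Type u) [AddCommGroup N] [Module R N],
      Subsingleton (ExtM R N ω j)) (k : ℕ) :
    ∀ j > xs.length, s < j + k →
      ∀ (N : Type u) [AddCommGroup N] [Module R N] [Module.Finite R N],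
        Dies m.primeCompl (ExtM R N ω j) := by
  induction k with
  | zero =>
    intro j _ hj N _ _ _
    have := hs j hj N
    exact Dies.of_subsingleton
  | succ k ih =>
    intro j hj hk N _ _ _
    have hsucc := ih (j + 1) (by omega) (by omega)
    refine dies_ext_of_prime (fun Q hQ => dies_ext_quotient_prime @hsucc ?_ Q) N
    have h0 : Subsingleton (ExtM R (R ⧸ (Ideal.ofList xs • ⊤ : Submodule R R)) ω j) := by
      refine subsingleton_ext_quot xs 0 R (fun i hi => ?_) hxs j (by omega)
      obtain ⟨i, rfl⟩ : ∃ l, i = l + 1 := ⟨i - 1, by omega⟩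
      exact subsingleton_of_forall_eq 0 ExtM.eq_zero_of_projective
    obtain ⟨f, hf⟩ := (isAssociatedPrime_iff_exists_injective_linearMap m _).mp hass |>.2
    exact Dies.of_exact (SES.of_range hf).exact_pre_δ Dies.of_subsingleton (hsucc _)

/-- Over a Noetherian ring, a finite module on which regular sequences of the ring stay regular
has no higher `Ext` into a finite module of finite injective dimension. -/
theorem acyc_of_regOn [IsNoetherianRing R] [Module.Finite R ω] (hω : FinInjDim R ω)
    {N : Type u} [AddCommGroup N] [Module R N] [Module.Finite R N] (hN : RegOn R N) :
    Acyc R N ω := by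
  obtain ⟨s, hs⟩ := hω
  intro j hj
  refine subsingleton_of_dies (R := R) fun m hm => ?_
  obtain ⟨xs, hxm, hxs, hass⟩ := exists_maximal_weaklyRegular m
  refine dies_ext_of_quot xs hxm 0 N (hN xs hxs) (fun i hi => ?_) j hj
  exact dies_ext_of_length_lt hxs hass hs s i (by omega) (by omega) _

end Acyclic

open RingTheory.Sequence
open scoped Pointwise

section Lifting

variable {R : Type u} [CommRing R]
variable {N A B C : Type u} [AddCommGroup N] [Module R N] [AddCommGroup A] [Module R A]
  [AddCommGroup B] [Module R B] [AddCommGroup C] [Module R C]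
  {f : A →ₗ[R] B} {g : B →ₗ[R] C}

lemma SES.exists_lift (h : SES f g) [Subsingleton (ExtM R N A 1)] (φ : N →ₗ[R] C) :
    ∃ ψ : N →ₗ[R] B, g ∘ₗ ψ = φ := by
  obtain ⟨y, hy⟩ := (h.exact_post_δ' (N := N) (n := 0) (ExtM.ofHom φ)).mp (Subsingleton.elim _ _)
  obtain ⟨ψ, rfl⟩ := ExtM.ofHom.surjective y
  exact ⟨ψ, ExtM.ofHom.injective (by rw [← ExtM.post_ofHom, hy])⟩

lemma SES.exists_extend (h : SES f g) [Subsingleton (ExtM R C N 1)] (φ : A →ₗ[R] N) :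
    ∃ ψ : B →ₗ[R] N, ψ ∘ₗ f = φ := by
  obtain ⟨y, hy⟩ := (h.exact_pre_δ (N := N) (n := 0) (ExtM.ofHom φ)).mp (Subsingleton.elim _ _)
  obtain ⟨ψ, rfl⟩ := ExtM.ofHom.surjective y
  exact ⟨ψ, ExtM.ofHom.injective (by rw [← ExtM.pre_ofHom, hy])⟩

lemma SES.exists_factor (h : SES f g) (φ : N →ₗ[R] B) (hφ : g ∘ₗ φ = 0) :
    ∃ ψ : N →ₗ[R] A, f ∘ₗ ψ = φ := by
  have hmem : ∀ x, φ x ∈ LinearMap.range f := fun x =>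
    (h.exact (φ x)).mp (LinearMap.congr_fun hφ x)
  refine ⟨(LinearEquiv.ofInjective f h.inj).symm.toLinearMap ∘ₗ φ.codRestrict _ hmem, ?_⟩
  ext x
  simp

lemma SES.exists_desc (h : SES f g) (φ : B →ₗ[R] N) (hφ : φ ∘ₗ f = 0) :
    ∃ ψ : C →ₗ[R] N, ψ ∘ₗ g = φ := by
  have hle : LinearMap.ker g ≤ LinearMap.ker φ := by
    intro b hb
    obtain ⟨a, rfl⟩ := (h.exact b).mp hb
    exact LinearMap.congr_fun hφ a
  refine ⟨(LinearMap.ker g).liftQ φ hle ∘ₗ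
    (LinearMap.quotKerEquivOfSurjective g h.surj).symm.toLinearMap, ?_⟩
  ext b
  have : (LinearMap.quotKerEquivOfSurjective g h.surj).symm (g b)
      = Submodule.Quotient.mk b := by
    rw [LinearEquiv.symm_apply_eq]; rfl
  simp [this]

lemma SES.homCongr (h : SES f g) [Subsingleton (ExtM R N A 1)] :
    SES (f.compRight R : (N →ₗ[R] A) →ₗ[R] _) (g.compRight R) where
  inj φ ψ hφ := LinearMap.ext fun x => h.inj (LinearMap.congr_fun hφ x)
  exact φ := by
    refine ⟨fun hφ => h.exists_factor φ hφ, ?_⟩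
    rintro ⟨ψ, rfl⟩
    exact LinearMap.ext fun x => h.exact.apply_apply_eq_zero _
  surj φ := h.exists_lift φ

lemma SES.homContra (h : SES f g) [Subsingleton (ExtM R C N 1)] :
    SES (LinearMap.lcomp R N g) (LinearMap.lcomp R N f) where
  inj φ ψ hφ := LinearMap.ext fun x => by
    obtain ⟨b, rfl⟩ := h.surj x
    exact LinearMap.congr_fun hφ b
  exact φ := by
    refine ⟨fun hφ => h.exists_desc φ hφ, ?_⟩
    rintro ⟨ψ, rfl⟩
    refine LinearMap.ext fun x => ?_
    simp [h.exact.apply_apply_eq_zero]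
  surj φ := h.exists_extend φ

end Lifting

section Regular

variable {R : Type u} [CommRing R]

lemma isWeaklyRegular_of_subsingleton {N : Type u} [AddCommGroup N] [Module R N] [Subsingleton N]
    (xs : List R) : IsWeaklyRegular N xs := by
  induction xs generalizing N with
  | nil => exact IsWeaklyRegular.nil R N
  | cons x xs ih =>
    exact (isWeaklyRegular_cons_iff _ _ _).mpr ⟨fun _ _ _ => Subsingleton.elim _ _, ih⟩

lemma SES.isWeaklyRegular (xs : List R) {A B C : Type u} [AddCommGroup A] [Module R A]
    [AddCommGroup B] [Module R B] [AddCommGroup C] [Module R C]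
    {f : A →ₗ[R] B} {g : B →ₗ[R] C} (h : SES f g) (hA : IsWeaklyRegular A xs)
    (hC : IsWeaklyRegular C xs) : IsWeaklyRegular B xs := by
  induction xs generalizing A B C with
  | nil => exact IsWeaklyRegular.nil R B
  | cons x xs ih =>
    rw [isWeaklyRegular_cons_iff] at hA hC ⊢
    refine ⟨isSMulRegular_of_range_eq_ker h.inj (LinearMap.exact_iff.mp h.exact).symm hA.1 hC.1,
      ih (f := QuotSMulTop.map x f) (g := QuotSMulTop.map x g) ⟨?_, ?_, ?_⟩ hA.2 hC.2⟩
    · rw [injective_iff_map_eq_zero]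
      intro a ha
      obtain ⟨a, rfl⟩ := Submodule.Quotient.mk_surjective _ a
      rw [QuotSMulTop.map_apply_mk, Submodule.Quotient.mk_eq_zero,
        Submodule.mem_smul_pointwise_iff_exists] at ha
      obtain ⟨b, -, hb⟩ := ha
      have hgb : g b = 0 := by
        apply hC.1
        simp only [smul_zero]
        rw [← map_smul, hb, h.exact.apply_apply_eq_zero]
      obtain ⟨a', rfl⟩ := (h.exact b).mp hgb
      rw [← map_smul] at hb
      rw [← h.inj hb, Submodule.Quotient.mk_eq_zero]
      exact Submodule.smul_mem_pointwise_smul _ _ _ trivial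
    · exact QuotSMulTop.map_exact x h.exact h.surj
    · exact QuotSMulTop.map_surjective x h.surj

lemma ses_quotSMulTop_pow {M : Type u} [AddCommGroup M] [Module R M] {x : R}
    (hx : IsSMulRegular M x) (a : ℕ) :
    ∃ (f : QuotSMulTop x M →ₗ[R] QuotSMulTop (x ^ (a + 1)) M)
      (g : QuotSMulTop (x ^ (a + 1)) M →ₗ[R] QuotSMulTop (x ^ a) M), SES f g := by
  have key : ∀ (y : R) (m : M), m ∈ y • (⊤ : Submodule R M) ↔ ∃ m', m = y • m' := by
    intro y m
    rw [Submodule.mem_smul_pointwise_iff_exists]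
    exact ⟨fun ⟨b, _, hb⟩ => ⟨b, hb.symm⟩, fun ⟨b, hb⟩ => ⟨b, trivial, hb.symm⟩⟩
  refine ⟨Submodule.mapQ _ _ (LinearMap.lsmul R M (x ^ a)) ?_,
    Submodule.mapQ _ _ LinearMap.id ?_, ?_, ?_, ?_⟩
  · intro m hm
    obtain ⟨m', rfl⟩ := (key _ _).mp hm
    exact (key _ _).mpr ⟨m', by rw [LinearMap.lsmul_apply, pow_succ, mul_smul]⟩
  · intro m hm
    obtain ⟨m', rfl⟩ := (key _ _).mp hm
    exact (key _ _).mpr ⟨x • m', by simp [pow_succ, mul_smul]⟩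
  · rw [injective_iff_map_eq_zero]
    intro m hm
    obtain ⟨m, rfl⟩ := Submodule.Quotient.mk_surjective _ m
    rw [Submodule.mapQ_apply, Submodule.Quotient.mk_eq_zero, key] at hm
    obtain ⟨m', hm'⟩ := hm
    rw [pow_succ, mul_smul] at hm'
    rw [Submodule.Quotient.mk_eq_zero, key]
    exact ⟨m', hx.pow a hm'⟩
  · intro m
    obtain ⟨m, rfl⟩ := Submodule.Quotient.mk_surjective _ m
    rw [Submodule.mapQ_apply, Submodule.Quotient.mk_eq_zero, key]
    constructor
    · rintro ⟨m', hm'⟩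
      exact ⟨Submodule.Quotient.mk m', by rw [Submodule.mapQ_apply]; exact congrArg _ hm'.symm⟩
    · rintro ⟨b, hb⟩
      obtain ⟨b, rfl⟩ := Submodule.Quotient.mk_surjective _ b
      rw [Submodule.mapQ_apply, Submodule.Quotient.eq, key] at hb
      obtain ⟨m', hm'⟩ := hb
      refine ⟨b - x • m', ?_⟩
      rw [smul_sub, ← mul_smul, ← pow_succ, ← hm']
      simp
  · intro m
    obtain ⟨m, rfl⟩ := Submodule.Quotient.mk_surjective _ m
    exact ⟨Submodule.Quotient.mk m, by rw [Submodule.mapQ_apply]; rfl⟩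

lemma isWeaklyRegular_map_pow (xs : List R) (a : ℕ) {M : Type u} [AddCommGroup M] [Module R M]
    (h : IsWeaklyRegular M xs) : IsWeaklyRegular M (xs.map (· ^ a)) := by
  induction xs generalizing M with
  | nil => exact IsWeaklyRegular.nil R M
  | cons x xs ih =>
    rw [isWeaklyRegular_cons_iff] at h
    rw [List.map_cons, isWeaklyRegular_cons_iff]
    refine ⟨h.1.pow a, ?_⟩
    generalize hxs : xs.map (· ^ a) = ys
    have hys : IsWeaklyRegular (QuotSMulTop x M) ys := hxs ▸ ih h.2
    clear hxs ih
    induction a with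
    | zero =>
      have : Subsingleton (QuotSMulTop (x ^ 0) M) := by
        rw [pow_zero, Submodule.Quotient.subsingleton_iff, one_smul]
      exact isWeaklyRegular_of_subsingleton _
    | succ a iha =>
      obtain ⟨f, g, hfg⟩ := ses_quotSMulTop_pow h.1 a
      exact hfg.isWeaklyRegular ys hys iha

lemma Acyc.quotSMulTop {W Z : Type u} [AddCommGroup W] [Module R W] [AddCommGroup Z] [Module R Z]
    {x : R} (hx : IsSMulRegular Z x) (h : Acyc R W Z) : Acyc R W (QuotSMulTop x Z) := by
  intro j hj
  have := h j hj
  have := h (j + 1) (by omega)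
  exact subsingleton_of_exact (ses_quotSMulTop hx).exact_post_δ'

lemma isSMulRegular_hom {W Z : Type u} [AddCommGroup W] [Module R W] [AddCommGroup Z] [Module R Z]
    {x : R} (hx : IsSMulRegular Z x) : IsSMulRegular (W →ₗ[R] Z) x :=
  fun _ _ h => LinearMap.ext fun w => hx (LinearMap.congr_fun h w)

lemma nonempty_quotSMulTop_hom_equiv {W Z : Type u} [AddCommGroup W] [Module R W]
    [AddCommGroup Z] [Module R Z] {x : R} (hx : IsSMulRegular Z x) (h : Acyc R W Z) :
    Nonempty (QuotSMulTop x (W →ₗ[R] Z) ≃ₗ[R] (W →ₗ[R] QuotSMulTop x Z)) := by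
  have := h 1 one_pos
  have hs := (ses_quotSMulTop hx).homCongr (N := W)
  refine ⟨(Submodule.quotEquivOfEq _ _ ?_).trans
    (LinearMap.quotKerEquivOfSurjective _ hs.surj)⟩
  rw [LinearMap.exact_iff.mp hs.exact]
  ext φ
  rw [Submodule.mem_smul_pointwise_iff_exists]
  constructor
  · rintro ⟨ψ, -, rfl⟩; exact ⟨ψ, rfl⟩
  · rintro ⟨ψ, rfl⟩; exact ⟨ψ, trivial, rfl⟩

lemma Acyc.isWeaklyRegular_hom (xs : List R) {W Z : Type u} [AddCommGroup W] [Module R W]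
    [AddCommGroup Z] [Module R Z] (h : Acyc R W Z) (hxs : IsWeaklyRegular Z xs) :
    IsWeaklyRegular (W →ₗ[R] Z) xs := by
  induction xs generalizing Z with
  | nil => exact IsWeaklyRegular.nil R _
  | cons x xs ih =>
    rw [isWeaklyRegular_cons_iff] at hxs ⊢
    obtain ⟨e⟩ := nonempty_quotSMulTop_hom_equiv hxs.1 h
    exact ⟨isSMulRegular_hom hxs.1,
      (e.isWeaklyRegular_congr xs).mpr (ih (h.quotSMulTop hxs.1) hxs.2)⟩

lemma Acyc.isWeaklyRegular_of_hom [IsNoetherianRing R] (xs : List R) {W Z : Type u}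
    [AddCommGroup W] [Module R W] [AddCommGroup Z] [Module R Z] [Module.Finite R W]
    [Module.Finite R Z] (hW : Module.annihilator R W = ⊥) (h : Acyc R W Z)
    (hxs : IsWeaklyRegular (W →ₗ[R] Z) xs) : IsWeaklyRegular Z xs := by
  induction xs generalizing Z with
  | nil => exact IsWeaklyRegular.nil R _
  | cons x xs ih =>
    rw [isWeaklyRegular_cons_iff] at hxs ⊢
    have hx : IsSMulRegular Z x := by
      have hT : Subsingleton (W →ₗ[R] LinearMap.ker (LinearMap.lsmul R Z x)) := by
        refine subsingleton_of_forall_eq 0 fun φ => ?_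
        have h0 : (LinearMap.ker (LinearMap.lsmul R Z x)).subtype ∘ₗ φ = 0 := by
          apply hxs.1
          ext w
          have := LinearMap.mem_ker.mp (φ w).2
          rw [LinearMap.lsmul_apply] at this
          simp [this]
        exact LinearMap.ext fun w => Subtype.ext (LinearMap.congr_fun h0 w)
      obtain ⟨r, hr, hreg⟩ := IsSMulRegular.subsingleton_linearMap_iff.mp hT
      rw [hW, Submodule.mem_bot] at hr
      subst hr
      rw [isSMulRegular_iff_ker_lsmul_eq_bot, Submodule.eq_bot_iff]
      intro z hz
      have : (⟨z, hz⟩ : LinearMap.ker (LinearMap.lsmul R Z x)) = 0 := hreg (by simp)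
      exact congrArg Subtype.val this
    obtain ⟨e⟩ := nonempty_quotSMulTop_hom_equiv hx h
    exact ⟨hx, ih (h.quotSMulTop hx) ((e.isWeaklyRegular_congr xs).mp hxs.2)⟩

end Regular

open RingTheory.Sequence

section Duality

variable {R : Type u} [CommRing R]

/-- `ω` is a dualizing module, expressed with `ExtM`. -/
structure Dualizing (R : Type u) [CommRing R] (ω : Type u) [AddCommGroup ω] [Module R ω] :
    Prop where
  finite : Module.Finite R ω
  finInjDim : FinInjDim R ω
  bijective : Function.Bijective (algebraMap R (Module.End R ω))
  acyc : Acyc R ω ω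

lemma Acyc.ker {F N ω : Type u} [AddCommGroup F] [Module R F] [Module.Projective R F]
    [AddCommGroup N] [Module R N] [AddCommGroup ω] [Module R ω] {π : F →ₗ[R] N}
    (hπ : Function.Surjective π) (h : Acyc R N ω) : Acyc R (LinearMap.ker π) ω := by
  intro j hj
  obtain ⟨i, rfl⟩ : ∃ l, j = l + 1 := ⟨j - 1, by omega⟩
  have : Subsingleton (ExtM R F ω (i + 1)) :=
    subsingleton_of_forall_eq 0 ExtM.eq_zero_of_projective
  have := h (i + 1 + 1) (by omega)
  exact subsingleton_of_exact (SES.of_ker hπ).exact_pre_δ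

/-- The evaluation map to the bidual. -/
abbrev ev (R : Type u) [CommRing R] (ω N : Type u) [AddCommGroup ω] [Module R ω]
    [AddCommGroup N] [Module R N] : N →ₗ[R] (N →ₗ[R] ω) →ₗ[R] ω :=
  LinearMap.applyₗ

namespace Dualizing

variable {ω : Type u} [AddCommGroup ω] [Module R ω] (hω : Dualizing R ω)
include hω

lemma annihilator_eq_bot : Module.annihilator R ω = ⊥ := by
  rw [Submodule.eq_bot_iff]
  intro r hr
  refine hω.bijective.1 ?_
  rw [map_zero]
  exact LinearMap.ext fun w => Module.mem_annihilator.mp hr w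

lemma regOn [IsNoetherianRing R] : RegOn R ω := by
  have := hω.finite
  intro xs hxs
  refine hω.acyc.isWeaklyRegular_of_hom xs hω.annihilator_eq_bot ?_
  let e : R ≃ₗ[R] (ω →ₗ[R] ω) := LinearEquiv.ofBijective (Algebra.linearMap R (Module.End R ω))
    hω.bijective
  exact (e.isWeaklyRegular_congr xs).mp hxs

variable {N : Type u} [AddCommGroup N] [Module R N]

lemma acyc_of_regOn [IsNoetherianRing R] [Module.Finite R N] (hN : RegOn R N) : Acyc R N ω :=
  have := hω.finite
  FFRT.acyc_of_regOn hω.finInjDim hN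

lemma regOn_hom [IsNoetherianRing R] (hN : Acyc R N ω) : RegOn R (N →ₗ[R] ω) :=
  fun xs hxs => hN.isWeaklyRegular_hom xs (hω.regOn xs hxs)

lemma acyc_hom [IsNoetherianRing R] [Module.Finite R N] (hN : Acyc R N ω) :
    Acyc R (N →ₗ[R] ω) ω :=
  have := hω.finite
  hω.acyc_of_regOn (hω.regOn_hom hN)

lemma ev_free_bijective (m : ℕ) : Function.Bijective (ev R ω (Fin m → R)) := by
  constructor
  · rw [injective_iff_map_eq_zero]
    intro v hv
    funext i
    refine hω.bijective.1 ?_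
    rw [Pi.zero_apply, map_zero]
    refine LinearMap.ext fun w => ?_
    exact LinearMap.congr_fun hv ((LinearMap.proj i : (Fin m → R) →ₗ[R] R).smulRight w)
  · intro θ
    choose r hr using fun i => hω.bijective.2 (θ ∘ₗ
      (LinearMap.smulRightₗ (LinearMap.proj i : (Fin m → R) →ₗ[R] R)))
    refine ⟨r, LinearMap.ext fun φ => ?_⟩
    have hφ : φ = ∑ i, (LinearMap.proj i : (Fin m → R) →ₗ[R] R).smulRight
        (φ (Pi.single i 1)) := by
      refine LinearMap.pi_ext' fun i => LinearMap.ext_ring ?_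
      simp [Pi.single_apply]
    have hi : ∀ i, θ ((LinearMap.proj i : (Fin m → R) →ₗ[R] R).smulRight (φ (Pi.single i 1)))
        = r i • φ (Pi.single i 1) := fun i =>
      (LinearMap.congr_fun (hr i) (φ (Pi.single i 1))).symm
    conv_rhs => rw [hφ, map_sum]
    simp only [hi]
    change φ r = _
    conv_lhs => rw [hφ]
    simp [LinearMap.sum_apply]

lemma ev_surjective [IsNoetherianRing R] [Module.Finite R N] (hN : Acyc R N ω) :
    Function.Surjective (ev R ω N) := by
  obtain ⟨m, π, hπ⟩ := Module.Finite.exists_fin' R N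
  have := hN 1 one_pos
  have := hω.acyc_hom (hN.ker hπ) 1 one_pos
  intro θ
  obtain ⟨θ', hθ'⟩ := ((SES.of_ker hπ).homContra (N := ω)).exists_extend θ
  obtain ⟨v, rfl⟩ := (hω.ev_free_bijective m).2 θ'
  exact ⟨π v, hθ'⟩

lemma ev_bijective [IsNoetherianRing R] [Module.Finite R N] (hN : Acyc R N ω) :
    Function.Bijective (ev R ω N) := by
  refine ⟨?_, hω.ev_surjective hN⟩
  rw [injective_iff_map_eq_zero]
  intro n hn
  obtain ⟨m, π, hπ⟩ := Module.Finite.exists_fin' R N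
  obtain ⟨v, rfl⟩ := hπ n
  have := hN 1 one_pos
  obtain ⟨θ, hθ⟩ := ((SES.of_ker hπ).homContra (N := ω)).exists_desc (ev R ω _ v) hn
  obtain ⟨k, rfl⟩ := hω.ev_surjective (hN.ker hπ) θ
  have hk : (k : Fin m → R) = v := (hω.ev_free_bijective m).1 hθ
  rw [← hk]
  exact k.2

/-- A dualizing module is a direct summand of a finite power of any other dualizing module. -/
lemma exists_split [IsNoetherianRing R] {ω' : Type u} [AddCommGroup ω'] [Module R ω']
    (hω' : Dualizing R ω') :
    ∃ (m : ℕ) (g : Fin m → ω →ₗ[R] ω') (f : Fin m → ω' →ₗ[R] ω),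
      ∀ w, ∑ i, f i (g i w) = w := by
  have := hω.finite
  have := hω'.finite
  have h1 : Acyc R ω ω' := hω'.acyc_of_regOn hω.regOn
  have hL : Acyc R (ω →ₗ[R] ω') ω' := hω'.acyc_hom h1
  obtain ⟨m, π, hπ⟩ := Module.Finite.exists_fin' R (ω →ₗ[R] ω')
  have := hL 1 one_pos
  have hK := hL.ker hπ
  have := hω.acyc_of_regOn (hω'.regOn_hom hK) 1 one_pos
  let e : ω ≃ₗ[R] ((ω →ₗ[R] ω') →ₗ[R] ω') := LinearEquiv.ofBijective _ (hω'.ev_bijective h1)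
  obtain ⟨τ, hτ⟩ := ((SES.of_ker hπ).homContra (N := ω')).exists_extend e.symm.toLinearMap
  refine ⟨m, fun i => π (Pi.single i 1), fun i => τ ∘ₗ
    (LinearMap.smulRightₗ (LinearMap.proj i : (Fin m → R) →ₗ[R] R)), fun w => ?_⟩
  have h2 := LinearMap.congr_fun hτ (e w)
  simp only [LinearMap.comp_apply, LinearEquiv.coe_coe, LinearEquiv.symm_apply_apply] at h2
  refine Eq.trans ?_ h2
  simp only [LinearMap.comp_apply, ← map_sum]
  congr 1
  refine LinearMap.pi_ext' fun i => LinearMap.ext_ring ?_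
  simp [Pi.single_apply, e]

lemma exists_comp_eq_smul [IsNoetherianRing R] {ω' : Type u} [AddCommGroup ω'] [Module R ω']
    (hω' : Dualizing R ω') (P : Ideal R) [hP : P.IsPrime] :
    ∃ (g : ω →ₗ[R] ω') (f : ω' →ₗ[R] ω) (s : R), s ∉ P ∧ ∀ w, f (g w) = s • w := by
  obtain ⟨m, g, f, hfg⟩ := hω.exists_split hω'
  choose s hs using fun i => hω.bijective.2 (f i ∘ₗ g i)
  have hsum : ∑ i, s i = 1 := by
    refine hω.bijective.1 ?_
    rw [map_sum, map_one]
    refine LinearMap.ext fun w => ?_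
    simp [LinearMap.sum_apply, hs, hfg]
  obtain ⟨i, hi⟩ : ∃ i, s i ∉ P := by
    by_contra! h
    exact hP.ne_top (P.eq_top_iff_one.mpr (hsum ▸ P.sum_mem fun i _ => h i))
  exact ⟨g i, f i, s i, hi, fun w => (LinearMap.congr_fun (hs i) w).symm⟩

end Dualizing

lemma mem_associatedPrimes_iff [IsNoetherianRing R] {X : Type*} [AddCommGroup X] [Module R X]
    {P : Ideal R} : P ∈ associatedPrimes R X ↔ P.IsPrime ∧ ∃ x : X, ∀ a, a ∈ P ↔ a • x = 0 := by
  rw [AssociatedPrimes.mem_iff, isAssociatedPrime_iff]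
  simp only [SetLike.ext_iff, Submodule.mem_colon_singleton, Submodule.mem_bot]

/-- The map induced on quotients by an ideal. -/
abbrev mapQuot (J : Ideal R) {M N : Type u} [AddCommGroup M] [Module R M] [AddCommGroup N]
    [Module R N] (f : M →ₗ[R] N) :
    (M ⧸ (J • ⊤ : Submodule R M)) →ₗ[R] (N ⧸ (J • ⊤ : Submodule R N)) :=
  Submodule.mapQ _ _ f (Submodule.smul_top_le_comap_smul_top J f)

lemma Dualizing.mem_associatedPrimes [IsNoetherianRing R] {ω ω' : Type u} [AddCommGroup ω]
    [Module R ω] [AddCommGroup ω'] [Module R ω'] (hω : Dualizing R ω) (hω' : Dualizing R ω')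
    (J : Ideal R) {n : ℕ} {P : Ideal R}
    (hP : P ∈ associatedPrimes R (ExtM R (ω ⧸ (J • ⊤ : Submodule R ω)) ω n)) :
    P ∈ associatedPrimes R (ExtM R (ω' ⧸ (J • ⊤ : Submodule R ω')) ω' n) := by
  rw [mem_associatedPrimes_iff] at hP ⊢
  obtain ⟨hP, z, hz⟩ := hP
  obtain ⟨g, f, s, hs, hfg⟩ := hω.exists_comp_eq_smul hω' P
  refine ⟨hP, ExtM.pre (mapQuot J f) (ExtM.post g z), fun a => ⟨fun ha => ?_, fun ha => ?_⟩⟩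
  · rw [← map_smul, ← map_smul, (hz a).mp ha, map_zero, map_zero]
  · have h1 : ExtM.pre (mapQuot J g) (ExtM.post f
        (ExtM.pre (mapQuot J f) (ExtM.post g z))) = s • s • z := by
      rw [← ExtM.pre_post, ExtM.pre_pre, ExtM.post_post]
      have e1 : f ∘ₗ g = LinearMap.lsmul R ω s := LinearMap.ext hfg
      have e2 : mapQuot J f ∘ₗ mapQuot J g = LinearMap.lsmul R _ s := by
        refine Submodule.linearMap_qext _ (LinearMap.ext fun w => ?_)
        simp [mapQuot, hfg]
      rw [e1, e2, ExtM.pre_lsmul, ExtM.post_lsmul]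
    have h2 : a • s • s • z = 0 := by
      rw [← h1, ← map_smul, ← map_smul, ha, map_zero, map_zero]
    rw [← mul_smul, ← mul_smul, ← hz] at h2
    have := (hP.mem_or_mem h2).resolve_right hs
    exact (hP.mem_or_mem this).resolve_right hs

end Duality

section ChangeOfRings

variable {R : Type u} [CommRing R]

lemma exists_injective (R : Type u) [CommRing R] (Z : Type u) [AddCommGroup Z] [Module R Z] :
    ∃ (E : Type u) (_ : AddCommGroup E) (_ : Module R E) (_ : Module.Injective R E)
      (f : Z →ₗ[R] E), Function.Injective f := by
  obtain ⟨⟨E, hE, f, hf⟩⟩ := (ModuleCat.enoughInjectives.{u} R).presentation (ModuleCat.of R Z)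
  exact ⟨E, inferInstance, inferInstance, Module.injective_module_of_injective_object R E,
    f.hom, (ModuleCat.mono_iff_injective f).mp hf⟩

/-- Acyclicity is inherited by cosyzygies. -/
lemma Acyc.cosyzygy {W A B C : Type u} [AddCommGroup W] [Module R W] [AddCommGroup A] [Module R A]
    [AddCommGroup B] [Module R B] [AddCommGroup C] [Module R C] [Module.Injective R B]
    {f : A →ₗ[R] B} {g : B →ₗ[R] C} (hs : SES f g) (h : Acyc R W A) : Acyc R W C := by
  intro j hj
  obtain ⟨i, rfl⟩ : ∃ l, j = l + 1 := ⟨j - 1, by omega⟩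
  have : Subsingleton (ExtM R W B (i + 1)) :=
    subsingleton_of_forall_eq 0 ExtM.eq_zero_of_injective
  have := h (i + 1 + 1) (by omega)
  exact subsingleton_of_exact hs.exact_post_δ'

/-- Acyclicity passes to arbitrary direct sums in the first argument. -/
lemma Acyc.finsupp (ι : Type u) {W Z : Type u} [AddCommGroup W] [Module R W] [AddCommGroup Z]
    [Module R Z] (h : Acyc R W Z) : Acyc R (ι →₀ W) Z := by
  suffices H : ∀ (j : ℕ) (Z : Type u) [AddCommGroup Z] [Module R Z], Acyc R W Z →
      Subsingleton (ExtM R (ι →₀ W) Z (j + 1)) by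
    intro j hj
    obtain ⟨i, rfl⟩ : ∃ l, j = l + 1 := ⟨j - 1, by omega⟩
    exact H i Z h
  clear h
  intro j
  induction j with
  | zero =>
    intro Z _ _ h
    obtain ⟨E, _, _, _, f, hf⟩ := exists_injective R Z
    have hs := SES.of_range hf
    have := h 1 one_pos
    refine subsingleton_of_forall_eq 0 fun x => ?_
    obtain ⟨y, rfl⟩ := (hs.exact_δ'_post x).mp (ExtM.eq_zero_of_injective _)
    obtain ⟨φ, rfl⟩ := ExtM.ofHom.surjective y
    refine (hs.exact_post_δ' _).mpr ?_
    choose ψ hψ using fun i : ι => hs.exists_lift (φ ∘ₗ Finsupp.lsingle i)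
    refine ⟨ExtM.ofHom (Finsupp.lsum R ψ), ?_⟩
    rw [ExtM.post_ofHom]
    congr 1
    refine Finsupp.lhom_ext' fun i => ?_
    rw [← hψ i]
    ext w
    simp
  | succ j ih =>
    intro Z _ _ h
    obtain ⟨E, _, _, _, f, hf⟩ := exists_injective R Z
    have hs := SES.of_range hf
    have := ih _ (h.cosyzygy hs)
    have : Subsingleton (ExtM R (ι →₀ W) E (j + 1 + 1)) :=
      subsingleton_of_forall_eq 0 ExtM.eq_zero_of_injective
    exact subsingleton_of_exact hs.exact_δ'_post

variable (R) (S : Type u) [CommRing S] [Algebra R S]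

/-- The coinduced module `Hom_R(S, Z)`, as a module over `S`. -/
def CoInd (Z : Type u) [AddCommGroup Z] [Module R Z] : Type u := S →ₗ[R] Z

namespace CoInd

variable (Z : Type u) [AddCommGroup Z] [Module R Z]

instance : AddCommGroup (CoInd R S Z) := inferInstanceAs (AddCommGroup (S →ₗ[R] Z))

instance : Module R (CoInd R S Z) := inferInstanceAs (Module R (S →ₗ[R] Z))

/-- The identity, as a linear equivalence. -/
def equiv : CoInd R S Z ≃ₗ[R] (S →ₗ[R] Z) := LinearEquiv.refl _ _

variable {R S Z} in
@[ext] lemma ext {φ ψ : CoInd R S Z} (h : ∀ s, equiv R S Z φ s = equiv R S Z ψ s) : φ = ψ :=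
  (equiv R S Z).injective (LinearMap.ext h)

instance : SMul S (CoInd R S Z) where
  smul a φ := (equiv R S Z).symm (equiv R S Z φ ∘ₗ LinearMap.mulLeft R a)

variable {R S Z} in
lemma smul_apply (a s : S) (φ : CoInd R S Z) :
    equiv R S Z (a • φ) s = equiv R S Z φ (a * s) := rfl

instance : Module S (CoInd R S Z) where
  one_smul φ := by ext s; simp [smul_apply]
  mul_smul a b φ := by
    ext s
    simp only [smul_apply]
    congr 1
    ring
  smul_zero a := by ext s; simp [smul_apply]
  smul_add a φ ψ := by ext s; simp [smul_apply]
  add_smul a b φ := by ext s; simp [smul_apply, add_mul]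
  zero_smul φ := by ext s; simp [smul_apply]

instance : IsScalarTower R S (CoInd R S Z) where
  smul_assoc r a φ := by ext s; simp [smul_apply]

variable {R S Z} {N : Type u} [AddCommGroup N] [Module R N] [Module S N] [IsScalarTower R S N]

/-- The counit direction of the coinduction adjunction. -/
def toHom (φ : N →ₗ[S] CoInd R S Z) : N →ₗ[R] Z where
  toFun x := equiv R S Z (φ x) 1
  map_add' x y := by simp
  map_smul' r x := by
    rw [← algebraMap_smul S r x, map_smul, smul_apply, mul_one, Algebra.algebraMap_eq_smul_one,
      map_smul, RingHom.id_apply]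

lemma equiv_apply (φ : N →ₗ[S] CoInd R S Z) (x : N) (s : S) :
    equiv R S Z (φ x) s = toHom φ (s • x) := by
  simp [toHom, smul_apply]

/-- The unit direction of the coinduction adjunction. -/
def ofHom (ψ : N →ₗ[R] Z) : N →ₗ[S] CoInd R S Z where
  toFun x := (equiv R S Z).symm (ψ ∘ₗ (LinearMap.toSpanSingleton S N x).restrictScalars R)
  map_add' x y := by ext s; simp
  map_smul' a x := by ext s; simp [smul_apply, mul_smul, smul_comm a s]

lemma toHom_ofHom (ψ : N →ₗ[R] Z) : toHom (ofHom ψ : N →ₗ[S] CoInd R S Z) = ψ := by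
  ext x
  simp [toHom, ofHom]

lemma toHom_injective : Function.Injective (toHom : (N →ₗ[S] CoInd R S Z) → (N →ₗ[R] Z)) := by
  intro φ ψ h
  ext x s
  rw [equiv_apply, equiv_apply, h]

lemma toHom_smul (r : R) (φ : N →ₗ[S] CoInd R S Z) :
    toHom (algebraMap R S r • φ) = r • toHom φ := by
  ext x
  simp [toHom]

lemma toHom_zero : toHom (0 : N →ₗ[S] CoInd R S Z) = 0 := by
  ext x
  simp [toHom]

lemma toHom_comp {L : Type u} [AddCommGroup L] [Module R L] [Module S L] [IsScalarTower R S L]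
    (φ : N →ₗ[S] CoInd R S Z) (f : L →ₗ[S] N) :
    toHom (φ ∘ₗ f) = toHom φ ∘ₗ f.restrictScalars R := rfl

end CoInd

variable {R S}

lemma SES.restrictScalars {A B C : Type u} [AddCommGroup A] [Module R A] [Module S A]
    [IsScalarTower R S A] [AddCommGroup B] [Module R B] [Module S B] [IsScalarTower R S B]
    [AddCommGroup C] [Module R C] [Module S C] [IsScalarTower R S C] {f : A →ₗ[S] B}
    {g : B →ₗ[S] C} (h : SES f g) : SES (f.restrictScalars R) (g.restrictScalars R) :=
  ⟨h.inj, h.exact, h.surj⟩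

lemma exists_ses_finsupp (R S : Type u) [CommRing R] [CommRing S] [Algebra R S] (N : Type u)
    [AddCommGroup N] [Module S N] :
    ∃ (K : Type u) (_ : AddCommGroup K) (_ : Module R K) (_ : Module S K)
      (_ : IsScalarTower R S K) (f : K →ₗ[S] (N →₀ S)) (g : (N →₀ S) →ₗ[S] N), SES f g :=
  ⟨_, _, _, _, inferInstance, _, _, SES.of_ker (Finsupp.linearCombination_id_surjective S N)⟩

/-- Change of rings for `Ext` into a coinduced module, on annihilators of elements. -/
lemma exists_ext_restrictScalars {Z : Type u} [AddCommGroup Z] [Module R Z] (hZ : Acyc R S Z)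
    (n : ℕ) (N : Type u) [AddCommGroup N] [Module R N] [Module S N] [IsScalarTower R S N]
    (y : ExtM S N (CoInd R S Z) n) :
    ∃ z : ExtM R N Z n, ∀ r : R, r • z = 0 ↔ algebraMap R S r • y = 0 := by
  induction n generalizing N with
  | zero =>
    obtain ⟨φ, rfl⟩ := ExtM.ofHom.surjective y
    refine ⟨ExtM.ofHom (CoInd.toHom φ), fun r => ?_⟩
    rw [← map_smul, ← map_smul, LinearEquiv.map_eq_zero_iff, LinearEquiv.map_eq_zero_iff,
      ← CoInd.toHom_smul, ← CoInd.toHom_zero (S := S), CoInd.toHom_injective.eq_iff]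
  | succ n ih =>
    obtain ⟨K, _, _, _, _, f, g, hs⟩ := exists_ses_finsupp R S N
    have hs' := hs.restrictScalars (R := R)
    obtain ⟨y, rfl⟩ := (hs.exact_δ_pre y).mp (ExtM.eq_zero_of_projective _)
    have hF : Acyc R (N →₀ S) Z := hZ.finsupp N
    cases n with
    | zero =>
      obtain ⟨φ : _ →ₗ[S] CoInd R S Z, rfl⟩ := ExtM.ofHom.surjective y
      refine ⟨hs'.δ (ExtM.ofHom (CoInd.toHom φ)), fun r => ?_⟩
      rw [← map_smul, ← map_smul, ← map_smul, ← map_smul, hs.exact_pre_δ, hs'.exact_pre_δ,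
        ← CoInd.toHom_smul]
      constructor
      · rintro ⟨ψ, hψ⟩
        obtain ⟨ψ, rfl⟩ := ExtM.ofHom.surjective ψ
        refine ⟨ExtM.ofHom (CoInd.ofHom ψ), ?_⟩
        rw [ExtM.pre_ofHom] at hψ ⊢
        congr 1
        apply CoInd.toHom_injective
        rw [CoInd.toHom_comp, CoInd.toHom_ofHom]
        exact ExtM.ofHom.injective hψ
      · rintro ⟨ψ, hψ⟩
        obtain ⟨ψ, rfl⟩ := ExtM.ofHom.surjective ψ
        refine ⟨ExtM.ofHom (CoInd.toHom ψ), ?_⟩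
        rw [ExtM.pre_ofHom] at hψ ⊢
        rw [← CoInd.toHom_comp, ExtM.ofHom.injective hψ]
    | succ n =>
      obtain ⟨z, hz⟩ := ih _ y
      have := hF (n + 1) (by omega)
      have h1 : ∀ x, hs.δ (N := CoInd R S Z) (n := n + 1) x = 0 → x = 0 := by
        intro x hx
        obtain ⟨w, rfl⟩ := (hs.exact_pre_δ x).mp hx
        rw [ExtM.eq_zero_of_projective w, map_zero]
      have h2 : ∀ x, hs'.δ (N := Z) (n := n + 1) x = 0 → x = 0 := by
        intro x hx
        obtain ⟨w, rfl⟩ := (hs'.exact_pre_δ x).mp hx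
        rw [Subsingleton.elim w 0, map_zero]
      refine ⟨hs'.δ z, fun r => ?_⟩
      rw [← map_smul, ← map_smul]
      exact ⟨fun h => by rw [(hz r).mp (h2 _ h), map_zero],
        fun h => by rw [(hz r).mpr (h1 _ h), map_zero]⟩

lemma subsingleton_ext_coInd {Z : Type u} [AddCommGroup Z] [Module R Z] (hZ : Acyc R S Z)
    (n : ℕ) (N : Type u) [AddCommGroup N] [Module R N] [Module S N] [IsScalarTower R S N]
    [Subsingleton (ExtM R N Z n)] : Subsingleton (ExtM S N (CoInd R S Z) n) := by
  refine subsingleton_of_forall_eq 0 fun y => ?_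
  obtain ⟨z, hz⟩ := exists_ext_restrictScalars hZ n N y
  have := (hz 1).mp (Subsingleton.elim _ _)
  rwa [map_one, one_smul] at this

end ChangeOfRings

open RingTheory.Sequence

section Frobenius

variable {R : Type u} [CommRing R]

lemma Dualizing.coInd [IsNoetherianRing R] {S : Type u} [CommRing S] [Algebra R S]
    [Module.Finite R S] (hS : RegOn R S) {ω : Type u} [AddCommGroup ω] [Module R ω]
    (hω : Dualizing R ω) : Dualizing S (CoInd R S ω) := by
  have := hω.finite
  have hSω : Acyc R S ω := hω.acyc_of_regOn hS
  refine ⟨?_, ?_, ?_, ?_⟩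
  · have : Module.Finite R (CoInd R S ω) := Module.Finite.equiv (CoInd.equiv R S ω).symm
    exact Module.Finite.of_restrictScalars_finite R S _
  · obtain ⟨s, hs⟩ := hω.finInjDim
    refine ⟨s, fun j hj N _ _ => ?_⟩
    let _ : Module R N := Module.compHom N (algebraMap R S)
    have : IsScalarTower R S N := ⟨fun r a x => by
      change (r • a) • x = algebraMap R S r • a • x
      rw [Algebra.smul_def, mul_smul]⟩
    have := hs j hj N
    exact subsingleton_ext_coInd hSω j N
  · have hb := hω.ev_bijective hSω
    let T : Module.End S (CoInd R S ω) → (CoInd R S ω →ₗ[R] ω) := CoInd.toHom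
    have hT : Function.Bijective T :=
      ⟨CoInd.toHom_injective, fun ψ => ⟨CoInd.ofHom ψ, CoInd.toHom_ofHom ψ⟩⟩
    have hc : T ∘ algebraMap S (Module.End S (CoInd R S ω)) = ev R ω S := by
      funext s
      refine LinearMap.ext fun φ => ?_
      change CoInd.equiv R S ω (s • φ) 1 = CoInd.equiv R S ω φ s
      rw [CoInd.smul_apply, mul_one]
    rw [← hc] at hb
    exact (hT.of_comp_iff' _).mp hb
  · intro j hj
    have : Subsingleton (ExtM R (CoInd R S ω) ω j) := hω.acyc_hom hSω j hj
    exact subsingleton_ext_coInd hSω j _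

lemma Dualizing.comap_mem_associatedPrimes [IsNoetherianRing R] {S : Type u} [CommRing S]
    [IsNoetherianRing S] [Algebra R S] [Module.Finite R S] (hS : RegOn R S)
    {ω ω' : Type u} [AddCommGroup ω] [Module R ω] [AddCommGroup ω'] [Module S ω']
    (hω : Dualizing R ω) (hω' : Dualizing S ω') (I : Ideal R) {n : ℕ} {P : Ideal S}
    (hP : P ∈ associatedPrimes S
      (ExtM S (ω' ⧸ (I.map (algebraMap R S) • ⊤ : Submodule S ω')) ω' n)) :
    P.comap (algebraMap R S) ∈ associatedPrimes R
      (ExtM R ((S →ₗ[R] ω) ⧸ (I • ⊤ : Submodule R (S →ₗ[R] ω))) ω n) := by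
  have hP := hω'.mem_associatedPrimes (hω.coInd hS) _ hP
  rw [mem_associatedPrimes_iff] at hP ⊢
  obtain ⟨hP, y, hy⟩ := hP
  obtain ⟨z, hz⟩ := exists_ext_restrictScalars (hω.acyc_of_regOn hS) n _ y
  let e₀ : (CoInd R S ω ⧸ (I • ⊤ : Submodule R (CoInd R S ω))) ≃ₗ[R]
      (CoInd R S ω ⧸ (I.map (algebraMap R S) • ⊤ : Submodule S (CoInd R S ω))) :=
    (Submodule.quotEquivOfEq _ _ (by rw [Ideal.smul_restrictScalars]; rfl)).trans
      (Submodule.Quotient.restrictScalarsEquiv R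
        (I.map (algebraMap R S) • ⊤ : Submodule S (CoInd R S ω)))
  refine ⟨inferInstance, ExtM.preEquiv e₀ n z, fun a => ?_⟩
  rw [Ideal.mem_comap, hy, ← hz]
  refine Iff.trans ?_ (Eq.congr_left (map_smul (ExtM.preEquiv e₀ n) a z))
  exact ((ExtM.preEquiv e₀ n).map_eq_zero_iff).symm

/-- An associated prime of a finite direct sum comes from one of the summands. -/
lemma exists_mem_associatedPrimes_of_sum [IsNoetherianRing R] {κ : Type*} [Fintype κ]
    {X ω : Type u} [AddCommGroup X] [Module R X] [AddCommGroup ω] [Module R ω] {L : κ → Type u}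
    [∀ k, AddCommGroup (L k)] [∀ k, Module R (L k)] (i : ∀ k, L k →ₗ[R] X)
    (q : ∀ k, X →ₗ[R] L k) (hiq : ∑ k, i k ∘ₗ q k = LinearMap.id) (I : Ideal R) {n : ℕ}
    {P : Ideal R} (hP : P ∈ associatedPrimes R (ExtM R (X ⧸ (I • ⊤ : Submodule R X)) ω n)) :
    ∃ k, P ∈ associatedPrimes R (ExtM R (L k ⧸ (I • ⊤ : Submodule R (L k))) ω n) := by
  simp only [mem_associatedPrimes_iff] at hP ⊢
  obtain ⟨hP, z, hz⟩ := hP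
  by_contra! H
  have hsum : z = ∑ k, ExtM.pre (mapQuot I (q k)) (ExtM.pre (mapQuot I (i k)) z) := by
    simp only [ExtM.pre_pre]
    rw [← ExtM.pre_sum]
    have : ∑ k, mapQuot I (i k) ∘ₗ mapQuot I (q k) = LinearMap.id := by
      refine Submodule.linearMap_qext _ (LinearMap.ext fun x => ?_)
      have := LinearMap.congr_fun hiq x
      simp only [LinearMap.sum_apply, LinearMap.comp_apply, LinearMap.id_apply] at this
      simp only [LinearMap.comp_apply, LinearMap.sum_apply, Submodule.mkQ_apply,
        Submodule.mapQ_apply, LinearMap.id_apply]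
      conv_rhs => rw [← this]
      exact (map_sum (Submodule.mkQ _) _ _).symm
    rw [this, ExtM.pre_id]
  have hk : ∀ k, ∃ a, a ∉ P ∧ a • ExtM.pre (mapQuot I (i k)) z = 0 := by
    intro k
    obtain ⟨a, ha⟩ := H k hP (ExtM.pre (mapQuot I (i k)) z)
    rcases ha with ⟨ha, h0⟩ | ⟨ha, h0⟩
    · rw [← map_smul, (hz a).mp ha, map_zero] at h0
      exact absurd rfl h0
    · exact ⟨a, ha, h0⟩
  choose a ha h0 using hk
  classical
  have hprod : (∏ k, a k) ∈ P := by
    rw [hz, hsum, Finset.smul_sum]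
    refine Finset.sum_eq_zero fun k _ => ?_
    rw [← map_smul, ← Finset.prod_erase_mul _ _ (Finset.mem_univ k), mul_smul, h0, smul_zero,
      map_zero]
  obtain ⟨k, -, hk⟩ := hP.prod_mem_iff.mp hprod
  exact ha k hk

/-- The ring `R`, regarded as an algebra over itself through the iterated Frobenius. -/
def Frob (R : Type u) (_p _e : ℕ) : Type u := R

variable (p e : ℕ)

instance : CommRing (Frob R p e) := ‹CommRing R›

instance [ExpChar R p] : Algebra R (Frob R p e) := (iterateFrobenius R p e).toAlgebra

lemma regOn_frob [ExpChar R p] : RegOn R (Frob R p e) := by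
  intro xs hxs
  refine (AddEquiv.isWeaklyRegular_congr (e := AddEquiv.refl R) (M := Frob R p e) (M₂ := R)
    (as := xs) (bs := xs.map (· ^ p ^ e)) ?_).mpr (isWeaklyRegular_map_pow xs (p ^ e) hxs)
  rw [List.forall₂_map_right_iff, List.forall₂_same]
  intro r _ x
  rfl

/-- Passing from `ω / I^[q] ω` to the modules of a Frobenius decomposition. -/
theorem exists_mem_associatedPrimes_of_frobenius [IsNoetherianRing R] [ExpChar R p] {t : ℕ}
    (M : Fin t → Type u) [∀ i, AddCommGroup (M i)] [∀ i, Module R (M i)]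
    [∀ i, Module.Finite R (M i)] (m : Fin t → ℕ) (ψ : R ≃+ ⨁ i : Fin t, (Fin (m i) → M i))
    (hψ : ∀ r y : R, ψ (r ^ p ^ e * y) = r • ψ y) {ω : Type u} [AddCommGroup ω] [Module R ω]
    (hω : Dualizing R ω) (I : Ideal R) {n : ℕ} {P : Ideal R}
    (hP : P ∈ associatedPrimes R
      (ExtM R (ω ⧸ (I.map (iterateFrobenius R p e) • ⊤ : Submodule R ω)) ω n)) :
    ∃ i, P ∈ associatedPrimes R
      (ExtM R ((M i →ₗ[R] ω) ⧸ (I • ⊤ : Submodule R (M i →ₗ[R] ω))) ω n) := by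
  let Ψ : Frob R p e ≃ₗ[R] ⨁ i : Fin t, (Fin (m i) → M i) :=
    { ψ with map_smul' := fun r y => hψ r y }
  have : Module.Finite R (Frob R p e) := Module.Finite.equiv Ψ.symm
  have : IsNoetherianRing (Frob R p e) := ‹IsNoetherianRing R›
  let mod : Module (Frob R p e) ω := ‹Module R ω›
  have hω' : Dualizing (Frob R p e) ω := hω
  have hP' : P ∈ associatedPrimes (Frob R p e) (ExtM (Frob R p e)
      (ω ⧸ (I.map (algebraMap R (Frob R p e)) • ⊤ : Submodule (Frob R p e) ω)) ω n) := hP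
  have h1 := hω.comap_mem_associatedPrimes (regOn_frob p e) hω' I hP'
  have hcomap : P.comap (algebraMap R (Frob R p e)) = P := by
    have := hP.1
    ext a
    exact this.pow_mem_iff_mem (p ^ e) (pow_pos (expChar_pos R p) e)
  replace h1 := Set.mem_of_eq_of_mem hcomap.symm h1
  obtain ⟨⟨i, k⟩, hk⟩ := exists_mem_associatedPrimes_of_sum (κ := Σ i : Fin t, Fin (m i))
    (L := fun k => M k.1 →ₗ[R] ω)
    (fun k => LinearMap.lcomp R ω (LinearMap.proj k.2 ∘ₗ DirectSum.component R (Fin t)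
      (fun i => Fin (m i) → M i) k.1 ∘ₗ Ψ.toLinearMap))
    (fun k => LinearMap.lcomp R ω (Ψ.symm.toLinearMap ∘ₗ DirectSum.lof R (Fin t)
      (fun i => Fin (m i) → M i) k.1 ∘ₗ LinearMap.single R (fun _ => M k.1) k.2)) (by
    refine LinearMap.ext fun φ => LinearMap.ext fun x => ?_
    obtain ⟨x, rfl⟩ := Ψ.symm.surjective x
    simp only [LinearMap.sum_apply, LinearMap.comp_apply, LinearMap.lcomp_apply,
      LinearEquiv.coe_coe, LinearEquiv.apply_symm_apply, LinearMap.id_apply]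
    rw [← map_sum, ← map_sum]
    congr 2
    rw [Fintype.sum_sigma]
    conv_rhs => rw [← DirectSum.sum_univ_of x]
    refine Finset.sum_congr rfl fun i _ => ?_
    refine (map_sum (DirectSum.lof R (Fin t) (fun i => Fin (m i) → M i) i)
      (fun k => Pi.single k (x i k)) Finset.univ).symm.trans ?_
    exact congrArg _ (Finset.univ_sum_single (x i))) I h1
  exact ⟨i, hk⟩

end Frobenius

section IndComparison

variable {R : Type u} [CommRing R] (I : Ideal R)

/-- The transition map `W / I^l W → W / I^k W` for `k ≤ l`. -/
abbrev tr (W : Type u) [AddCommGroup W] [Module R W] {k l : ℕ} (h : k ≤ l) :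
    (W ⧸ (I ^ l • ⊤ : Submodule R W)) →ₗ[R] (W ⧸ (I ^ k • ⊤ : Submodule R W)) :=
  Submodule.factor (Submodule.smul_mono_left (Ideal.pow_le_pow_right h))

variable {I} {W : Type u} [AddCommGroup W] [Module R W]

lemma tr_comp_tr {k l m : ℕ} (h : k ≤ l) (h' : l ≤ m) :
    tr I W h ∘ₗ tr I W h' = tr I W (h.trans h') :=
  Submodule.linearMap_qext _ (LinearMap.ext fun _ => rfl)

/-- The annihilator of the image of `y` in the colimit of `Ext^n(W / I^l W, V)` over `l`. -/
def IndAnn {V : Type u} [AddCommGroup V] [Module R V] {k n : ℕ}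
    (y : ExtM R (W ⧸ (I ^ k • ⊤ : Submodule R W)) V n) (a : R) : Prop :=
  ∃ (l : ℕ) (h : k ≤ l), a • ExtM.pre (tr I W h) y = 0

lemma pre_tr_pre_tr {V : Type u} [AddCommGroup V] [Module R V] {k l m n : ℕ} (h : k ≤ l)
    (h' : l ≤ m) (y : ExtM R (W ⧸ (I ^ k • ⊤ : Submodule R W)) V n) :
    ExtM.pre (tr I W h') (ExtM.pre (tr I W h) y) = ExtM.pre (tr I W (h.trans h')) y := by
  rw [ExtM.pre_pre, tr_comp_tr]

lemma smul_pre_tr_of_le {V : Type u} [AddCommGroup V] [Module R V] {k l m n : ℕ} {h : k ≤ l}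
    (h' : l ≤ m) {y : ExtM R (W ⧸ (I ^ k • ⊤ : Submodule R W)) V n} {a : R}
    (hy : a • ExtM.pre (tr I W h) y = 0) : a • ExtM.pre (tr I W (h.trans h')) y = 0 := by
  rw [← pre_tr_pre_tr h h', ← map_smul, hy, map_zero]

lemma indAnn_pre_iff {V : Type u} [AddCommGroup V] [Module R V] {k l n : ℕ} (h : k ≤ l)
    (y : ExtM R (W ⧸ (I ^ k • ⊤ : Submodule R W)) V n) (a : R) :
    IndAnn (ExtM.pre (tr I W h) y) a ↔ IndAnn y a := by
  constructor
  · rintro ⟨m, hm, ha⟩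
    rw [pre_tr_pre_tr] at ha
    exact ⟨m, _, ha⟩
  · rintro ⟨m, hm, ha⟩
    refine ⟨max l m, le_max_left _ _, ?_⟩
    rw [pre_tr_pre_tr]
    exact smul_pre_tr_of_le (le_max_right l m) ha

/-- The adjunction `Hom(R / I^k, Hom(W, V)) ≃ Hom(W / I^k W, V)`. -/
def adj (k : ℕ) (W V : Type u) [AddCommGroup W] [Module R W] [AddCommGroup V] [Module R V] :
    ((R ⧸ (I ^ k • ⊤ : Submodule R R)) →ₗ[R] (W →ₗ[R] V)) ≃ₗ[R]
      ((W ⧸ (I ^ k • ⊤ : Submodule R W)) →ₗ[R] V) where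
  toFun φ := Submodule.liftQ _ (φ (Submodule.Quotient.mk 1)) (by
    rw [Submodule.smul_le]
    intro r hr w _
    have : r • (Submodule.Quotient.mk 1 : R ⧸ (I ^ k • ⊤ : Submodule R R)) = 0 := by
      rw [← Submodule.Quotient.mk_smul, Submodule.Quotient.mk_eq_zero]
      exact Submodule.smul_mem_smul hr trivial
    rw [LinearMap.mem_ker, map_smul, ← LinearMap.smul_apply, ← map_smul, this, map_zero,
      LinearMap.zero_apply])
  invFun ψ := Submodule.liftQ _ (LinearMap.toSpanSingleton R _ (ψ ∘ₗ Submodule.mkQ _)) (by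
    rw [Submodule.smul_le]
    intro r hr a _
    rw [LinearMap.mem_ker, LinearMap.toSpanSingleton_apply]
    ext w
    simp only [smul_eq_mul, LinearMap.smul_apply, LinearMap.comp_apply, LinearMap.zero_apply]
    rw [← map_smul, ← map_smul, mul_smul, Submodule.mkQ_apply, (Submodule.Quotient.mk_eq_zero _).mpr,
      map_zero]
    exact Submodule.smul_mem_smul hr trivial)
  map_add' φ φ' := Submodule.linearMap_qext _ (LinearMap.ext fun _ => by simp)
  map_smul' r φ := Submodule.linearMap_qext _ (LinearMap.ext fun _ => by simp)
  left_inv φ := Submodule.linearMap_qext _ (LinearMap.ext_ring (by ext w; simp))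
  right_inv ψ := Submodule.linearMap_qext _ (LinearMap.ext fun w =>
    (LinearMap.congr_fun (one_smul R (ψ ∘ₗ Submodule.mkQ _)) w))

lemma adj_tr {k l : ℕ} (h : k ≤ l) {V : Type u} [AddCommGroup V] [Module R V]
    (φ : (R ⧸ (I ^ k • ⊤ : Submodule R R)) →ₗ[R] (W →ₗ[R] V)) :
    adj l W V (φ ∘ₗ tr I R h) = adj k W V φ ∘ₗ tr I W h :=
  Submodule.linearMap_qext _ (LinearMap.ext fun _ => rfl)

lemma adj_comp {k : ℕ} {V V' : Type u} [AddCommGroup V] [Module R V] [AddCommGroup V']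
    [Module R V'] (g : V →ₗ[R] V')
    (φ : (R ⧸ (I ^ k • ⊤ : Submodule R R)) →ₗ[R] (W →ₗ[R] V)) :
    adj k W V' (g.compRight R ∘ₗ φ) = g ∘ₗ adj k W V φ :=
  Submodule.linearMap_qext _ (LinearMap.ext fun _ => rfl)

lemma adj_lcomp {k : ℕ} {W' V : Type u} [AddCommGroup V] [Module R V] [AddCommGroup W']
    [Module R W'] (f : W' →ₗ[R] W)
    (φ : (R ⧸ (I ^ k • ⊤ : Submodule R R)) →ₗ[R] (W →ₗ[R] V)) :
    adj k W' V (LinearMap.lcomp R V f ∘ₗ φ) = adj k W V φ ∘ₗ mapQuot (I ^ k) f :=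
  Submodule.linearMap_qext _ (LinearMap.ext fun _ => rfl)

/-- By Artin–Rees, a map from a submodule killed by a power of `I` extends to an injective module
after shrinking. -/
lemma exists_extend_tr [IsNoetherianRing R] {K F E : Type u} [AddCommGroup K] [Module R K]
    [AddCommGroup F] [Module R F] [Module.Finite R F] [AddCommGroup E] [Module R E]
    [Module.Injective R E] {f : K →ₗ[R] F} (hf : Function.Injective f) {k : ℕ}
    (g : (K ⧸ (I ^ k • ⊤ : Submodule R K)) →ₗ[R] E) :
    ∃ (l : ℕ) (h : k ≤ l) (g' : (F ⧸ (I ^ l • ⊤ : Submodule R F)) →ₗ[R] E),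
      g' ∘ₗ mapQuot (I ^ l) f = g ∘ₗ tr I K h := by
  obtain ⟨c, hc⟩ := I.exists_pow_inf_eq_pow_smul (LinearMap.range f)
  let N : Submodule R K := (I ^ (c + k) • ⊤ : Submodule R F).comap f
  have hN : N ≤ (I ^ k • ⊤ : Submodule R K) := by
    intro x hx
    have h1 : f x ∈ (I ^ k • ⊤ : Submodule R K).map f := by
      rw [Submodule.map_smul'', Submodule.map_top]
      have h2 : f x ∈ (I ^ (c + k) • ⊤ ⊓ LinearMap.range f : Submodule R F) :=
        ⟨hx, LinearMap.mem_range_self f x⟩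
      rw [hc (c + k) (by omega), Nat.add_sub_cancel_left] at h2
      exact Submodule.smul_mono le_rfl inf_le_right h2
    obtain ⟨y, hy, hxy⟩ := h1
    exact hf hxy ▸ hy
  let j : (K ⧸ N) →ₗ[R] (F ⧸ (I ^ (c + k) • ⊤ : Submodule R F)) := Submodule.mapQ _ _ f le_rfl
  have hj : Function.Injective j := by
    rw [← LinearMap.ker_eq_bot, Submodule.ker_mapQ, Submodule.mkQ_map_self]
  obtain ⟨g', hg'⟩ := Module.Injective.out j hj (g ∘ₗ Submodule.factor hN)
  refine ⟨c + k, by omega, g', ?_⟩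
  refine Submodule.linearMap_qext _ (LinearMap.ext fun x => ?_)
  exact hg' (Submodule.Quotient.mk x)

lemma ext_hom_eq_zero {X E : Type u} [AddCommGroup X] [Module R X] [AddCommGroup E] [Module R E]
    [Module.Injective R E] {m n : ℕ} (x : ExtM R X ((Fin m → R) →ₗ[R] E) (n + 1)) : x = 0 := by
  have e := ExtM.postEquiv (M := (Fin m → R) →ₗ[R] E) (M' := Fin m → E) (N := X)
    ((Pi.basisFun R (Fin m)).constr R).symm (n + 1)
  exact e.injective ((ExtM.eq_zero_of_injective _).trans (map_zero e).symm)

/-- Higher `Ext` of `R / I^k` into `Hom(W, E)` vanishes in the limit, for injective `E`. -/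
lemma exists_pre_tr_eq_zero [IsNoetherianRing R] {E : Type u} [AddCommGroup E] [Module R E]
    [Module.Injective R E] (n : ℕ) (W : Type u) [AddCommGroup W] [Module R W] [Module.Finite R W]
    {k : ℕ} (y : ExtM R (R ⧸ (I ^ k • ⊤ : Submodule R R)) (W →ₗ[R] E) (n + 1)) :
    ∃ (l : ℕ) (h : k ≤ l), ExtM.pre (tr I R h) y = 0 := by
  induction n generalizing W with
  | zero =>
    obtain ⟨m, π, hπ⟩ := Module.Finite.exists_fin' R W
    have : Subsingleton (ExtM R W E 1) := subsingleton_of_forall_eq 0 ExtM.eq_zero_of_injective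
    have hs := (SES.of_ker hπ).homContra (N := E)
    obtain ⟨y, rfl⟩ := (hs.exact_δ'_post y).mp (ext_hom_eq_zero _)
    obtain ⟨φ, rfl⟩ := ExtM.ofHom.surjective y
    obtain ⟨l, h, g', hg'⟩ := exists_extend_tr (LinearMap.ker π).injective_subtype (adj k _ E φ)
    refine ⟨l, h, ?_⟩
    rw [SES.pre_δ', ExtM.pre_ofHom, hs.exact_post_δ']
    refine ⟨ExtM.ofHom ((adj l _ E).symm g'), ?_⟩
    rw [ExtM.post_ofHom]
    congr 1
    apply (adj l _ E).injective
    rw [adj_lcomp, LinearEquiv.apply_symm_apply, hg', adj_tr]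
  | succ n ih =>
    obtain ⟨m, π, hπ⟩ := Module.Finite.exists_fin' R W
    have : Subsingleton (ExtM R W E 1) := subsingleton_of_forall_eq 0 ExtM.eq_zero_of_injective
    have hs := (SES.of_ker hπ).homContra (N := E)
    obtain ⟨y, rfl⟩ := (hs.exact_δ'_post y).mp (ext_hom_eq_zero _)
    obtain ⟨l, h, hy⟩ := ih _ y
    exact ⟨l, h, by rw [SES.pre_δ', hy, map_zero]⟩

/-- Comparison of `Ext^n(R / I^k, Hom(W, Z))` and `Ext^n(W / I^k W, Z)` in the limit. -/
lemma exists_indAnn_iff [IsNoetherianRing R] {W : Type u} [AddCommGroup W] [Module R W]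
    [Module.Finite R W] (n : ℕ) {Z : Type u} [AddCommGroup Z] [Module R Z] (hZ : Acyc R W Z)
    {k : ℕ} (y : ExtM R (R ⧸ (I ^ k • ⊤ : Submodule R R)) (W →ₗ[R] Z) n) :
    ∃ (l : ℕ) (z : ExtM R (W ⧸ (I ^ l • ⊤ : Submodule R W)) Z n),
      ∀ a, IndAnn z a ↔ IndAnn y a := by
  induction n generalizing Z k with
  | zero =>
    obtain ⟨φ, rfl⟩ := ExtM.ofHom.surjective y
    refine ⟨k, ExtM.ofHom (adj k W Z φ), fun a => ?_⟩
    refine exists_congr fun l => exists_congr fun h => ?_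
    rw [ExtM.pre_ofHom, ExtM.pre_ofHom, ← map_smul, ← map_smul, LinearEquiv.map_eq_zero_iff,
      LinearEquiv.map_eq_zero_iff, ← adj_tr, ← map_smul, LinearEquiv.map_eq_zero_iff]
  | succ n ih =>
    obtain ⟨E, _, _, _, f, hf⟩ := exists_injective R Z
    have hs := SES.of_range hf
    have := hZ 1 one_pos
    have hs' := hs.homCongr (N := W)
    obtain ⟨k', hk', hy'⟩ := exists_pre_tr_eq_zero n W (ExtM.post (f.compRight R) y)
    simp only [← indAnn_pre_iff hk' y]
    rw [ExtM.pre_post] at hy'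
    obtain ⟨y', hyy⟩ := (hs'.exact_δ'_post _).mp hy'
    rw [← hyy]
    cases n with
    | zero =>
      obtain ⟨φ, rfl⟩ := ExtM.ofHom.surjective y'
      refine ⟨k', hs.δ' (ExtM.ofHom (adj k' W _ φ)), fun a => ?_⟩
      refine exists_congr fun l => exists_congr fun h => ?_
      rw [SES.pre_δ', SES.pre_δ', ExtM.pre_ofHom, ExtM.pre_ofHom, ← adj_tr, ← map_smul,
        ← map_smul, ← map_smul, ← map_smul, ← map_smul, hs.exact_post_δ', hs'.exact_post_δ']
      constructor
      · rintro ⟨ψ, hψ⟩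
        obtain ⟨ψ, rfl⟩ := ExtM.ofHom.surjective ψ
        refine ⟨ExtM.ofHom ((adj l W E).symm ψ), ?_⟩
        rw [ExtM.post_ofHom] at hψ ⊢
        congr 1
        apply (adj l W _).injective
        rw [adj_comp, LinearEquiv.apply_symm_apply]
        exact ExtM.ofHom.injective hψ
      · rintro ⟨ψ, hψ⟩
        obtain ⟨ψ, rfl⟩ := ExtM.ofHom.surjective ψ
        refine ⟨ExtM.ofHom (adj l W E ψ), ?_⟩
        rw [ExtM.post_ofHom] at hψ ⊢
        rw [← adj_comp, ExtM.ofHom.injective hψ]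
    | succ n =>
      obtain ⟨l, z, hz⟩ := ih (hZ.cosyzygy hs) y'
      refine ⟨l, hs.δ' z, fun a => Iff.trans ?_ ((hz a).trans ?_)⟩
      · refine exists_congr fun l => exists_congr fun h => ?_
        rw [SES.pre_δ', ← map_smul]
        refine ⟨fun h0 => ?_, fun h0 => by rw [h0, map_zero]⟩
        obtain ⟨w, hw⟩ := (hs.exact_post_δ' _).mp h0
        rw [← hw, ExtM.eq_zero_of_injective w, map_zero]
      · constructor
        · rintro ⟨l, h, h0⟩
          exact ⟨l, h, by rw [SES.pre_δ', ← map_smul, h0, map_zero]⟩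
        · rintro ⟨l, h, h0⟩
          rw [SES.pre_δ', ← map_smul] at h0
          obtain ⟨w, hw⟩ := (hs'.exact_post_δ' _).mp h0
          obtain ⟨m, hm, hw0⟩ := exists_pre_tr_eq_zero n W w
          refine ⟨m, h.trans hm, ?_⟩
          rw [← pre_tr_pre_tr h hm, ← map_smul, ← hw, ExtM.pre_post, hw0, map_zero]

end IndComparison

section FrobeniusPowers

variable {R : Type u} [CommRing R] {I : Ideal R}

lemma exists_forall_smul_pre_tr [IsNoetherianRing R] {W V : Type u} [AddCommGroup W] [Module R W]
    [AddCommGroup V] [Module R V] {l n : ℕ} (z : ExtM R (W ⧸ (I ^ l • ⊤ : Submodule R W)) V n)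
    {P : Ideal R} (hP : ∀ a ∈ P, IndAnn z a) :
    ∃ (m : ℕ) (h : l ≤ m), ∀ a ∈ P, a • ExtM.pre (tr I W h) z = 0 := by
  obtain ⟨s, rfl⟩ := IsNoetherian.noetherian P
  choose! f hf hz using fun a (ha : a ∈ s) => hP a (Submodule.subset_span ha)
  refine ⟨max l (s.sup f), le_max_left _ _, fun a ha => ?_⟩
  have h1 : Submodule.span R (s : Set R) ≤ LinearMap.ker (LinearMap.toSpanSingleton R _
      (ExtM.pre (tr I W (le_max_left l (s.sup f))) z)) := by
    rw [Submodule.span_le]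
    intro b hb
    exact smul_pre_tr_of_le ((Finset.le_sup (f := f) hb).trans (le_max_right _ _)) (hz b hb)
  exact h1 ha

/-- An associated prime of the limit of the `Ext^n(R / I^k, R)` is associated to
`Ext^n(ω / I^[q] ω, ω)` for some Frobenius power `I^[q]`. -/
theorem Dualizing.exists_mem_associatedPrimes_frobenius [IsNoetherianRing R] {p : ℕ}
    [ExpChar R p] (hp : 1 < p) {ω : Type u} [AddCommGroup ω] [Module R ω] (hω : Dualizing R ω)
    {k n : ℕ} (y : ExtM R (R ⧸ (I ^ k • ⊤ : Submodule R R)) R n) {P : Ideal R} (hP : P.IsPrime)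
    (hy : ∀ a, a ∈ P ↔ IndAnn y a) :
    ∃ e : ℕ, P ∈ associatedPrimes R
      (ExtM R (ω ⧸ (I.map (iterateFrobenius R p e) • ⊤ : Submodule R ω)) ω n) := by
  have := hω.finite
  let θ : R ≃ₗ[R] (ω →ₗ[R] ω) := LinearEquiv.ofBijective (Algebra.linearMap R (Module.End R ω))
    hω.bijective
  obtain ⟨l, z, hz⟩ := exists_indAnn_iff n hω.acyc (ExtM.post θ.toLinearMap y)
  replace hz : ∀ a, a ∈ P ↔ IndAnn z a := by
    intro a
    rw [hz, hy]
    refine exists_congr fun l => exists_congr fun h => ?_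
    rw [ExtM.pre_post, ← map_smul (ExtM.post θ.toLinearMap)]
    exact ((ExtM.postEquiv (N := R ⧸ (I ^ l • ⊤ : Submodule R R)) θ n).map_eq_zero_iff).symm
  obtain ⟨m, hm, hkill⟩ := exists_forall_smul_pre_tr z fun a ha => (hz a).mp ha
  set J := I.map (iterateFrobenius R p m) with hJ
  have hJm : J ≤ I ^ m := by
    rw [hJ, Ideal.map_le_iff_le_comap]
    intro r hr
    rw [Ideal.mem_comap, iterateFrobenius_def]
    exact Ideal.pow_le_pow_right (Nat.lt_pow_self hp).le (Ideal.pow_mem_pow hr _)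
  have hIJ : I ≤ J.radical := fun r hr =>
    ⟨p ^ m, by rw [← iterateFrobenius_def]; exact Ideal.mem_map_of_mem _ hr⟩
  obtain ⟨c, hc⟩ := Ideal.exists_pow_le_of_le_radical_of_fg hIJ (IsNoetherian.noetherian I)
  let φ : (ω ⧸ (J • ⊤ : Submodule R ω)) →ₗ[R] (ω ⧸ (I ^ m • ⊤ : Submodule R ω)) :=
    Submodule.factor (Submodule.smul_mono_left hJm)
  refine ⟨m, mem_associatedPrimes_iff.mpr ⟨hP, ExtM.pre φ (ExtM.pre (tr I ω hm) z), fun a =>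
    ⟨fun ha => by rw [← map_smul, hkill a ha, map_zero], fun ha => ?_⟩⟩⟩
  let φ' : (ω ⧸ (I ^ max c m • ⊤ : Submodule R ω)) →ₗ[R] (ω ⧸ (J • ⊤ : Submodule R ω)) :=
    Submodule.factor (Submodule.smul_mono_left
      ((Ideal.pow_le_pow_right (le_max_left c m)).trans hc))
  have hφ : tr I ω hm ∘ₗ φ ∘ₗ φ' = tr I ω (hm.trans (le_max_right c m)) :=
    Submodule.linearMap_qext _ (LinearMap.ext fun _ => rfl)
  rw [hz]
  refine ⟨max c m, hm.trans (le_max_right c m), ?_⟩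
  rw [← hφ, ← ExtM.pre_pre, ← ExtM.pre_pre, ← map_smul, ha, map_zero]

end FrobeniusPowers

section Bridge

open Limits

variable {R : Type u} [CommRing R]

/-- The `n`-cocycles of `Hom(P, Y)` for a projective resolution `P`. -/
def cocycles {X : ModuleCat.{u} R} (P : ProjectiveResolution X) (Y : ModuleCat.{u} R) (n : ℕ) :
    Submodule R (P.complex.X n ⟶ Y) where
  carrier := {c | P.complex.d (n + 1) n ≫ c = 0}
  add_mem' ha hb := by
    simp only [Set.mem_ofPred_eq] at *
    rw [Preadditive.comp_add, ha, hb, add_zero]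
  zero_mem' := by simp
  smul_mem' r c hc := by
    simp only [Set.mem_ofPred_eq] at *
    rw [Linear.comp_smul, hc, smul_zero]

lemma extMk_eq_zero_iff_next {X Y : ModuleCat.{u} R} (P : ProjectiveResolution X) {n : ℕ}
    (f : P.complex.X n ⟶ Y) (hf : P.complex.d (n + 1) n ≫ f = 0) :
    P.extMk f (n + 1) rfl hf = 0 ↔
      ∃ g : P.complex.X ((ComplexShape.down ℕ).next n) ⟶ Y, P.complex.d n _ ≫ g = f := by
  cases n with
  | succ n =>
    have h : (ComplexShape.down ℕ).next (n + 1) = n := ChainComplex.next_nat_succ n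
    rw [P.extMk_eq_zero_iff f (n + 2) rfl hf n rfl, h]
  | zero =>
    simp only [← P.extEquivCohomologyClass.apply_eq_iff_eq,
      ProjectiveResolution.extEquivCohomologyClass_extMk,
      ProjectiveResolution.extEquivCohomologyClass_zero,
      CochainComplex.HomComplex.CohomologyClass.mk_eq_zero_iff]
    rw [CochainComplex.HomComplex.Cocycle.toSingleMk_mem_coboundaries_iff _ _ _ _ _ 1 (by simp)]
    have hz : IsZero (P.cochainComplex.X 1) :=
      CochainComplex.isZero_of_isStrictlyLE _ 0 _
    have h0 : P.complex.d 0 ((ComplexShape.down ℕ).next 0) = 0 :=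
      P.complex.shape _ _ (by simp)
    constructor
    · rintro ⟨g, hg⟩
      refine ⟨0, ?_⟩
      rw [hz.eq_of_src g 0, comp_zero] at hg
      rw [comp_zero, ← cancel_epi (P.cochainComplexXIso (-(0 : ℕ)) 0 rfl).hom, comp_zero, hg]
    · rintro ⟨g, rfl⟩
      exact ⟨0, by simp⟩

/-- The `Ext` class of a cocycle. -/
noncomputable def cocycleToExt {X : ModuleCat.{u} R} (P : ProjectiveResolution X)
    (Y : ModuleCat.{u} R) (n : ℕ) : cocycles P Y n →ₗ[R] Abelian.Ext X Y n where
  toFun c := P.extMk c.1 (n + 1) rfl c.2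
  map_add' a b := (P.add_extMk a.1 b.1 (n + 1) rfl a.2 b.2).symm
  map_smul' r c := by
    have h := P.extMk_comp_mk₀ c.1 (n + 1) rfl c.2 (r • 𝟙 Y)
    simp only [Linear.comp_smul, Category.comp_id, Abelian.Ext.mk₀_smul, Abelian.Ext.comp_smul,
      Abelian.Ext.comp_mk₀_id] at h
    exact h.symm

lemma cocycleToExt_surjective {X : ModuleCat.{u} R} (P : ProjectiveResolution X)
    (Y : ModuleCat.{u} R) (n : ℕ) : Function.Surjective (cocycleToExt P Y n) := fun x => by
  obtain ⟨f, hf, h⟩ := P.extMk_surjective x (n + 1) rfl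
  exact ⟨⟨f, hf⟩, h⟩

/-- The complex `Hom(P, Y)`, as a chain complex in the opposite category. -/
noncomputable abbrev homComplex (P : ChainComplex (ModuleCat.{u} R) ℕ)
    (Y : ModuleCat.{u} R) : ChainComplex (ModuleCat.{u} R)ᵒᵖ ℕ :=
  (((linearYoneda R (ModuleCat.{u} R)).obj Y).rightOp.mapHomologicalComplex _).obj P

/-- The inclusion of the cocycles, in the opposite category. -/
noncomputable def cocyclesIncl {X : ModuleCat.{u} R} (P : ProjectiveResolution X)
    (Y : ModuleCat.{u} R) (n : ℕ) :
    (homComplex P.complex Y).X n ⟶ Opposite.op (ModuleCat.of R (cocycles P Y n)) :=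
  (ModuleCat.ofHom (cocycles P Y n).subtype :
    ModuleCat.of R (cocycles P Y n) ⟶ ModuleCat.of R (P.complex.X n ⟶ Y)).op

lemma d_comp_cocyclesIncl {X : ModuleCat.{u} R} (P : ProjectiveResolution X)
    (Y : ModuleCat.{u} R) (n : ℕ) :
    (homComplex P.complex Y).d (n + 1) n ≫ cocyclesIncl P Y n = 0 := by
  apply Quiver.Hom.unop_inj
  apply ModuleCat.hom_ext
  apply LinearMap.ext
  intro c
  exact c.2

/-- The class of a cocycle in the homology of `Hom(P, Y)`. -/
noncomputable def cocycleToHomology {X : ModuleCat.{u} R} (P : ProjectiveResolution X)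
    (Y : ModuleCat.{u} R) (n : ℕ) :
    ModuleCat.of R (cocycles P Y n) ⟶ ((homComplex P.complex Y).homology n).unop :=
  ((homComplex P.complex Y).homologyι n ≫ (homComplex P.complex Y).descOpcycles
    (cocyclesIncl P Y n) (n + 1) (by simp) (d_comp_cocyclesIncl P Y n)).unop

/-- The class of a cocycle in `extCat`. -/
noncomputable def cocycleToExtCat {X : ModuleCat.{u} R} (P : ProjectiveResolution X)
    (Y : ModuleCat.{u} R) (n : ℕ) : cocycles P Y n →ₗ[R] extCat R n X Y :=
  (cocycleToHomology P Y n ≫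
    (P.isoLeftDerivedObj ((linearYoneda R (ModuleCat.{u} R)).obj Y).rightOp n).hom.unop).hom

end Bridge

section Bridge

open Limits

variable {R : Type u} [CommRing R] {X : ModuleCat.{u} R} (P : ProjectiveResolution X)
  (Y : ModuleCat.{u} R) (n : ℕ)

lemma unop_pOpcycles_injective :
    Function.Injective ((homComplex P.complex Y).pOpcycles n).unop.hom :=
  (ModuleCat.mono_iff_injective _).1 inferInstance

lemma unop_homologyι_surjective :
    Function.Surjective ((homComplex P.complex Y).homologyι n).unop.hom :=
  (ModuleCat.epi_iff_surjective _).1 inferInstance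

/-- Cocycles, as elements of the object of opcycles in the opposite category. -/
noncomputable def cocycleToOpcycles :
    ModuleCat.of R (cocycles P Y n) ⟶ ((homComplex P.complex Y).opcycles n).unop :=
  ((homComplex P.complex Y).descOpcycles
    (cocyclesIncl P Y n) (n + 1) (by simp) (d_comp_cocyclesIncl P Y n)).unop

lemma cocycleToHomology_apply (c : cocycles P Y n) : (cocycleToHomology P Y n).hom c =
    ((homComplex P.complex Y).homologyι n).unop.hom ((cocycleToOpcycles P Y n).hom c) := rfl

lemma pOpcycles_cocycleToOpcycles (c : cocycles P Y n) :
    ((homComplex P.complex Y).pOpcycles n).unop.hom ((cocycleToOpcycles P Y n).hom c) = c.1 := by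
  have h := (homComplex P.complex Y).p_descOpcycles (cocyclesIncl P Y n) (n + 1) (by simp)
    (d_comp_cocyclesIncl P Y n)
  exact congr(($h).unop.hom c)

lemma cocycleToOpcycles_surjective : Function.Surjective (cocycleToOpcycles P Y n).hom := by
  intro z
  refine ⟨⟨((homComplex P.complex Y).pOpcycles n).unop.hom z, ?_⟩, ?_⟩
  · have h := (homComplex P.complex Y).d_pOpcycles (n + 1) n
    exact congr(($h).unop.hom z)
  · exact unop_pOpcycles_injective P Y n (pOpcycles_cocycleToOpcycles P Y n _)

lemma cocycleToHomology_eq_zero_iff (c : cocycles P Y n) :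
    (cocycleToHomology P Y n).hom c = 0 ↔
      ∃ g : P.complex.X ((ComplexShape.down ℕ).next n) ⟶ Y, P.complex.d n _ ≫ g = c.1 := by
  let K := homComplex P.complex Y
  have hex : (ShortComplex.mk _ _ (K.homologyι_comp_fromOpcycles n
      ((ComplexShape.down ℕ).next n))).Exact :=
    ShortComplex.exact_of_f_is_kernel _ (K.homologyIsKernel n _ rfl)
  have hex' := (ShortComplex.moduleCat_exact_iff _).1 hex.unop
  have hd : ∀ g, (K.pOpcycles n).unop.hom ((K.fromOpcycles n
      ((ComplexShape.down ℕ).next n)).unop.hom g) = (K.d n _).unop.hom g := fun g => by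
    have h := K.p_fromOpcycles n ((ComplexShape.down ℕ).next n)
    exact congr(($h).unop.hom g)
  rw [cocycleToHomology_apply]
  constructor
  · intro h
    obtain ⟨g, hg⟩ := hex' _ h
    refine ⟨g, ?_⟩
    rw [← pOpcycles_cocycleToOpcycles P Y n c]
    refine (hd g).symm.trans ?_
    exact congrArg _ hg
  · rintro ⟨g, hg⟩
    have h1 : (cocycleToOpcycles P Y n).hom c = (K.fromOpcycles n
        ((ComplexShape.down ℕ).next n)).unop.hom g := by
      apply unop_pOpcycles_injective P Y n
      rw [pOpcycles_cocycleToOpcycles, ← hg]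
      exact (hd g).symm
    rw [h1]
    have h := K.homologyι_comp_fromOpcycles n ((ComplexShape.down ℕ).next n)
    exact congr(($h).unop.hom g)

lemma cocycleToExtCat_surjective : Function.Surjective (cocycleToExtCat P Y n) := by
  have h1 : Function.Surjective (cocycleToHomology P Y n).hom :=
    (unop_homologyι_surjective P Y n).comp (cocycleToOpcycles_surjective P Y n)
  have h2 := (P.isoLeftDerivedObj ((linearYoneda R
    (ModuleCat.{u} R)).obj Y).rightOp n).unop.toLinearEquiv.surjective
  exact h2.comp h1

lemma cocycleToExtCat_eq_zero_iff (c : cocycles P Y n) :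
    cocycleToExtCat P Y n c = 0 ↔
      ∃ g : P.complex.X ((ComplexShape.down ℕ).next n) ⟶ Y, P.complex.d n _ ≫ g = c.1 := by
  rw [← cocycleToHomology_eq_zero_iff]
  exact (P.isoLeftDerivedObj ((linearYoneda R
    (ModuleCat.{u} R)).obj Y).rightOp n).unop.toLinearEquiv.map_eq_zero_iff

lemma ker_cocycleToExtCat :
    LinearMap.ker (cocycleToExtCat P Y n) = LinearMap.ker (cocycleToExt P Y n) := by
  ext c
  rw [LinearMap.mem_ker, LinearMap.mem_ker, cocycleToExtCat_eq_zero_iff]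
  exact (extMk_eq_zero_iff_next P c.1 c.2).symm

/-- The comparison of the two models of `Ext`, computed by a projective resolution. -/
noncomputable def extCatEquivAux : extCat R n X Y ≃ₗ[R] Abelian.Ext X Y n :=
  ((cocycleToExtCat P Y n).quotKerEquivOfSurjective (cocycleToExtCat_surjective P Y n)).symm ≪≫ₗ
    Submodule.quotEquivOfEq _ _ (ker_cocycleToExtCat P Y n) ≪≫ₗ
    (cocycleToExt P Y n).quotKerEquivOfSurjective (cocycleToExt_surjective P Y n)

lemma extCatEquivAux_cocycleToExtCat (c : cocycles P Y n) :
    extCatEquivAux P Y n (cocycleToExtCat P Y n c) = cocycleToExt P Y n c := by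
  have : ((cocycleToExtCat P Y n).quotKerEquivOfSurjective
      (cocycleToExtCat_surjective P Y n)).symm (cocycleToExtCat P Y n c) =
      Submodule.Quotient.mk c := by
    rw [LinearEquiv.symm_apply_eq]
    rfl
  simp only [extCatEquivAux, LinearEquiv.trans_apply, this]
  rfl

variable {P Y} in
/-- Pullback of cocycles along a morphism of resolutions. -/
def cocyclesMap {X' : ModuleCat.{u} R} {P' : ProjectiveResolution X'} {f : X' ⟶ X}
    (φ : ProjectiveResolution.Hom P' P f) (c : cocycles P Y n) : cocycles P' Y n :=
  ⟨φ.hom.f n ≫ c.1, by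
    have := c.2
    change _ ≫ _ = 0 at this
    change _ ≫ _ ≫ _ = 0
    rw [← φ.hom.comm_assoc, this, comp_zero]⟩

variable {P Y} in
lemma cocycleToExtCat_cocyclesMap {X' : ModuleCat.{u} R} {P' : ProjectiveResolution X'}
    {f : X' ⟶ X} (φ : ProjectiveResolution.Hom P' P f) (c : cocycles P Y n) :
    cocycleToExtCat P' Y n (cocyclesMap n φ c) =
      (((Ext R (ModuleCat.{u} R) n).map f.op).app Y).hom (cocycleToExtCat P Y n c) := by
  let F := ((linearYoneda R (ModuleCat.{u} R)).obj Y).rightOp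
  let ψ := (F.mapHomologicalComplex (ComplexShape.down ℕ)).map φ.hom
  have h1 : (cocycleToHomology P' Y n).hom (cocyclesMap n φ c) =
      (HomologicalComplex.homologyMap ψ n).unop.hom ((cocycleToHomology P Y n).hom c) := by
    have h3 := HomologicalComplex.homologyι_naturality ψ n
    have h4 := HomologicalComplex.p_opcyclesMap ψ n
    have h5 : (cocycleToOpcycles P' Y n).hom (cocyclesMap n φ c) =
        (HomologicalComplex.opcyclesMap ψ n).unop.hom ((cocycleToOpcycles P Y n).hom c) := by
      apply unop_pOpcycles_injective
      rw [pOpcycles_cocycleToOpcycles]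
      refine Eq.trans ?_ congr(($h4).unop.hom ((cocycleToOpcycles P Y n).hom c)).symm
      exact congrArg (fun z => φ.hom.f n ≫ z) (pOpcycles_cocycleToOpcycles P Y n c).symm
    rw [cocycleToHomology_apply, h5, cocycleToHomology_apply]
    exact congr(($h3).unop.hom ((cocycleToOpcycles P Y n).hom c)).symm
  have h2 := ProjectiveResolution.isoLeftDerivedObj_hom_naturality f P' P φ.hom
    φ.hom_f_zero_comp_π_f_zero F n
  refine (congrArg (P'.isoLeftDerivedObj F n).hom.unop.hom h1).trans ?_
  exact congr(($h2).unop.hom ((cocycleToHomology P Y n).hom c)).symm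

variable {P Y} in
lemma extCatEquivAux_map {X' : ModuleCat.{u} R} {P' : ProjectiveResolution X'}
    {f : X' ⟶ X} (φ : ProjectiveResolution.Hom P' P f) (x : extCat R n X Y) :
    extCatEquivAux P' Y n ((((Ext R (ModuleCat.{u} R) n).map f.op).app Y).hom x) =
      (Abelian.Ext.mk₀ f).comp (extCatEquivAux P Y n x) (zero_add n) := by
  obtain ⟨c, rfl⟩ := cocycleToExtCat_surjective P Y n x
  rw [← cocycleToExtCat_cocyclesMap n φ c, extCatEquivAux_cocycleToExtCat,
    extCatEquivAux_cocycleToExtCat]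
  exact (ProjectiveResolution.mk₀_comp_extMk c.1 (n + 1) rfl c.2 φ).symm

/-- The comparison of the two models of `Ext`. -/
noncomputable def extCatEquiv (X Y : ModuleCat.{u} R) (n : ℕ) :
    extCat R n X Y ≃ₗ[R] Abelian.Ext X Y n :=
  extCatEquivAux (projectiveResolution X) Y n

/-- Contravariant functoriality of `extCat`. -/
noncomputable def extCatMap {X X' : ModuleCat.{u} R} (f : X' ⟶ X) (Y : ModuleCat.{u} R) (n : ℕ) :
    extCat R n X Y →ₗ[R] extCat R n X' Y :=
  (((Ext R (ModuleCat.{u} R) n).map f.op).app Y).hom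

lemma extCatEquiv_extCatMap {X X' : ModuleCat.{u} R} (f : X' ⟶ X) {Y : ModuleCat.{u} R} {n : ℕ}
    (x : extCat R n X Y) : extCatEquiv X' Y n (extCatMap f Y n x) =
      (Abelian.Ext.mk₀ f).comp (extCatEquiv X Y n x) (zero_add n) :=
  extCatEquivAux_map n (P' := projectiveResolution X')
    { hom := ProjectiveResolution.lift f _ _
      hom_f_zero_comp_π_f_zero := ProjectiveResolution.lift_commutes_zero f _ _ } x

end Bridge

section LocalCohomology

open Limits Opposite localCohomology

variable {R : Type u} [CommRing R] (I : Ideal R) (n : ℕ) (Y : ModuleCat.{u} R)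

/-- The system of modules `Ext^n(R / I^k, Y)`. -/
noncomputable abbrev extSystem : (ℕᵒᵖ)ᵒᵖ ⥤ ModuleCat.{u} R :=
  diagram (idealPowersDiagram I) n ⋙ (evaluation _ _).obj Y

/-- Local cohomology as a colimit of modules. -/
noncomputable def localCohomologyCocone : Cocone (extSystem I n Y) :=
  ((evaluation _ _).obj Y).mapCocone
    (@colimit.cocone _ _ _ _ _ (hasColimitDiagram.{u, 0} (idealPowersDiagram I) n))

/-- The colimit property of local cohomology. -/
noncomputable def localCohomologyIsColimit : IsColimit (localCohomologyCocone I n Y) :=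
  isColimitOfPreserves ((evaluation _ _).obj Y)
    (@colimit.isColimit _ _ _ _ _ (hasColimitDiagram.{u, 0} (idealPowersDiagram I) n))

/-- The structure map from `Ext^n(R / I^k, Y)` to local cohomology. -/
noncomputable def toLocalCohomology (k : ℕ) :
    extCat R n (ModuleCat.of R (R ⧸ I ^ k)) Y →ₗ[R] (localCohomology I n).obj Y :=
  ((localCohomologyCocone I n Y).ι.app (op (op k))).hom

variable {I n Y}

instance : PreservesFilteredColimitsOfSize.{0, 0} (forget (ModuleCat.{u} R)) :=
  preservesSmallestFilteredColimits_of_preservesFilteredColimits _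

lemma exists_toLocalCohomology_eq (x : (localCohomology I n).obj Y) :
    ∃ k y, toLocalCohomology I n Y k y = x := by
  obtain ⟨j, y, hy⟩ := Concrete.isColimit_exists_rep _ (localCohomologyIsColimit I n Y) x
  exact ⟨j.unop.unop, y, hy⟩

lemma toLocalCohomology_eq_zero_iff {k : ℕ} (y : extCat R n (ModuleCat.of R (R ⧸ I ^ k)) Y) :
    toLocalCohomology I n Y k y = 0 ↔ ∃ (l : ℕ) (h : k ≤ l),
      extCatMap (ModuleCat.ofHom
        (Submodule.mapQ (I ^ l) (I ^ k) LinearMap.id (Ideal.pow_le_pow_right h))) Y n y = 0 := by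
  constructor
  · intro h
    obtain ⟨l, f, g, hfg⟩ := Concrete.isColimit_exists_of_rep_eq _
      (localCohomologyIsColimit I n Y) (i := op (op k)) (j := op (op k)) y 0
      (h.trans (map_zero (toLocalCohomology I n Y k)).symm)
    refine ⟨l.unop.unop, f.unop.unop.down.down, ?_⟩
    refine Eq.trans ?_ (hfg.trans (map_zero ((extSystem I n Y).map g).hom))
    rfl
  · rintro ⟨l, h, hy⟩
    have hw := (localCohomologyCocone I n Y).w
      (show op (op k) ⟶ op (op l) from (homOfLE h).op.op)
    refine (congr(($hw).hom y)).symm.trans ?_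
    refine Eq.trans ?_ (map_zero (toLocalCohomology I n Y l))
    exact congrArg (toLocalCohomology I n Y l) hy

/-- The identification `Ext^n(R / I^k, Y) ≃ Ext^n(R / I^k R, Y)` between the two models of `Ext`. -/
noncomputable def extCatQuotEquiv (I : Ideal R) (n k : ℕ) (V : Type u) [AddCommGroup V]
    [Module R V] : extCat R n (ModuleCat.of R (R ⧸ I ^ k)) (ModuleCat.of R V) ≃ₗ[R]
      ExtM R (R ⧸ (I ^ k • ⊤ : Submodule R R)) V n :=
  extCatEquiv _ _ n ≪≫ₗ ExtM.preEquiv (Submodule.quotEquivOfEq (I ^ k • ⊤ : Submodule R R) (I ^ k)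
    (by simp)) n

lemma extCatQuotEquiv_map {V : Type u} [AddCommGroup V] [Module R V] {k l : ℕ} (h : k ≤ l)
    (y : extCat R n (ModuleCat.of R (R ⧸ I ^ k)) (ModuleCat.of R V)) :
    extCatQuotEquiv I n l V (extCatMap (ModuleCat.ofHom
        (Submodule.mapQ (I ^ l) (I ^ k) LinearMap.id (Ideal.pow_le_pow_right h)))
          (ModuleCat.of R V) n y) = ExtM.pre (tr I R h) (extCatQuotEquiv I n k V y) := by
  simp only [extCatQuotEquiv, LinearEquiv.trans_apply, extCatEquiv_extCatMap]
  change ExtM.pre _ (ExtM.pre _ _) = ExtM.pre _ (ExtM.pre _ _)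
  rw [ExtM.pre_pre, ExtM.pre_pre]
  congr 1
  congr 1
  exact Submodule.linearMap_qext _ (LinearMap.ext fun _ => rfl)

theorem exists_indAnn_of_mem_associatedPrimes_localCohomology [IsNoetherianRing R]
    {V : Type u} [AddCommGroup V] [Module R V] {P : Ideal R}
    (hP : P ∈ associatedPrimes R ((localCohomology I n).obj (ModuleCat.of R V))) :
    ∃ (k : ℕ) (y : ExtM R (R ⧸ (I ^ k • ⊤ : Submodule R R)) V n), ∀ a, a ∈ P ↔ IndAnn y a := by
  obtain ⟨-, x, hx⟩ := mem_associatedPrimes_iff.1 hP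
  obtain ⟨k, y, rfl⟩ := exists_toLocalCohomology_eq x
  refine ⟨k, extCatQuotEquiv I n k V y, fun a => ?_⟩
  rw [hx, ← map_smul, toLocalCohomology_eq_zero_iff]
  refine exists_congr fun l => exists_congr fun h => ?_
  rw [← map_smul, ← map_smul, ← extCatQuotEquiv_map, LinearEquiv.map_eq_zero_iff]

end LocalCohomology

section Main

variable {R : Type u} [CommRing R]

lemma dualizing_of_isCanonicalModule {ω : Type u} [AddCommGroup ω] [Module R ω]
    (h : IsCanonicalModule R ω) : Dualizing R ω where
  finite := h.1
  finInjDim := by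
    obtain ⟨s, hs⟩ := h.2.1
    exact ⟨s, fun j hj N _ _ => have := hs (ModuleCat.of R N) j hj
      (extCatEquiv _ _ j).symm.injective.subsingleton⟩
  bijective := h.2.2.1
  acyc j hj := have := h.2.2.2 j hj
    (extCatEquiv _ _ j).symm.injective.subsingleton

end Main

end FFRT

/-- Let `R` be a Cohen-Macaulay ring of prime characteristic `p` with
finite F-representation type by finitely generated `R`-modules `M_1, …, M_t`, admitting a
canonical module `ω_R`.  Suppose `R_𝔭` is Gorenstein for every prime ideal `𝔭` with
`dim R/𝔭 ≥ 2`.  Let `I` be an ideal and `n` an integer.  Then every associated prime of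
`H_I^n(R)` either lies in `⋃_i Ass_R Ext_R^n(M_i†/IM_i†, ω_R)` or is a maximal ideal of
`R`, where `(−)† = Hom_R(−, ω_R)`.  In particular, `Ass_R H_I^n(R)` is a finite set if
`R` is semilocal. -/
theorem stmt6 {R : Type u} [CommRing R] (hCM : IsCMRing R)
    (p : ℕ) (hp : p.Prime) [CharP R p]
    -- finite F-representation type by finitely generated modules `M_1, …, M_t`:
    (t : ℕ) (M : Fin t → Type u) [∀ i, AddCommGroup (M i)] [∀ i, Module R (M i)]
    (hfg : ∀ i, Module.Finite R (M i))
    (hFFRT : ∀ e : ℕ, ∃ (m : Fin t → ℕ)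
      (ψ : R ≃+ ⨁ i : Fin t, (Fin (m i) → M i)),
        ∀ r y : R, ψ (r ^ p ^ e * y) = r • ψ y)
    -- a canonical module `ω_R`:
    (ω : Type u) [AddCommGroup ω] [Module R ω] (hω : IsCanonicalModule R ω)
    -- `R_𝔭` is Gorenstein for every prime ideal `𝔭` with `dim R/𝔭 ≥ 2`:
    (hGor : ∀ (P : Ideal R) (h : P.IsPrime), 2 ≤ ringKrullDim (R ⧸ P) →
      IsGorensteinLocalRing (Localization (@Ideal.primeCompl R _ P h)))
    (I : Ideal R) (n : ℕ) :
    (∀ P ∈ associatedPrimes R ((localCohomology I n).obj (ModuleCat.of R R)),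
      (P ∈ ⋃ i : Fin t, associatedPrimes R
        (extCat R n
          (ModuleCat.of R ((M i →ₗ[R] ω) ⧸ (I • (⊤ : Submodule R (M i →ₗ[R] ω)))))
          (ModuleCat.of R ω))) ∨ P.IsMaximal) ∧
    ({J : Ideal R | J.IsMaximal}.Finite →
      (associatedPrimes R ((localCohomology I n).obj (ModuleCat.of R R))).Finite) := by
  have hN : IsNoetherianRing R := hCM.1
  have : ExpChar R p := ExpChar.prime hp
  have hD := FFRT.dualizing_of_isCanonicalModule hω
  have : Module.Finite R ω := hω.1
  have key : associatedPrimes R ((localCohomology I n).obj (ModuleCat.of R R)) ⊆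
      ⋃ i : Fin t, associatedPrimes R (extCat R n
        (ModuleCat.of R ((M i →ₗ[R] ω) ⧸ (I • (⊤ : Submodule R (M i →ₗ[R] ω)))))
        (ModuleCat.of R ω)) := by
    intro P hP
    obtain ⟨k, y, hy⟩ := FFRT.exists_indAnn_of_mem_associatedPrimes_localCohomology hP
    obtain ⟨e, he⟩ := hD.exists_mem_associatedPrimes_frobenius hp.one_lt y hP.isPrime hy
    obtain ⟨m, ψ, hψ⟩ := hFFRT e
    obtain ⟨i, hi⟩ := FFRT.exists_mem_associatedPrimes_of_frobenius p e M m ψ hψ hD I he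
    refine Set.mem_iUnion.2 ⟨i, ?_⟩
    rwa [LinearEquiv.AssociatedPrimes.eq (FFRT.extCatEquiv _ _ n)]
  refine ⟨fun P hP => Or.inl (key hP), fun _ => Set.Finite.subset (Set.finite_iUnion fun i => ?_)
    key⟩
  rw [LinearEquiv.AssociatedPrimes.eq (FFRT.extCatEquiv _ _ n)]
  exact associatedPrimes.finite R _
end

section
/- Let R = ⨁_{n≥0} R_n be a Noetherian graded ring with k := R_0 a field of characteristic p > 0 and K the perfect closure of k. If R_K := R ⊗_k K has finite graded F-representation type, then for any non-zerodivisor x ∈ R there exists a differential operator δ ∈ D_{R/k} such that δ(1/x) = 1/x^p in R_x. -/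
/-!
Statement 16: Let `R = ⨁_{n≥0} R_n` be a Noetherian graded ring with `k := R_0` a field
of characteristic `p > 0` and `K` the perfect closure of `k`.  If `R_K = R ⊗_k K` has
finite graded F-representation type, then for any non-zerodivisor `x ∈ R` there is a
differential operator `δ ∈ D_{R/k}` with `δ(1/x) = 1/x^p` in `R_x`.
-/

open scoped DirectSum TensorProduct

universe u v

section Defs

variable (k : Type v) (R : Type u) [CommSemiring k] [CommRing R] [Algebra k R]

/-- The `k`-linear differential operators on `R` of order at most `n`:
`D⁻¹ = 0` and `D^{n+1} = {δ | [δ, r] ∈ D^n for all r ∈ R}`. -/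
def diffOpsLe : ℕ → Set (R →ₗ[k] R)
  | 0 => {δ | ∀ r : R,
      δ.comp (LinearMap.mulLeft k r) - (LinearMap.mulLeft k r).comp δ = 0}
  | n + 1 => {δ | ∀ r : R,
      δ.comp (LinearMap.mulLeft k r) - (LinearMap.mulLeft k r).comp δ ∈ diffOpsLe n}

/-- The ring of `k`-linear differential operators `D_{R/k} = ⋃_n D^n_{R/k}`. -/
def DiffOps : Set (R →ₗ[k] R) :=
  {δ | ∃ n : ℕ, δ ∈ diffOpsLe k R n}

/-- A witness for finite *graded* F-representation type of an `ℕ`-graded ring `R`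
(graded by `k₀`-submodules `𝒜`), by finitely generated `ℚ`-graded modules. -/
structure GradedFFRTWitness (p : ℕ) (k₀ : Type v) (S : Type u) [CommSemiring k₀]
    [CommRing S] [Algebra k₀ S] (𝒜 : ℕ → Submodule k₀ S) : Type (max (u + 1) (v + 1)) where
  s : ℕ
  M : Fin s → Type u
  [acg : ∀ i, AddCommGroup (M i)]
  [modR : ∀ i, Module S (M i)]
  [modk : ∀ i, Module k₀ (M i)]
  [tower : ∀ i, IsScalarTower k₀ S (M i)]
  /-- the `ℚ`-grading of each `M i` -/
  ℳ : ∀ i, ℚ → Submodule k₀ (M i)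
  fin : ∀ i, Module.Finite S (M i)
  internal : ∀ i, DirectSum.IsInternal (ℳ i)
  smul_mem : ∀ (i : Fin s) (n : ℕ) (α : ℚ) (r : S) (m : M i),
    r ∈ 𝒜 n → m ∈ ℳ i α → r • m ∈ ℳ i ((n : ℚ) + α)
  /-- for every `e` there are multiplicities `n`, shifts `α` and a degree-preserving
  isomorphism `ᵉS ≅ ⨁_{i,j} M_i(α_{ij})` of `ℚ`-graded `S`-modules. -/
  decomp : ∀ e : ℕ, ∃ (n : Fin s → ℕ) (α : ∀ i, Fin (n i) → ℚ)
    (ψ : S ≃+ ⨁ ij : (Σ i : Fin s, Fin (n i)), M ij.1),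
      (∀ r y : S, ψ (r ^ p ^ e * y) = r • ψ y) ∧
      ∀ (d : ℕ) (y : S), y ∈ 𝒜 d → ∀ ij : Σ i : Fin s, Fin (n i),
        (ψ y) ij ∈ ℳ ij.1 (α ij.1 ij.2 + (d : ℚ) / (p : ℚ) ^ e)

/-- `S` has finite graded F-representation type. -/
def HasGradedFFRT (p : ℕ) (k₀ : Type v) (S : Type u) [CommSemiring k₀] [CommRing S]
    [Algebra k₀ S] (𝒜 : ℕ → Submodule k₀ S) : Prop :=
  Nonempty (GradedFFRTWitness p k₀ S 𝒜)

end Defs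

section GradedPieces

variable {k R : Type*} [Field k] [CommRing R] [Algebra k R] [IsNoetherianRing R]
  (𝒜 : ℕ → Submodule k R) [GradedAlgebra 𝒜]

/-- A Noetherian connected `ℕ`-graded `k`-algebra has finite-dimensional graded pieces. -/
theorem finite_gradedPiece (h0 : 𝒜 0 = Submodule.span k {1}) (n : ℕ) :
    Module.Finite k (𝒜 n) := by
  classical
  obtain ⟨T, hT, hspan⟩ := (Submodule.fg_span_iff_fg_span_finset_subset (R := R)
    (𝒜 n : Set R)).1 (IsNoetherian.noetherian _)
  have hle : 𝒜 n ≤ Submodule.span k (T : Set R) := by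
    intro a ha
    have haT : a ∈ Submodule.span R (T : Set R) := hspan ▸ Submodule.subset_span ha
    obtain ⟨f, -, hf⟩ := Submodule.mem_span_finset.1 haT
    have hproj : ((DirectSum.decompose 𝒜 a n : 𝒜 n) : R) =
        ∑ t ∈ T, ((DirectSum.decompose 𝒜 (f t • t) n : 𝒜 n) : R) := by
      rw [← hf, DirectSum.decompose_sum, DFinsupp.finsetSum_apply, Submodule.coe_sum]
    rw [DirectSum.decompose_of_mem_same 𝒜 ha] at hproj
    rw [hproj]
    refine Submodule.sum_mem _ fun t ht => ?_
    rw [smul_eq_mul, DirectSum.coe_decompose_mul_of_right_mem 𝒜 n (hT ht), if_pos le_rfl,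
      Nat.sub_self]
    have hzero : ((DirectSum.decompose 𝒜 (f t) 0 : 𝒜 0) : R) ∈ Submodule.span k {(1 : R)} :=
      h0 ▸ (DirectSum.decompose 𝒜 (f t) 0).2
    obtain ⟨c, hc⟩ := Submodule.mem_span_singleton.1 hzero
    rw [← hc, smul_one_mul]
    exact Submodule.smul_mem _ _ (Submodule.subset_span ht)
  have : Module.Finite k (Submodule.span k (T : Set R)) := Module.Finite.span_finset k T
  exact Submodule.finiteDimensional_of_le hle

/-- A Noetherian connected `ℕ`-graded `k`-algebra is of finite type. -/
theorem finiteType_of_connected_graded (h0 : 𝒜 0 = Submodule.span k {1}) :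
    Algebra.FiniteType k R := by
  classical
  obtain ⟨T, hT, hspan⟩ := (Submodule.fg_span_iff_fg_span_finset_subset (R := R)
    {r : R | ∃ n, n ≠ 0 ∧ r ∈ 𝒜 n}).1 (IsNoetherian.noetherian _)
  refine ⟨T, ?_⟩
  have hmem : ∀ n, ∀ a ∈ 𝒜 n, a ∈ Algebra.adjoin k (T : Set R) := by
    intro n
    induction n using Nat.strong_induction_on with
    | _ n ih =>
      intro a ha
      rcases eq_or_ne n 0 with rfl | hn
      · obtain ⟨c, rfl⟩ := Submodule.mem_span_singleton.1 (h0 ▸ ha)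
        exact Subalgebra.smul_mem _ (one_mem _) c
      have haT : a ∈ Submodule.span R (T : Set R) :=
        hspan ▸ Submodule.subset_span ⟨n, hn, ha⟩
      obtain ⟨f, -, hf⟩ := Submodule.mem_span_finset.1 haT
      have hproj : ((DirectSum.decompose 𝒜 a n : 𝒜 n) : R) =
          ∑ t ∈ T, ((DirectSum.decompose 𝒜 (f t • t) n : 𝒜 n) : R) := by
        rw [← hf, DirectSum.decompose_sum, DFinsupp.finsetSum_apply, Submodule.coe_sum]
      rw [DirectSum.decompose_of_mem_same 𝒜 ha] at hproj
      rw [hproj]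
      refine sum_mem fun t ht => ?_
      obtain ⟨i, hi, hti⟩ := hT ht
      rw [smul_eq_mul, DirectSum.coe_decompose_mul_of_right_mem 𝒜 n hti]
      split_ifs with hin
      · exact mul_mem (ih _ (by omega) _ (SetLike.coe_mem _)) (Algebra.subset_adjoin ht)
      · exact zero_mem _
  refine eq_top_iff.2 fun r _ => ?_
  rw [← DirectSum.sum_support_decompose 𝒜 r]
  exact sum_mem fun n _ => hmem n _ (SetLike.coe_mem _)

end GradedPieces

section DiffOps

variable {k R : Type*} [Field k] [CommRing R] [Algebra k R]

/-- The bimodule action of `R ⊗ R` on `k`-linear endomorphisms of `R`: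
`a ⊗ b` sends `δ` to `y ↦ a * δ (b * y)`. -/
noncomputable def bimoduleAction : R ⊗[k] R →ₐ[k] Module.End k (R →ₗ[k] R) :=
  Algebra.TensorProduct.lift
    (AlgHom.ofLinearMap
      ((LinearMap.llcomp k R R R).comp (LinearMap.mul k R))
      (by ext; simp) (by intros; ext; simp [mul_assoc]))
    (AlgHom.ofLinearMap
      ((LinearMap.llcomp k R R R).flip.comp (LinearMap.mul k R))
      (by ext; simp) (by intro a b; ext; simp [mul_left_comm, mul_assoc]))
    (fun a b => (commute_iff_eq _ _).2 (by ext; simp))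

theorem bimoduleAction_tmul (a b : R) (δ : R →ₗ[k] R) (y : R) :
    bimoduleAction (a ⊗ₜ[k] b) δ y = a * δ (b * y) := by
  rw [bimoduleAction, Algebra.TensorProduct.lift_tmul]
  rfl

theorem mem_diffOpsLe_of_ideal_pow (n : ℕ) (δ : R →ₗ[k] R)
    (h : ∀ t ∈ KaehlerDifferential.ideal k R ^ (n + 1), bimoduleAction t δ = 0) :
    δ ∈ diffOpsLe k R n := by
  have key : ∀ (δ : R →ₗ[k] R) (r : R),
      δ.comp (LinearMap.mulLeft k r) - (LinearMap.mulLeft k r).comp δ =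
        bimoduleAction ((1 : R) ⊗ₜ[k] r - r ⊗ₜ[k] (1 : R)) δ := by
    intro δ r
    ext y
    simp [bimoduleAction_tmul]
  induction n generalizing δ with
  | zero =>
    intro r
    rw [key]
    exact h _ (by simp)
  | succ n ih =>
    intro r
    rw [key]
    refine ih _ fun t ht => ?_
    rw [← Module.End.mul_apply, ← map_mul]
    refine h _ ?_
    rw [pow_succ]
    exact Ideal.mul_mem_mul ht (KaehlerDifferential.one_smul_sub_smul_one_mem_ideal k r)

/-- Over a `k`-algebra of finite type in characteristic `p`, every `k`-linear map which is linear
over the `pᵉ`-th powers is a differential operator. -/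
theorem mem_diffOps_of_map_pow_mul [Algebra.FiniteType k R] (p : ℕ) (hp : p.Prime) [CharP k p]
    [Nontrivial R] (e : ℕ) (δ : R →ₗ[k] R) (h : ∀ r y : R, δ (r ^ p ^ e * y) = r ^ p ^ e * δ y) :
    δ ∈ DiffOps k R := by
  have : Fact p.Prime := ⟨hp⟩
  let A : Ideal (R ⊗[k] R) :=
    { carrier := {t | bimoduleAction t δ = 0}
      add_mem' := fun {a b} ha hb => by
        simp only [Set.mem_ofPred_eq] at *
        rw [map_add, LinearMap.add_apply, ha, hb, add_zero]
      zero_mem' := by simp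
      smul_mem' := fun c t ht => by
        simp only [Set.mem_ofPred_eq, smul_eq_mul] at *
        rw [map_mul, Module.End.mul_apply, ht, map_zero] }
  have hrad : KaehlerDifferential.ideal k R ≤ A.radical := by
    rw [← KaehlerDifferential.span_range_eq_ideal, Ideal.span_le]
    rintro _ ⟨r, rfl⟩
    refine ⟨p ^ e, ?_⟩
    have : CharP (R ⊗[k] R) p :=
      charP_of_injective_algebraMap (algebraMap k (R ⊗[k] R)).injective p
    change bimoduleAction _ δ = 0
    rw [sub_pow_char_pow, Algebra.TensorProduct.tmul_pow, Algebra.TensorProduct.tmul_pow]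
    ext y
    simp [bimoduleAction_tmul, h]
  obtain ⟨n, hn⟩ := Ideal.exists_pow_le_of_le_radical_of_fg hrad (KaehlerDifferential.ideal_fg k R)
  exact ⟨n, mem_diffOpsLe_of_ideal_pow n δ fun t ht => hn (Ideal.pow_le_pow_right n.le_succ ht)⟩

end DiffOps

section Truncation

variable {K S M : Type*} [Field K] [CommRing S] [Algebra K S] [AddCommGroup M] [Module K M]
  [Module S M] [IsScalarTower K S M]

/-- The projection of a `ℚ`-graded module onto the part of degree at most `C`. -/
noncomputable def truncation (ℳ : ℚ → Submodule K M) (hℳ : DirectSum.IsInternal ℳ) (C : ℚ) :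
    M →ₗ[K] M :=
  (DirectSum.toModule K ℚ M fun γ => if γ ≤ C then (ℳ γ).subtype else 0) ∘ₗ
    (LinearEquiv.ofBijective (DirectSum.coeLinearMap ℳ) hℳ).symm.toLinearMap

theorem truncation_of_mem {ℳ : ℚ → Submodule K M} (hℳ : DirectSum.IsInternal ℳ) (C : ℚ)
    {γ : ℚ} {m : M} (hm : m ∈ ℳ γ) :
    truncation ℳ hℳ C m = if γ ≤ C then m else 0 := by
  have hsymm : (LinearEquiv.ofBijective (DirectSum.coeLinearMap ℳ) hℳ).symm m =
      DirectSum.lof K ℚ (fun γ => ℳ γ) γ ⟨m, hm⟩ := by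
    rw [LinearEquiv.symm_apply_eq]
    exact (DirectSum.coeLinearMap_lof ℳ γ ⟨m, hm⟩).symm
  rw [truncation, LinearMap.comp_apply, LinearEquiv.coe_coe, hsymm, DirectSum.toModule_lof]
  split_ifs <;> rfl

/-- The part of degree at most `C` of a finitely generated `ℚ`-graded module over an `ℕ`-graded
ring with finite-dimensional pieces is finite-dimensional. -/
theorem finite_iSup_le_degree (𝒮 : ℕ → Submodule K S) (htop : ⨆ n, 𝒮 n = ⊤)
    (h𝒮 : ∀ n, Module.Finite K (𝒮 n)) {ℳ : ℚ → Submodule K M} (hℳ : DirectSum.IsInternal ℳ)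
    (hsmul : ∀ (n : ℕ) (α : ℚ) (r : S) (m : M), r ∈ 𝒮 n → m ∈ ℳ α → r • m ∈ ℳ ((n : ℚ) + α))
    [Module.Finite S M] (C : ℚ) : Module.Finite K (⨆ γ ≤ C, ℳ γ : Submodule K M) := by
  classical
  let τ := truncation ℳ hℳ C
  let act : M → S →ₗ[K] M := fun m => (LinearMap.toSpanSingleton S M m).restrictScalars K
  have hhom : ∀ (γ : ℚ) (m : M), m ∈ ℳ γ →
      Module.Finite K (LinearMap.range (τ ∘ₗ act m)) := by
    intro γ m hm
    obtain ⟨N, hN⟩ := exists_nat_gt (C - γ)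
    have hle : LinearMap.range (τ ∘ₗ act m) ≤
        ⨆ n : Fin N, (𝒮 n).map (τ ∘ₗ act m) := by
      rw [LinearMap.range_eq_map, ← htop, Submodule.map_iSup]
      refine iSup_le fun n => ?_
      by_cases hn : n < N
      · exact le_iSup (fun n : Fin N => (𝒮 n).map (τ ∘ₗ act m)) ⟨n, hn⟩
      · rintro _ ⟨r, hr, rfl⟩
        have hval : τ (r • m) = 0 := by
          rw [truncation_of_mem hℳ C (hsmul n γ r m hr hm), if_neg]
          have : (N : ℚ) ≤ n := by exact_mod_cast not_lt.1 hn
          linarith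
        change τ (r • m) ∈ _
        rw [hval]
        exact zero_mem _
    exact Submodule.finiteDimensional_of_le hle
  have hall : ∀ m : M, Module.Finite K (LinearMap.range (τ ∘ₗ act m)) := by
    intro m
    have hm : m ∈ ⨆ γ, ℳ γ := by rw [hℳ.submodule_iSup_eq_top]; trivial
    induction hm using Submodule.iSup_induction' with
    | mem γ m hm => exact hhom γ m hm
    | zero => exact hhom 0 0 (zero_mem _)
    | add a b _ _ ha hb =>
      have hle : LinearMap.range (τ ∘ₗ act (a + b)) ≤
          LinearMap.range (τ ∘ₗ act a) ⊔ LinearMap.range (τ ∘ₗ act b) := by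
        rintro _ ⟨r, rfl⟩
        have hadd : (τ ∘ₗ act (a + b)) r = (τ ∘ₗ act a) r + (τ ∘ₗ act b) r := by
          change τ (r • (a + b)) = τ (r • a) + τ (r • b)
          rw [smul_add, map_add]
        rw [hadd]
        exact Submodule.add_mem_sup ⟨r, rfl⟩ ⟨r, rfl⟩
      exact Submodule.finiteDimensional_of_le hle
  obtain ⟨T, hT⟩ := Module.Finite.fg_top (R := S) (M := M)
  have hrange : LinearMap.range τ ≤ ⨆ t : T, LinearMap.range (τ ∘ₗ act t) := by
    rintro _ ⟨m, rfl⟩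
    have hm : m ∈ Submodule.span S (T : Set M) := by rw [hT]; trivial
    obtain ⟨f, -, rfl⟩ := Submodule.mem_span_finset.1 hm
    rw [map_sum]
    exact Submodule.sum_mem _ fun t ht =>
      Submodule.mem_iSup_of_mem (⟨t, ht⟩ : T) ⟨f t, rfl⟩
  have hle : (⨆ γ ≤ C, ℳ γ : Submodule K M) ≤ ⨆ t : T, LinearMap.range (τ ∘ₗ act t) := by
    refine le_trans (iSup₂_le fun γ hγ m hm => ?_) hrange
    exact ⟨m, (truncation_of_mem hℳ C hm).trans (if_pos hγ)⟩
  exact Submodule.finiteDimensional_of_le hle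

/-- The part of degree at most `d` in an `ℕ`-graded algebra is compatible with powers. -/
theorem pow_mem_iSup_le_degree (𝒮 : ℕ → Submodule K S) [GradedAlgebra 𝒮] {d : ℕ} {x : S}
    (hx : x ∈ ⨆ n ≤ d, 𝒮 n) (m : ℕ) : x ^ m ∈ ⨆ n ≤ m * d, 𝒮 n := by
  have hmul : ∀ a b : ℕ, (⨆ n ≤ a, 𝒮 n) * (⨆ n ≤ b, 𝒮 n) ≤ ⨆ n ≤ a + b, 𝒮 n := by
    intro a b
    simp only [Submodule.iSup_mul, Submodule.mul_iSup, iSup_le_iff]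
    intro j hj i hi
    refine le_trans (Submodule.mul_le.2 fun r hr s hs => SetLike.mul_mem_graded hr hs) ?_
    exact le_iSup₂ (f := fun n (_ : n ≤ a + b) => 𝒮 n) (i + j) (add_le_add hi hj)
  induction m with
  | zero =>
    rw [pow_zero]
    exact Submodule.mem_iSup_of_mem 0
      (Submodule.mem_iSup_of_mem (Nat.zero_le _) (SetLike.one_mem_graded 𝒮))
  | succ m ih =>
    rw [pow_succ, Nat.succ_mul]
    exact hmul _ _ (Submodule.mul_mem_mul ih hx)

theorem exists_mem_iSup_le_degree (𝒮 : ℕ → Submodule K S) (htop : ⨆ n, 𝒮 n = ⊤) (x : S) :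
    ∃ d : ℕ, x ∈ ⨆ n ≤ d, 𝒮 n := by
  have hx : x ∈ ⨆ n, 𝒮 n := by rw [htop]; trivial
  have hmono : ∀ {a b : ℕ}, a ≤ b → (⨆ n ≤ a, 𝒮 n) ≤ ⨆ n ≤ b, 𝒮 n := fun hab =>
    biSup_mono fun n hn => hn.trans hab
  induction hx using Submodule.iSup_induction' with
  | mem n x hx => exact ⟨n, Submodule.mem_iSup_of_mem n (Submodule.mem_iSup_of_mem le_rfl hx)⟩
  | zero => exact ⟨0, zero_mem _⟩
  | add a b _ _ ha hb =>
    obtain ⟨i, hi⟩ := ha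
    obtain ⟨j, hj⟩ := hb
    exact ⟨max i j, add_mem (hmono (le_max_left i j) hi) (hmono (le_max_right i j) hj)⟩

end Truncation

section FrobeniusLinear

variable {S : Type*} [CommRing S] (p : ℕ)

/-- The values at `x ^ (pᵉ - 1)` of the additive maps `φ : S → M` with
`φ (r ^ pᵉ * y) = r • φ y`. -/
def frobeniusValues (M : Type*) [AddCommGroup M] [Module S M] (x : S) (e : ℕ) :
    Submodule S M where
  carrier := {m | ∃ φ : S →+ M, (∀ r y, φ (r ^ p ^ e * y) = r • φ y) ∧ φ (x ^ (p ^ e - 1)) = m}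
  add_mem' := by
    rintro _ _ ⟨φ, hφ, rfl⟩ ⟨χ, hχ, rfl⟩
    exact ⟨φ + χ, fun r y => by simp [hφ, hχ], rfl⟩
  zero_mem' := ⟨0, by simp, rfl⟩
  smul_mem' := by
    rintro c _ ⟨φ, hφ, rfl⟩
    exact ⟨(DistribSMul.toAddMonoidHom M c).comp φ, fun r y => by simp [hφ, smul_comm c r], rfl⟩

theorem frobeniusValues_succ_le (hp : p.Prime) [CharP S p] (M : Type*) [AddCommGroup M]
    [Module S M] (x : S) (e : ℕ) :
    frobeniusValues p M x (e + 1) ≤ frobeniusValues p M x e := by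
  have : Fact p.Prime := ⟨hp⟩
  rintro _ ⟨φ, hφ, rfl⟩
  refine ⟨(φ.comp (AddMonoidHom.mulLeft (x ^ (p - 1)))).comp (frobenius S p : S →+ S),
    fun r y => ?_, ?_⟩
  · simp only [AddMonoidHom.coe_comp, Function.comp_apply, AddMonoidHom.coe_coe,
      AddMonoidHom.coe_mulLeft, frobenius_def]
    rw [← hφ]
    congr 1
    ring
  · simp only [AddMonoidHom.coe_comp, Function.comp_apply, AddMonoidHom.coe_coe,
      AddMonoidHom.coe_mulLeft, frobenius_def]
    rw [← pow_mul, ← pow_add]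
    congr 2
    have hpos : 0 < p ^ e := pow_pos hp.pos e
    obtain ⟨q, hq⟩ := Nat.exists_eq_succ_of_ne_zero hpos.ne'
    obtain ⟨t, ht⟩ := Nat.exists_eq_succ_of_ne_zero hp.pos.ne'
    rw [pow_succ, hq, ht]
    simp only [Nat.succ_eq_add_one, Nat.add_sub_cancel]
    ring_nf
    omega

variable {K : Type*} [Field K] [Algebra K S] {s : ℕ} (M : Fin s → Type*)
  [∀ i, AddCommGroup (M i)] [∀ i, Module S (M i)] [∀ i, Module K (M i)]
  [∀ i, IsScalarTower K S (M i)] [∀ i, Module.Finite S (M i)]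

/-- If the modules `ᵉS` decompose into the `M i` so that all components of `x ^ (pᵉ - 1)` lie in
fixed finite-dimensional spaces, then some `S`-linear map `ᵉ⁺¹S → ᵉS` sends `x ^ (pᵉ⁺¹ - 1)` to
`x ^ (pᵉ - 1)`. -/
theorem exists_frobenius_descent (hp : p.Prime) [CharP S p] [IsNoetherianRing S] (x : S)
    (W : ∀ i, Submodule K (M i)) [∀ i, Module.Finite K (W i)]
    (decomp : ∀ e : ℕ, ∃ (n : Fin s → ℕ) (ψ : S ≃+ ⨁ ij : (Σ i : Fin s, Fin (n i)), M ij.1),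
      (∀ r y : S, ψ (r ^ p ^ e * y) = r • ψ y) ∧ ∀ ij, ψ (x ^ (p ^ e - 1)) ij ∈ W ij.1) :
    ∃ (e : ℕ) (φ : S →+ S), (∀ r y, φ (r ^ p ^ (e + 1) * y) = r ^ p ^ e * φ y) ∧
      φ (x ^ (p ^ (e + 1) - 1)) = x ^ (p ^ e - 1) := by
  classical
  have hgen : ∀ i j : Fin s, ∃ T : Finset (M j →ₗ[S] M i),
      Submodule.span S (T : Set (M j →ₗ[S] M i)) = ⊤ := fun i j => Module.Finite.fg_top
  choose T hT using hgen
  let V : ∀ i, Submodule K (M i) := fun i =>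
    ⨆ j, ⨆ g : T i j, (W j).map ((g : M j →ₗ[S] M i).restrictScalars K)
  have hV : ∀ i, Module.Finite K (V i) := fun i => inferInstance
  have hgenerated : ∀ e i, frobeniusValues p (M i) x e ≤
      Submodule.span S ((V i : Set (M i)) ∩ frobeniusValues p (M i) x e) := by
    rintro e i _ ⟨φ, hφ, rfl⟩
    obtain ⟨n, ψ, hψ, hW⟩ := decomp e
    have hψ' : ∀ r z, ψ.symm (r • z) = r ^ p ^ e * ψ.symm z := by
      intro r z
      rw [AddEquiv.symm_apply_eq, hψ, AddEquiv.apply_symm_apply]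
    let φlin : (⨁ ij : (Σ i : Fin s, Fin (n i)), M ij.1) →ₗ[S] M i :=
      { toFun := fun z => φ (ψ.symm z)
        map_add' := by simp
        map_smul' := fun r z => by simp [hψ', hφ] }
    have hx : φ (x ^ (p ^ e - 1)) = φlin (ψ (x ^ (p ^ e - 1))) := by
      change _ = φ (ψ.symm _)
      rw [AddEquiv.symm_apply_apply]
    rw [hx, ← DirectSum.sum_univ_of (ψ (x ^ (p ^ e - 1))), map_sum]
    refine Submodule.sum_mem _ fun ij _ => ?_
    have hspan : ∀ f ∈ Submodule.span S (T i ij.1 : Set (M ij.1 →ₗ[S] M i)),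
        f (ψ (x ^ (p ^ e - 1)) ij) ∈
          Submodule.span S ((V i : Set (M i)) ∩ frobeniusValues p (M i) x e) := by
      intro f hf
      induction hf using Submodule.span_induction with
      | mem g hg =>
        refine Submodule.subset_span ⟨?_, ?_⟩
        · exact Submodule.mem_iSup_of_mem ij.1 (Submodule.mem_iSup_of_mem (⟨g, hg⟩ : T i ij.1)
            ⟨_, hW ij, rfl⟩)
        · refine ⟨((g ∘ₗ DirectSum.component S _ _ ij).toAddMonoidHom).comp ψ.toAddMonoidHom,
            fun r y => ?_, rfl⟩
          change g (DirectSum.component S _ _ ij (ψ (r ^ p ^ e * y))) = _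
          rw [hψ, map_smul, map_smul]
          rfl
      | zero => exact zero_mem _
      | add f g _ _ hf hg => exact add_mem hf hg
      | smul c f _ hf => exact Submodule.smul_mem _ c hf
    exact hspan (φlin ∘ₗ DirectSum.lof S _ (fun ij : (Σ i : Fin s, Fin (n i)) => M ij.1) ij)
      (hT i ij.1 ▸ Submodule.mem_top)
  have hanti : ∀ i, Antitone (frobeniusValues p (M i) x) := fun i =>
    antitone_nat_of_succ_le fun e => frobeniusValues_succ_le p hp (M i) x e
  have hstable : ∀ i, ∃ N, ∀ e, N ≤ e →
      frobeniusValues p (M i) x e ≤ frobeniusValues p (M i) x (e + 1) := by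
    intro i
    let c : ℕ → Submodule K (V i) := fun e =>
      ((frobeniusValues p (M i) x e).restrictScalars K).comap (V i).subtype
    have hc : Antitone c := fun a b hab => Submodule.comap_mono (hanti i hab)
    obtain ⟨N, hN⟩ := IsArtinian.monotone_stabilizes
      (⟨fun e => OrderDual.toDual (c e), hc⟩ : ℕ →o (Submodule K (V i))ᵒᵈ)
    refine ⟨N, fun e he => (hgenerated e i).trans (Submodule.span_le.2 ?_)⟩
    rintro m ⟨hmV, hm⟩
    have hceq : c e = c (e + 1) := ((hN e he).symm.trans (hN (e + 1) (by omega)))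
    have hmem : (⟨m, hmV⟩ : V i) ∈ c e := hm
    rw [hceq] at hmem
    exact hmem
  choose N hN using hstable
  let e := Finset.univ.sup N
  obtain ⟨n, ψ, hψ, -⟩ := decomp e
  have hcomp : ∀ ij : (Σ i : Fin s, Fin (n i)), ∃ φ : S →+ M ij.1,
      (∀ r y, φ (r ^ p ^ (e + 1) * y) = r • φ y) ∧
        φ (x ^ (p ^ (e + 1) - 1)) = ψ (x ^ (p ^ e - 1)) ij := by
    intro ij
    refine hN ij.1 e (Finset.le_sup (Finset.mem_univ _)) ?_
    refine ⟨(DirectSum.component S _ _ ij).toAddMonoidHom.comp ψ.toAddMonoidHom,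
      fun r y => ?_, rfl⟩
    change DirectSum.component S _ _ ij (ψ (r ^ p ^ e * y)) = _
    rw [hψ, map_smul]
    rfl
  choose φ hφ hφx using hcomp
  let Φ : S →+ ⨁ ij : (Σ i : Fin s, Fin (n i)), M ij.1 :=
    ∑ ij, (DirectSum.of (fun ij : (Σ i : Fin s, Fin (n i)) => M ij.1) ij).comp (φ ij)
  have hΦ : ∀ y, Φ y = ∑ ij, DirectSum.lof S _ (fun ij : (Σ i : Fin s, Fin (n i)) => M ij.1) ij
      (φ ij y) := by
    intro y
    simp only [Φ, AddMonoidHom.finsetSum_apply]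
    rfl
  refine ⟨e, ψ.symm.toAddMonoidHom.comp Φ, fun r y => ?_, ?_⟩
  · change ψ.symm (Φ _) = r ^ p ^ e * ψ.symm (Φ y)
    rw [AddEquiv.symm_apply_eq, hψ, AddEquiv.apply_symm_apply, hΦ, hΦ, Finset.smul_sum]
    simp only [hφ, map_smul]
  · change ψ.symm (Φ _) = _
    rw [AddEquiv.symm_apply_eq, hΦ]
    simp only [hφx]
    exact DirectSum.sum_univ_of _

end FrobeniusLinear

section Shifts

variable {K S : Type*} [Field K] [CommRing S] [Algebra K S] (𝒮 : ℕ → Submodule K S)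
  {ι : Type*} {M : ι → Type*} [∀ i, AddCommGroup (M i)] (ψ : S ≃+ ⨁ i, M i) (i : ι)
  [Module K (M i)] {ℳ : ℚ → Submodule K (M i)} {α q : ℚ}

/-- The shifts in a graded decomposition of an `ℕ`-graded ring are bounded above. -/
theorem shift_le_of_mem [DecidableEq ι] (htop : ⨆ n, 𝒮 n = ⊤) (hℳ : DirectSum.IsInternal ℳ)
    (hq : 0 < q) (hdeg : ∀ (d : ℕ) (y : S), y ∈ 𝒮 d → ψ y i ∈ ℳ (α + d / q)) {β : ℚ} {m : M i}
    (hm : m ∈ ℳ β) (hm0 : m ≠ 0) : α ≤ β := by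
  by_contra! hlt
  have hkill : ∀ y : S, truncation ℳ hℳ β (ψ y i) = 0 := by
    intro y
    have hy : y ∈ ⨆ n, 𝒮 n := by rw [htop]; trivial
    induction hy using Submodule.iSup_induction' with
    | mem d y hy =>
      rw [truncation_of_mem hℳ β (hdeg d y hy), if_neg]
      have : 0 ≤ (d : ℚ) / q := by positivity
      linarith
    | zero => rw [map_zero, DirectSum.zero_apply, map_zero]
    | add a b _ _ ha hb => rw [map_add, DirectSum.add_apply, map_add, ha, hb, add_zero]
  have h := hkill (ψ.symm (DirectSum.of M i m))
  rw [AddEquiv.apply_symm_apply, DirectSum.of_eq_same, truncation_of_mem hℳ β hm,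
    if_pos le_rfl] at h
  exact hm0 h

theorem component_mem_iSup_le_degree (hq : 0 < q)
    (hdeg : ∀ (d : ℕ) (y : S), y ∈ 𝒮 d → ψ y i ∈ ℳ (α + d / q)) {β : ℚ} (hα : α ≤ β)
    {D : ℕ} {y : S} (hy : y ∈ ⨆ n ≤ D, 𝒮 n) : ψ y i ∈ ⨆ γ ≤ β + D / q, ℳ γ := by
  induction hy using Submodule.iSup_induction' with
  | mem n y hy =>
    by_cases hn : n ≤ D
    · rw [iSup_pos hn] at hy
      refine Submodule.mem_iSup_of_mem _ (Submodule.mem_iSup_of_mem ?_ (hdeg n y hy))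
      gcongr
    · rw [iSup_neg hn, Submodule.mem_bot] at hy
      rw [hy, map_zero, DirectSum.zero_apply]
      exact zero_mem _
  | zero =>
    rw [map_zero, DirectSum.zero_apply]
    exact zero_mem _
  | add a b _ _ ha hb =>
    rw [map_add, DirectSum.add_apply]
    exact add_mem ha hb

end Shifts

/-- Over a graded ring with finite graded F-representation type and finite-dimensional pieces,
every element `x` admits an `S^{pᵉ}`-linear endomorphism sending `x ^ (pᵉ - 1)` to
`x ^ (pᵉ - p)`. -/
theorem HasGradedFFRT.exists_map_pow {K : Type v} {S : Type u} [Field K] [CommRing S] [Algebra K S]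
    [IsNoetherianRing S] (p : ℕ) (hp : p.Prime) [CharP S p] (𝒮 : ℕ → Submodule K S)
    [GradedAlgebra 𝒮] (hfin : ∀ n, Module.Finite K (𝒮 n)) (h : HasGradedFFRT p K S 𝒮) (x : S) :
    ∃ (e : ℕ) (φ : S →+ S), (∀ r y, φ (r ^ p ^ (e + 1) * y) = r ^ p ^ (e + 1) * φ y) ∧
      φ (x ^ (p ^ (e + 1) - 1)) = (x ^ (p ^ e - 1)) ^ p := by
  classical
  have : Fact p.Prime := ⟨hp⟩
  obtain ⟨@⟨s, M, _, _, _, _, ℳ, _, internal, smul_mem, decomp⟩⟩ := h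
  have htop : ⨆ n, 𝒮 n = ⊤ :=
    (DirectSum.Decomposition.isInternal 𝒮).submodule_iSup_eq_top
  obtain ⟨d, hd⟩ := exists_mem_iSup_le_degree 𝒮 htop x
  have hβ : ∀ i, ∃ β : ℚ, (∃ m ∈ ℳ i β, m ≠ 0) ∨ Subsingleton (M i) := by
    intro i
    by_cases hex : ∃ β : ℚ, ∃ m ∈ ℳ i β, m ≠ 0
    · exact hex.imp fun β hm => Or.inl hm
    · push Not at hex
      refine ⟨0, Or.inr ((Submodule.subsingleton_iff K).1 (subsingleton_of_bot_eq_top ?_))⟩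
      rw [← (internal i).submodule_iSup_eq_top, eq_comm, iSup_eq_bot]
      exact fun β => (Submodule.eq_bot_iff _).2 (hex β)
  choose β hβ using hβ
  let W : ∀ i, Submodule K (M i) := fun i => ⨆ γ ≤ β i + d, ℳ i γ
  have hW : ∀ i, Module.Finite K (W i) := fun i =>
    finite_iSup_le_degree 𝒮 htop hfin (internal i) (smul_mem i) _
  obtain ⟨e, φ, hφ, hφx⟩ := exists_frobenius_descent p M hp x W (fun e => by
    obtain ⟨n, α, ψ, hψ, hdeg⟩ := decomp e
    refine ⟨n, ψ, hψ, fun ij => ?_⟩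
    have hq : (0 : ℚ) < (p : ℚ) ^ e := by
      have := hp.pos
      positivity
    rcases hβ ij.1 with ⟨m, hm, hm0⟩ | hs
    · have hα : α ij.1 ij.2 ≤ β ij.1 := shift_le_of_mem 𝒮 ψ ij htop (internal ij.1) hq
        (fun d y hy => hdeg d y hy ij) hm hm0
      have hmem := component_mem_iSup_le_degree 𝒮 ψ ij hq (fun d y hy => hdeg d y hy ij) hα
        (pow_mem_iSup_le_degree 𝒮 hd (p ^ e - 1))
      have hbound : β ij.1 + (((p ^ e - 1) * d : ℕ) : ℚ) / (p : ℚ) ^ e ≤ β ij.1 + d := by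
        gcongr
        rw [div_le_iff₀ hq, mul_comm (d : ℚ)]
        exact_mod_cast Nat.mul_le_mul_right d (Nat.sub_le _ _)
      have hmono : (⨆ γ ≤ β ij.1 + (((p ^ e - 1) * d : ℕ) : ℚ) / (p : ℚ) ^ e, ℳ ij.1 γ) ≤
          W ij.1 := biSup_mono fun γ hγ => le_trans hγ hbound
      exact hmono hmem
    · rw [Subsingleton.elim (ψ (x ^ (p ^ e - 1)) ij) 0]
      exact zero_mem _)
  refine ⟨e, (frobenius S p : S →+ S).comp φ, fun r y => ?_, ?_⟩
  · change (φ _) ^ p = r ^ p ^ (e + 1) * (φ y) ^ p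
    rw [hφ, mul_pow, ← pow_mul, ← pow_succ]
  · change (φ _) ^ p = _
    rw [hφx]

/-- Let `R = ⨁_{n ≥ 0} R_n` be a Noetherian graded ring with
`k := R_0` a field of characteristic `p > 0` and `K` the perfect closure of `k`.
If `R_K := R ⊗_k K` (with its induced grading) has finite graded F-representation type,
then for any non-zerodivisor `x ∈ R` there exists a differential operator `δ ∈ D_{R/k}`
such that `δ(1/x) = 1/x^p` in `R_x`.  (Any such `δ` is `R^{pᵉ}`-linear for some `e`, and
acts on `R_x` by `δ(y/s) = δ(s^{pᵉ-1}y)/s^{pᵉ}`; the equation `δ(1/x) = 1/x^p` is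
`δ(x^{pᵉ-1})·x^p = x^{pᵉ}` in `R_x`.) -/
theorem stmt16 {k : Type u} [Field k] (p : ℕ) (hp : p.Prime) [CharP k p]
    {R : Type u} [CommRing R] [Algebra k R] [IsNoetherianRing R] [CharP R p]
    -- the grading of `R`, with `R_0 = k`:
    (𝒜 : ℕ → Submodule k R) [GradedAlgebra 𝒜]
    (h0 : 𝒜 0 = Submodule.span k {1})
    -- `K` is the perfect closure of `k`:
    (K : Type u) [Field K] [Algebra k K] [ExpChar K p] [PerfectRing K p]
    [IsPRadical (algebraMap k K) p]
    -- `R_K = R ⊗_k K`, with grading `[R_K]_n = R_n ⊗_k K`, has finite graded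
    -- F-representation type:
    (hFFRT : HasGradedFFRT p K (K ⊗[k] R) (fun n => (𝒜 n).baseChange K))
    (x : R) (hx : x ∈ nonZeroDivisors R) :
    ∃ δ : R →ₗ[k] R, δ ∈ DiffOps k R ∧ ∃ e : ℕ,
      (∀ r y : R, δ (r ^ p ^ e * y) = r ^ p ^ e * δ y) ∧
      algebraMap R (Localization.Away x) (δ (x ^ (p ^ e - 1))) *
          algebraMap R (Localization.Away x) x ^ p =
        algebraMap R (Localization.Away x) x ^ p ^ e := by
  have : Fact p.Prime := ⟨hp⟩
  have : Nontrivial R := CharP.nontrivial_of_char_ne_one hp.ne_one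
  have : Algebra.FiniteType k R := finiteType_of_connected_graded 𝒜 h0
  have : CharP K p := charP_of_injective_algebraMap (algebraMap k K).injective p
  have : CharP (K ⊗[k] R) p :=
    charP_of_injective_algebraMap (algebraMap K (K ⊗[k] R)).injective p
  have : IsNoetherianRing (K ⊗[k] R) := Algebra.FiniteType.isNoetherianRing K _
  have hfin : ∀ n, Module.Finite K ((𝒜 n).baseChange K) := by
    intro n
    have := finite_gradedPiece 𝒜 h0 n
    exact Module.Finite.of_surjective _ ((𝒜 n).toBaseChange_surjective K)
  obtain ⟨e, φ, hφ, hφx⟩ := hFFRT.exists_map_pow p hp (fun n => (𝒜 n).baseChange K) hfin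
    ((1 : K) ⊗ₜ[k] x)
  have hφK : ∀ (c : K) (y : K ⊗[k] R), φ (c • y) = c • φ y := by
    intro c y
    obtain ⟨b, rfl⟩ := (bijective_iterateFrobenius K p (e + 1)).2 c
    have hb : ∀ z : K ⊗[k] R, iterateFrobenius K p (e + 1) b • z =
        (b ⊗ₜ[k] (1 : R)) ^ p ^ (e + 1) * z := by
      intro z
      rw [iterateFrobenius_def, Algebra.smul_def, map_pow]
      rfl
    rw [hb, hb, hφ]
  obtain ⟨l, hl⟩ := (Algebra.linearMap k K).exists_leftInverse_of_injective
    (LinearMap.ker_eq_bot.2 (algebraMap k K).injective)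
  have hl1 : l 1 = 1 := by
    have := LinearMap.congr_fun hl 1
    simpa using this
  let π : K ⊗[k] R →ₗ[k] R := (TensorProduct.lid k R).toLinearMap ∘ₗ l.rTensor R
  have hπ : ∀ (r : R) (z : K ⊗[k] R), π ((1 : K) ⊗ₜ[k] r * z) = r * π z := by
    intro r z
    induction z with
    | zero => simp
    | tmul c y => simp [π]
    | add a b ha hb => rw [mul_add, map_add, ha, hb, map_add, mul_add]
  have hπ1 : ∀ r : R, π ((1 : K) ⊗ₜ[k] r) = r := fun r => by simp [π, hl1]
  have hφk : ∀ (c : k) (y : K ⊗[k] R), φ (c • y) = c • φ y := fun c y => by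
    rw [← algebraMap_smul K c y, hφK, algebraMap_smul]
  let φk : K ⊗[k] R →ₗ[k] K ⊗[k] R := { φ with map_smul' := hφk }
  let δ : R →ₗ[k] R :=
    π ∘ₗ φk ∘ₗ (Algebra.TensorProduct.includeRight : R →ₐ[k] K ⊗[k] R).toLinearMap
  have hδ : ∀ y, δ y = π (φ ((1 : K) ⊗ₜ[k] y)) := fun _ => rfl
  have hδlin : ∀ r y : R, δ (r ^ p ^ (e + 1) * y) = r ^ p ^ (e + 1) * δ y := by
    intro r y
    have hmul : (1 : K) ⊗ₜ[k] (r ^ p ^ (e + 1) * y) =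
        ((1 : K) ⊗ₜ[k] r) ^ p ^ (e + 1) * (1 : K) ⊗ₜ[k] y := by
      simp [Algebra.TensorProduct.tmul_pow]
    rw [hδ, hmul, hφ, Algebra.TensorProduct.tmul_pow, one_pow, hπ, hδ]
  refine ⟨δ, mem_diffOps_of_map_pow_mul p hp (e + 1) δ hδlin, e + 1, hδlin, ?_⟩
  have hδx : δ (x ^ (p ^ (e + 1) - 1)) = (x ^ (p ^ e - 1)) ^ p := by
    have hpow : ∀ m : ℕ, (1 : K) ⊗ₜ[k] (x ^ m) = ((1 : K) ⊗ₜ[k] x) ^ m := fun m => by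
      rw [Algebra.TensorProduct.tmul_pow, one_pow]
    rw [hδ, hpow, hφx, ← hpow, Algebra.TensorProduct.tmul_pow, one_pow, hπ1]
  rw [hδx, ← map_pow, ← map_pow, ← map_mul, ← mul_pow, ← pow_succ,
    Nat.sub_add_cancel (Nat.one_le_pow _ _ hp.pos), ← pow_mul, ← pow_succ]
end

section
/- Let R ↪ S be a finite local homomorphism of Noetherian local rings of prime characteristic p such that R is an R-module direct summand of S. If S has finite F-representation type, then so does R. -/
/-!
Statement 19: If `R ↪ S` is a finite local homomorphism of Noetherian local rings of
prime characteristic `p` such that `R` is an `R`-module direct summand of `S`, and `S`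
has finite F-representation type, then so does `R`.
-/

open scoped DirectSum

universe u

section Defs

/-- A witness for finite F-representation type of `R`: finitely generated modules
`M_1, …, M_s` such that for every `e` the Frobenius pushforward `ᵉR` is isomorphic to a
finite direct sum of copies of the `M_i` (an additive isomorphism
`ψ : R ≃+ ⨁_i M_i^{⊕ n_i}` with `ψ (r^{pᵉ} y) = r • ψ y` is exactly an `R`-module
isomorphism `ᵉR ≅ ⨁_i M_i^{⊕ n_i}`). -/
structure FFRTWitness (p : ℕ) (R : Type u) [CommRing R] : Type (u + 1) where
  s : ℕ
  M : Fin s → Type u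
  [acg : ∀ i, AddCommGroup (M i)]
  [mod : ∀ i, Module R (M i)]
  fin : ∀ i, Module.Finite R (M i)
  decomp : ∀ e : ℕ, ∃ (n : Fin s → ℕ)
    (ψ : R ≃+ ⨁ i : Fin s, (Fin (n i) → M i)),
      ∀ r y : R, ψ (r ^ p ^ e * y) = r • ψ y

/-- `R` has finite F-representation type. -/
def HasFFRT (p : ℕ) (R : Type u) [CommRing R] : Prop :=
  Nonempty (FFRTWitness p R)

end Defs

section Top

variable {R E : Type*} [CommRing R] [IsLocalRing R] [Ring E] [Algebra R E]

/-- Over a local ring, the maximal ideal carries a module that is finite over `R` into its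
Jacobson radical over any `R`-algebra acting on it. -/
theorem smul_mem_jacobson_of_mem_maximalIdeal {P : Type*} [AddCommGroup P] [Module R P]
    [Module E P] [IsScalarTower R E P] [Module.Finite R P] {r : R}
    (hr : r ∈ IsLocalRing.maximalIdeal R) (x : P) : r • x ∈ Module.jacobson E P := by
  refine Submodule.mem_sInf.mpr fun N hN ↦ ?_
  have hN : IsCoatom N := hN
  by_contra hx
  let m : P →ₗ[E] P := r • LinearMap.id
  have htop : N ⊔ LinearMap.range m = ⊤ := by
    refine hN.2 _ (lt_of_le_of_ne le_sup_left fun h ↦ hx ?_)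
    rw [h]
    exact Submodule.mem_sup_right ⟨x, rfl⟩
  refine hN.1 (eq_top_iff.mpr fun y _ ↦ ?_)
  have key : (⊤ : Submodule R P) ≤ N.restrictScalars R := by
    refine Submodule.le_of_le_smul_of_le_jacobson_bot (I := IsLocalRing.maximalIdeal R)
      Module.Finite.fg_top (IsLocalRing.maximalIdeal_le_jacobson _) fun z _ ↦ ?_
    have hz : z ∈ N ⊔ LinearMap.range m := htop ▸ Submodule.mem_top
    obtain ⟨a, ha, _, ⟨b, rfl⟩, rfl⟩ := Submodule.mem_sup.mp hz
    exact Submodule.add_mem_sup (S := N.restrictScalars R) ha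
      (Submodule.smul_mem_smul hr Submodule.mem_top)
  exact key Submodule.mem_top

/-- A finite module killed by the maximal ideal of a local ring is Artinian. -/
theorem isArtinian_of_isTorsionBySet_maximalIdeal {Q : Type*} [AddCommGroup Q] [Module R Q]
    [Module.Finite R Q]
    (htors : Module.IsTorsionBySet R Q (IsLocalRing.maximalIdeal R : Set R)) :
    IsArtinian R Q := by
  let := htors.module
  have : IsSemisimpleRing (R ⧸ IsLocalRing.maximalIdeal R) :=
    inferInstanceAs (IsSemisimpleRing (IsLocalRing.ResidueField R))
  have : IsSemisimpleModule R Q := (htors.isSemisimpleModule_iff (I := IsLocalRing.maximalIdeal R)).mp inferInstance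
  have h : Module.Finite R Q ↔ IsArtinian R Q := IsSemisimpleModule.finite_tfae.out 0 2
  exact h.mp inferInstance

variable (R) in
/-- The quotient by the Jacobson radical is semisimple for modules finite over a local
central subring. -/
theorem isSemisimpleModule_quotient_jacobson (P : Type*) [AddCommGroup P] [Module R P]
    [Module E P] [IsScalarTower R E P] [Module.Finite R P] :
    IsSemisimpleModule E (P ⧸ Module.jacobson E P) := by
  have htors : Module.IsTorsionBySet R (P ⧸ Module.jacobson E P)
      (IsLocalRing.maximalIdeal R : Set R) := by
    rintro x ⟨r, hr⟩
    induction x using Submodule.Quotient.induction_on with | _ x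
    change r • Submodule.Quotient.mk x = 0
    rw [← Submodule.Quotient.mk_smul, Submodule.Quotient.mk_eq_zero]
    exact smul_mem_jacobson_of_mem_maximalIdeal hr x
  have : Module.Finite R (P ⧸ Module.jacobson E P) :=
    Module.Finite.quotient R _
  have : IsArtinian R (P ⧸ Module.jacobson E P) :=
    isArtinian_of_isTorsionBySet_maximalIdeal htors
  have : IsArtinian E (P ⧸ Module.jacobson E P) := isArtinian_of_tower R this
  exact (IsArtinian.isSemisimpleModule_iff_jacobson E _).mpr (Module.jacobson_quotient_jacobson E P)

variable (R E) in
/-- An algebra that is finite over a local ring has finitely many simple modules up to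
isomorphism. -/
theorem exists_fin_simple_modules [Module.Finite R E] :
    ∃ (t : ℕ) (S : Fin t → Submodule E (E ⧸ Module.jacobson E E)),
      ∀ (T : Type*) [AddCommGroup T] [Module E T] [IsSimpleModule E T],
        ∃ i, Nonempty (T ≃ₗ[E] S i) := by
  have := isSemisimpleModule_quotient_jacobson R (E := E) E
  obtain ⟨t, S, e, hS⟩ :=
    IsSemisimpleModule.exists_linearEquiv_fin_dfinsupp E (E ⧸ Module.jacobson E E)
  refine ⟨t, S, fun T _ _ _ ↦ ?_⟩
  have := IsSimpleModule.nontrivial E T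
  obtain ⟨x, hx⟩ := exists_ne (0 : T)
  let f : (E ⧸ Module.jacobson E E) →ₗ[E] T := (Module.jacobson E E).liftQ
    (LinearMap.toSpanSingleton E T x) (IsSemisimpleModule.jacobson_le_ker _ _ _ _ _)
  let g : (Π₀ i, S i) →ₗ[E] T := f ∘ₗ e.symm.toLinearMap
  have hg : g ≠ 0 := fun h ↦ hx <| by
    have h1 : f (Submodule.Quotient.mk 1) = x := by
      simp only [f, Submodule.liftQ_apply, LinearMap.toSpanSingleton_apply, one_smul]
    rw [← h1, ← e.symm_apply_apply (Submodule.Quotient.mk 1)]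
    exact LinearMap.congr_fun h _
  obtain ⟨i, hi⟩ : ∃ i, g ∘ₗ DFinsupp.lsingle i ≠ 0 := by
    by_contra! h
    exact hg (DFinsupp.lhom_ext' fun i ↦ by simp [h i])
  exact ⟨i, ⟨(LinearEquiv.ofBijective _ (LinearMap.bijective_of_ne_zero hi)).symm⟩⟩

/-- If every fibre of `c` is at most as large as the corresponding fibre of `c'`, then `c`
factors through `c'` by an injection. -/
theorem exists_injective_comp_eq_of_card_fiber_le {α β γ : Type*} [Finite β] {c : α → γ}
    {c' : β → γ} [Finite α]
    (h : ∀ i, Nat.card {k // c k = i} ≤ Nat.card {k // c' k = i}) :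
    ∃ σ : α → β, Function.Injective σ ∧ ∀ k, c' (σ k) = c k := by
  have hf (i) : ∃ f : {k // c k = i} → {k // c' k = i}, Function.Injective f := by
    have := Fintype.ofFinite {k // c k = i}
    have := Fintype.ofFinite {k // c' k = i}
    have hi := h i
    rw [Nat.card_eq_fintype_card, Nat.card_eq_fintype_card] at hi
    obtain ⟨f⟩ := Function.Embedding.nonempty_of_card_le hi
    exact ⟨f, f.injective⟩
  choose f hf using hf
  have hσ (k) : c' (f (c k) ⟨k, rfl⟩) = c k := (f (c k) ⟨k, rfl⟩).2
  refine ⟨fun k ↦ f (c k) ⟨k, rfl⟩, fun k l hkl ↦ ?_, hσ⟩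
  have hc : c k = c l := by rw [← hσ k, ← hσ l]; exact congrArg c' hkl
  have aux : ∀ i j (hij : i = j) (hi : c k = i) (hj : c l = j),
      (f i ⟨k, hi⟩ : β) = f j ⟨l, hj⟩ → k = l := by
    rintro i _ rfl hi hj h
    exact congrArg Subtype.val (hf i (Subtype.ext h))
  exact aux _ _ hc rfl rfl hkl

variable (R) in
/-- The tops of `E`-modules that are finite over a local central subring are measured by
vectors of natural numbers: a componentwise inequality of these vectors yields a surjection. -/
theorem exists_multiplicity_of_jacobson_quotient [Module.Finite R E] {α : Type*} (P : α → Type*)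
    [∀ x, AddCommGroup (P x)] [∀ x, Module R (P x)] [∀ x, Module E (P x)]
    [∀ x, IsScalarTower R E (P x)] [∀ x, Module.Finite R (P x)] :
    ∃ (t : ℕ) (a : α → Fin t → ℕ), ∀ x y, a x ≤ a y →
      ∃ f : (P y ⧸ Module.jacobson E (P y)) →ₗ[E] (P x ⧸ Module.jacobson E (P x)),
        Function.Surjective f := by
  obtain ⟨t, S, hS⟩ := exists_fin_simple_modules R E
  have decomp (x : α) : ∃ (n : ℕ) (T : Fin n → Submodule E (P x ⧸ Module.jacobson E (P x)))
      (_ : (P x ⧸ Module.jacobson E (P x)) ≃ₗ[E] Π₀ i, T i) (c : Fin n → Fin t),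
      ∀ k, Nonempty (T k ≃ₗ[E] S (c k)) := by
    have := isSemisimpleModule_quotient_jacobson R (E := E) (P x)
    have : Module.Finite E (P x) := .of_restrictScalars_finite R E _
    obtain ⟨n, T, e, hT⟩ :=
      IsSemisimpleModule.exists_linearEquiv_fin_dfinsupp E (P x ⧸ Module.jacobson E (P x))
    choose c hc using fun k ↦ hS (T k)
    exact ⟨n, T, e, c, hc⟩
  choose n T e c hc using decomp
  refine ⟨t, fun x i ↦ Nat.card {k // c x k = i}, fun x y hxy ↦ ?_⟩
  obtain ⟨σ, hσ, hσc⟩ := exists_injective_comp_eq_of_card_fiber_le hxy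
  have iso (k) : Nonempty (T y (σ k) ≃ₗ[E] T x k) := by
    have h := hc y (σ k)
    rw [hσc k] at h
    exact ⟨h.some.trans (hc x k).some.symm⟩
  let F : (Π₀ k, T y k) →ₗ[E] Π k, T x k :=
    LinearMap.pi fun k ↦ (iso k).some.toLinearMap ∘ₗ DFinsupp.lapply (σ k)
  have hF : Function.Surjective F := fun z ↦ by
    refine ⟨∑ k, DFinsupp.single (σ k) ((iso k).some.symm (z k)), funext fun l ↦ ?_⟩
    simp only [F, LinearMap.pi_apply, LinearMap.comp_apply, DFinsupp.lapply_apply,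
      DFinsupp.finsetSum_apply]
    rw [Finset.sum_eq_single l]
    · simp
    · intro k _ hk
      exact DFinsupp.single_eq_of_ne fun h ↦ hk (hσ h).symm
    · simp
  let toPi := (DirectSum.linearEquivFunOnFintype E (Fin (n x)) fun k ↦ T x k)
  exact ⟨(e x).symm.toLinearMap ∘ₗ toPi.symm.toLinearMap ∘ₗ F ∘ₗ (e y).toLinearMap,
    (e x).symm.surjective.comp (toPi.symm.surjective.comp (hF.comp (e y).surjective))⟩

/-- A surjection between the tops of finite projective modules makes the target a retract. -/
theorem exists_retract_of_surjective_jacobson_quotient {P Q : Type*} [AddCommGroup P]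
    [AddCommGroup Q] [Module E P] [Module E Q] [Module.Finite E P] [Module.Projective E P]
    [Module.Projective E Q] (f : (Q ⧸ Module.jacobson E Q) →ₗ[E] (P ⧸ Module.jacobson E P))
    (hf : Function.Surjective f) : ∃ (i : P →ₗ[E] Q) (π : Q →ₗ[E] P), π ∘ₗ i = LinearMap.id := by
  obtain ⟨π, hπ⟩ := Module.projective_lifting_property (Module.jacobson E P).mkQ
    (f ∘ₗ (Module.jacobson E Q).mkQ) (Submodule.mkQ_surjective _)
  have hsurj : LinearMap.range π = ⊤ := by
    refine (eq_top_or_exists_le_coatom _).resolve_right ?_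
    rintro ⟨N, hN, hle⟩
    refine hN.1 (eq_top_iff.mpr fun x _ ↦ ?_)
    obtain ⟨y, hy⟩ := (hf.comp (Submodule.mkQ_surjective _)) ((Module.jacobson E P).mkQ x)
    have hxy : (Module.jacobson E P).mkQ (x - π y) = 0 := by
      rw [map_sub, sub_eq_zero, ← hy]
      exact (LinearMap.congr_fun hπ y).symm
    rw [Submodule.mkQ_apply, Submodule.Quotient.mk_eq_zero] at hxy
    have hJ : Module.jacobson E P ≤ N := sInf_le hN
    simpa using N.add_mem (hJ hxy) (hle ⟨y, rfl⟩)
  obtain ⟨i, hi⟩ := π.exists_rightInverse_of_surjective hsurj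
  exact ⟨i, π, hi⟩

end Top

section PowerRetract

variable (R : Type*) [CommRing R] (M : Type*) [AddCommGroup M] [Module R M]

/-- `X` is a direct summand of a finite power of `M`. -/
def IsPowerRetract (X : Type*) [AddCommGroup X] [Module R X] : Prop :=
  ∃ (n : ℕ) (ι : X →ₗ[R] (Fin n → M)) (ρ : (Fin n → M) →ₗ[R] X), ρ ∘ₗ ι = LinearMap.id

variable {R M} {X Y : Type*} [AddCommGroup X] [Module R X] [AddCommGroup Y] [Module R Y]

namespace IsPowerRetract

theorem of_retract (hY : IsPowerRetract R M Y) (i : X →ₗ[R] Y) (π : Y →ₗ[R] X)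
    (h : π ∘ₗ i = LinearMap.id) : IsPowerRetract R M X := by
  obtain ⟨n, ι, ρ, hρ⟩ := hY
  refine ⟨n, ι ∘ₗ i, π ∘ₗ ρ, LinearMap.ext fun x ↦ ?_⟩
  have h1 := LinearMap.congr_fun hρ (i x)
  exact (congrArg π h1).trans (LinearMap.congr_fun h x)

theorem of_finite {κ : Type*} [Finite κ] (ι : X →ₗ[R] (κ → M)) (ρ : (κ → M) →ₗ[R] X)
    (h : ρ ∘ₗ ι = LinearMap.id) : IsPowerRetract R M X := by
  let e := LinearEquiv.funCongrLeft R M (Finite.equivFin κ).symm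
  refine ⟨Nat.card κ, e.toLinearMap ∘ₗ ι, ρ ∘ₗ e.symm.toLinearMap, LinearMap.ext fun x ↦ ?_⟩
  simpa using LinearMap.congr_fun h x

theorem finite [Module.Finite R M] (hX : IsPowerRetract R M X) : Module.Finite R X := by
  obtain ⟨n, ι, ρ, h⟩ := hX
  exact .of_surjective ρ fun x ↦ ⟨ι x, LinearMap.congr_fun h x⟩

theorem projective_hom (hX : IsPowerRetract R M X) :
    Module.Projective (Module.End R M) (X →ₗ[R] M) := by
  obtain ⟨n, ι, ρ, h⟩ := hX
  let i : (X →ₗ[R] M) →ₗ[Module.End R M] (Fin n → Module.End R M) :=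
    { toFun := fun φ k ↦ φ ∘ₗ ρ ∘ₗ LinearMap.single R (fun _ ↦ M) k
      map_add' := fun _ _ ↦ rfl
      map_smul' := fun _ _ ↦ rfl }
  let s : (Fin n → Module.End R M) →ₗ[Module.End R M] (X →ₗ[R] M) :=
    ∑ k, (LinearMap.toSpanSingleton (Module.End R M) (X →ₗ[R] M) (LinearMap.proj k ∘ₗ ι)) ∘ₗ
      LinearMap.proj k
  refine Module.Projective.of_split i s (LinearMap.ext fun φ ↦ LinearMap.ext fun x ↦ ?_)
  calc s (i φ) x = ∑ k, φ (ρ (Pi.single k (ι x k))) := by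
        simp [s, i]
    _ = φ (ρ (∑ k, Pi.single k (ι x k))) := by simp
    _ = φ (ρ (ι x)) := by rw [Finset.univ_sum_single]
    _ = φ x := congrArg φ (LinearMap.congr_fun h x)

/-- `X ↦ Hom(X, M)` is full on maps out of `Hom(X, M)` for `X` a summand of a power of `M`. -/
theorem exists_comp_eq (hX : IsPowerRetract R M X)
    (T : (X →ₗ[R] M) →ₗ[Module.End R M] (Y →ₗ[R] M)) :
    ∃ f : Y →ₗ[R] X, ∀ φ, T φ = φ ∘ₗ f := by
  obtain ⟨n, ι, ρ, h⟩ := hX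
  refine ⟨ρ ∘ₗ LinearMap.pi fun k ↦ T (LinearMap.proj k ∘ₗ ι), fun φ ↦ ?_⟩
  let ψ (k : Fin n) : Module.End R M := φ ∘ₗ ρ ∘ₗ LinearMap.single R (fun _ ↦ M) k
  have hψ (v : Fin n → M) : ∑ k, ψ k (v k) = φ (ρ v) := by
    conv_rhs => rw [← Finset.univ_sum_single v]
    simp [ψ]
  have hφ : φ = ∑ k, ψ k • (LinearMap.proj k ∘ₗ ι : X →ₗ[R] M) := LinearMap.ext fun x ↦ by
    rw [LinearMap.sum_apply]
    exact (congrArg φ (LinearMap.congr_fun h x)).symm.trans (hψ (ι x)).symm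
  ext y
  conv_lhs => rw [hφ]
  rw [map_sum, LinearMap.sum_apply]
  simp only [map_smul]
  exact hψ fun k ↦ T (LinearMap.proj k ∘ₗ ι) y

theorem ext_hom (hX : IsPowerRetract R M X) {f g : Y →ₗ[R] X}
    (hfg : ∀ φ : X →ₗ[R] M, φ ∘ₗ f = φ ∘ₗ g) : f = g := by
  obtain ⟨n, ι, ρ, h⟩ := hX
  ext y
  have : ι (f y) = ι (g y) := funext fun k ↦
    LinearMap.congr_fun (hfg (LinearMap.proj k ∘ₗ ι)) y
  rw [← LinearMap.id_apply (R := R) (f y), ← LinearMap.id_apply (R := R) (g y), ← h]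
  exact congrArg ρ this

/-- Retractions of `Hom(-, M)` descend to retractions of modules. -/
theorem exists_retract (hX : IsPowerRetract R M X) (hY : IsPowerRetract R M Y)
    (i : (X →ₗ[R] M) →ₗ[Module.End R M] (Y →ₗ[R] M))
    (π : (Y →ₗ[R] M) →ₗ[Module.End R M] (X →ₗ[R] M)) (h : π ∘ₗ i = LinearMap.id) :
    ∃ (f : Y →ₗ[R] X) (g : X →ₗ[R] Y), f ∘ₗ g = LinearMap.id := by
  obtain ⟨f, hf⟩ := hX.exists_comp_eq i
  obtain ⟨g, hg⟩ := hY.exists_comp_eq π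
  refine ⟨f, g, hX.ext_hom fun φ ↦ ?_⟩
  rw [← LinearMap.comp_assoc, ← hf, ← hg]
  exact LinearMap.congr_fun h φ

variable [IsLocalRing R] [IsNoetherianRing R] [Module.Finite R M]

/-- Summands of powers of `M` are measured by vectors of natural numbers: a componentwise
inequality of these vectors makes one module a retract of the other. -/
theorem exists_multiplicity {α : Type*} (X : α → Type*) [∀ x, AddCommGroup (X x)]
    [∀ x, Module R (X x)] (hX : ∀ x, IsPowerRetract R M (X x)) :
    ∃ (t : ℕ) (a : α → Fin t → ℕ), ∀ x y, a x ≤ a y →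
      ∃ (f : X y →ₗ[R] X x) (g : X x →ₗ[R] X y), f ∘ₗ g = LinearMap.id := by
  have (x : α) : Module.Finite R (X x) := (hX x).finite
  obtain ⟨t, a, ha⟩ := exists_multiplicity_of_jacobson_quotient R (E := Module.End R M)
    fun x ↦ X x →ₗ[R] M
  refine ⟨t, a, fun x y hxy ↦ ?_⟩
  obtain ⟨f, hf⟩ := ha x y hxy
  have := (hX x).projective_hom
  have := (hX y).projective_hom
  have : Module.Finite (Module.End R M) (X x →ₗ[R] M) := .of_restrictScalars_finite R _ _
  obtain ⟨i, π, h⟩ := exists_retract_of_surjective_jacobson_quotient f hf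
  exact (hX x).exists_retract (hX y) i π h

end IsPowerRetract

/-- A retraction `f` with section `g` splits off its target. -/
noncomputable def LinearEquiv.prodKerOfRetract (f : Y →ₗ[R] X) (g : X →ₗ[R] Y)
    (h : f ∘ₗ g = LinearMap.id) : (X × LinearMap.ker f) ≃ₗ[R] Y :=
  have hfg (x) : f (g x) = x := LinearMap.congr_fun h x
  LinearEquiv.ofBijective (g.coprod (LinearMap.ker f).subtype) <| by
    constructor
    · refine (injective_iff_map_eq_zero _).mpr ?_
      rintro ⟨x, k, hk⟩ h0
      have h0 : g x + k = 0 := h0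
      have hx : x = 0 := by simpa [hfg, LinearMap.mem_ker.mp hk] using congrArg f h0
      subst hx
      simpa using h0
    · intro y
      exact ⟨⟨f y, y - g (f y), by simp [hfg]⟩, by simp⟩

theorem LinearMap.ker_isPowerRetract (hY : IsPowerRetract R M Y) (f : Y →ₗ[R] X) (g : X →ₗ[R] Y)
    (h : f ∘ₗ g = LinearMap.id) : IsPowerRetract R M (LinearMap.ker f) := by
  let e := LinearEquiv.prodKerOfRetract f g h
  refine hY.of_retract (e.toLinearMap ∘ₗ LinearMap.inr R _ _)
    (LinearMap.snd R _ _ ∘ₗ e.symm.toLinearMap) (LinearMap.ext fun x ↦ by simp)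

/-- Splitting off a nonzero module decreases the dimension of the fibre over the residue field. -/
theorem finrank_fiber_ker_lt [IsLocalRing R] [Module.Finite R X] [Nontrivial X]
    [Module.Finite R Y] (f : Y →ₗ[R] X) (g : X →ₗ[R] Y) (h : f ∘ₗ g = LinearMap.id) :
    Module.finrank (IsLocalRing.ResidueField R)
        (TensorProduct R (IsLocalRing.ResidueField R) (LinearMap.ker f)) <
      Module.finrank (IsLocalRing.ResidueField R)
        (TensorProduct R (IsLocalRing.ResidueField R) Y) := by
  let k := IsLocalRing.ResidueField R
  let e := LinearEquiv.prodKerOfRetract f g h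
  have : Module.Finite R (LinearMap.ker f) :=
    .of_surjective (LinearMap.snd R _ _ ∘ₗ e.symm.toLinearMap)
      (Prod.snd_surjective.comp e.symm.surjective)
  have : Nontrivial (TensorProduct R k X) := by
    rw [← not_subsingleton_iff_nontrivial, IsLocalRing.subsingleton_tensorProduct,
      not_subsingleton_iff_nontrivial]
    infer_instance
  rw [← (((TensorProduct.prodRight R k k X (LinearMap.ker f)).symm.trans
    (TensorProduct.AlgebraTensorModule.congr (.refl k k) e))).finrank_eq, Module.finrank_prod]
  exact Nat.lt_add_of_pos_left Module.finrank_pos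

end PowerRetract

/-- A finite direct sum indexed by a word `c` is a direct sum of powers of its letters. -/
theorem nonempty_linearEquiv_pi_fiber {R : Type*} [CommRing R] {κ γ : Type*} [Finite κ]
    (X : γ → Type*) [∀ i, AddCommGroup (X i)] [∀ i, Module R (X i)] (c : κ → γ) :
    Nonempty ((Π k, X (c k)) ≃ₗ[R] Π i, Fin (Nat.card {k // c k = i}) → X i) := by
  let G : (Π i, {k // c k = i} → X i) →ₗ[R] Π k, X (c k) :=
    { toFun := fun v k ↦ v (c k) ⟨k, rfl⟩
      map_add' := fun _ _ ↦ rfl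
      map_smul' := fun _ _ ↦ rfl }
  have hG : Function.Bijective G := by
    refine ⟨fun v w h ↦ ?_, fun w ↦ ⟨fun i k ↦ k.2 ▸ w k.1, rfl⟩⟩
    funext i ⟨k, hk⟩
    subst hk
    exact congrFun h k
  exact ⟨(LinearEquiv.ofBijective G hG).symm.trans
    (LinearEquiv.piCongrRight fun i ↦ LinearEquiv.funCongrLeft R (X i) (Finite.equivFin _).symm)⟩

/-- Over a Noetherian local ring, the direct summands of the powers of a finite module are
the direct sums of copies of finitely many of them. -/
theorem exists_finite_generators_of_isPowerRetract (R : Type u) [CommRing R] [IsLocalRing R]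
    [IsNoetherianRing R] (M : Type u) [AddCommGroup M] [Module R M] [Module.Finite R M] :
    ∃ (s : ℕ) (n : Fin s → ℕ) (X : ∀ i, Submodule R (Fin (n i) → M)),
      ∀ (Y : Type u) [AddCommGroup Y] [Module R Y], IsPowerRetract R M Y →
        ∃ m : Fin s → ℕ, Nonempty (Y ≃ₗ[R] ⨁ i, (Fin (m i) → X i)) := by
  let α := {N : Σ n : ℕ, Submodule R (Fin n → M) // IsPowerRetract R M N.2 ∧ Nontrivial N.2}
  obtain ⟨t, a, ha⟩ := IsPowerRetract.exists_multiplicity (R := R) (M := M)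
    (fun x : α ↦ x.1.2) fun x ↦ x.2.1
  let A : Set (Fin t → ℕ) := {v | Minimal (· ∈ Set.range a) v}
  have hA : A.Finite := WellQuasiOrderedLE.finite_of_isAntichain (setOfPred_minimal_antichain _)
  have : Finite A := hA
  let e : Fin (Nat.card A) ≃ A := (Finite.equivFin A).symm
  choose x hx using fun i ↦ (e i).2.prop
  refine ⟨Nat.card A, fun i ↦ (x i).1.1, fun i ↦ (x i).1.2, ?_⟩
  suffices H : ∀ (d : ℕ) (Y : Type u) [AddCommGroup Y] [Module R Y], IsPowerRetract R M Y →
      Module.finrank (IsLocalRing.ResidueField R)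
        (TensorProduct R (IsLocalRing.ResidueField R) Y) = d →
      ∃ (m : ℕ) (c : Fin m → Fin (Nat.card A)), Nonempty (Y ≃ₗ[R] Π k, (x (c k)).1.2) by
    intro Y _ _ hY
    obtain ⟨m, c, ⟨φ⟩⟩ := H _ Y hY rfl
    obtain ⟨θ⟩ := nonempty_linearEquiv_pi_fiber (R := R) (fun i ↦ (x i).1.2) c
    exact ⟨_, ⟨(φ.trans θ).trans (DirectSum.linearEquivFunOnFintype R _ _).symm⟩⟩
  intro d
  induction d using Nat.strong_induction_on with | _ d ih
  intro Y _ _ hY hd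
  rcases subsingleton_or_nontrivial Y with hsub | hnt
  · exact ⟨0, Fin.elim0, ⟨LinearEquiv.ofSubsingleton _ _⟩⟩
  obtain ⟨n, ι, ρ, hρ⟩ := id hY
  have hι : Function.Injective ι := fun y z h ↦ by
    rw [← LinearMap.id_apply (R := R) y, ← LinearMap.id_apply (R := R) z, ← hρ]
    exact congrArg ρ h
  let ε := LinearEquiv.ofInjective ι hι
  let y : α := ⟨⟨n, LinearMap.range ι⟩, hY.of_retract ε.symm.toLinearMap ε.toLinearMap (by simp),
    ε.injective.nontrivial⟩
  obtain ⟨v, hv, hmin⟩ := exists_minimal_le_of_wellFoundedLT (· ∈ Set.range a) (a y) ⟨y, rfl⟩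
  obtain ⟨j, hj⟩ := e.surjective ⟨v, hmin⟩
  obtain ⟨f, g, hfg⟩ := ha (x j) y (by rwa [hx, hj])
  let f' : Y →ₗ[R] (x j).1.2 := f ∘ₗ ε.toLinearMap
  let g' : (x j).1.2 →ₗ[R] Y := ε.symm.toLinearMap ∘ₗ g
  have hfg' : f' ∘ₗ g' = LinearMap.id := LinearMap.ext fun z ↦ by
    simpa [f', g'] using LinearMap.congr_fun hfg z
  have := (x j).2.2
  have := (x j).2.1.finite
  have := hY.finite
  obtain ⟨m, c, ⟨φ⟩⟩ := ih _ (hd ▸ finrank_fiber_ker_lt f' g' hfg') (LinearMap.ker f')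
    (LinearMap.ker_isPowerRetract hY f' g' hfg') rfl
  exact ⟨m + 1, Fin.cons j c, ⟨((LinearEquiv.prodKerOfRetract f' g' hfg').symm.trans
    ((LinearEquiv.refl R _).prodCongr φ)).trans
    (Fin.consLinearEquiv R fun k ↦ (x ((Fin.cons j c : Fin (m + 1) → _) k)).1.2)⟩⟩

/-- A finite direct sum of powers of modules is a summand of a power of their product. -/
theorem isPowerRetract_directSum {R : Type*} [CommRing R] {κ : Type*} [Fintype κ] [DecidableEq κ]
    (N : κ → Type*) [∀ i, AddCommGroup (N i)] [∀ i, Module R (N i)] (n : κ → ℕ) :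
    IsPowerRetract R (Π i, N i) (⨁ i, (Fin (n i) → N i)) := by
  let e := DirectSum.linearEquivFunOnFintype R κ fun i ↦ Fin (n i) → N i
  let ι : (Π i, Fin (n i) → N i) →ₗ[R] ((Σ i, Fin (n i)) → Π i, N i) :=
    LinearMap.pi fun k ↦ LinearMap.single R N k.1 ∘ₗ LinearMap.proj k.2 ∘ₗ LinearMap.proj k.1
  let ρ : ((Σ i, Fin (n i)) → Π i, N i) →ₗ[R] (Π i, Fin (n i) → N i) :=
    LinearMap.pi fun i ↦ LinearMap.pi fun k ↦ LinearMap.proj i ∘ₗ LinearMap.proj ⟨i, k⟩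
  have hρ (v) : ρ (ι v) = v := by
    funext i k
    simp [ρ, ι]
  exact .of_finite (ι ∘ₗ e.toLinearMap) (e.symm.toLinearMap ∘ₗ ρ)
    (LinearMap.ext fun v ↦ by simp [hρ])

/-- The additive group of `R` with scalars acting through the ring endomorphism `φ`. -/
def TwistedSelf {R : Type*} [CommRing R] (_ : R →+* R) : Type _ := R

namespace TwistedSelf

variable {R : Type*} [CommRing R] (φ : R →+* R)

instance : AddCommGroup (TwistedSelf φ) := inferInstanceAs (AddCommGroup R)

instance : Module R (TwistedSelf φ) := Module.compHom R φ

/-- The identity of `R`, viewed as a map to the twisted module. -/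
def equiv : R ≃+ TwistedSelf φ := AddEquiv.refl R

theorem smul_equiv (r y : R) : r • equiv φ y = equiv φ (φ r * y) := rfl

end TwistedSelf

/-- If `R` is a direct summand of `S`, then `ᵉR` is a direct summand of `ᵉS`, hence of a
power of any `R`-module whose powers contain `ᵉS` as a summand. -/
theorem isPowerRetract_twistedSelf {R S : Type*} [CommRing R] [CommRing S] [Algebra R S]
    (g : S →ₗ[R] R) (hg : ∀ r : R, g (algebraMap R S r) = r) (φ : R →+* R) (q : ℕ)
    (hφ : ∀ r, φ r = r ^ q) {M U : Type*} [AddCommGroup M] [Module R M] [AddCommGroup U]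
    [Module R U] [Module S U] [IsScalarTower R S U] (hU : IsPowerRetract R M U) (ψ : S ≃+ U)
    (hψ : ∀ r y : S, ψ (r ^ q * y) = r • ψ y) : IsPowerRetract R M (TwistedSelf φ) := by
  have hψR (r : R) (y : S) : ψ (algebraMap R S (φ r) * y) = r • ψ y := by
    rw [hφ, map_pow, hψ, algebraMap_smul]
  let i : TwistedSelf φ →ₗ[R] U :=
    { toFun := fun y ↦ ψ (algebraMap R S ((TwistedSelf.equiv φ).symm y))
      map_add' := fun _ _ ↦ by simp
      map_smul' := fun r y ↦ by
        obtain ⟨y, rfl⟩ := (TwistedSelf.equiv φ).surjective y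
        simp [TwistedSelf.smul_equiv, hψR] }
  let π : U →ₗ[R] TwistedSelf φ :=
    { toFun := fun u ↦ TwistedSelf.equiv φ (g (ψ.symm u))
      map_add' := fun _ _ ↦ by simp
      map_smul' := fun r u ↦ by
        obtain ⟨y, rfl⟩ := ψ.surjective u
        rw [← hψR, ψ.symm_apply_apply, ψ.symm_apply_apply, ← Algebra.smul_def, map_smul,
          smul_eq_mul, RingHom.id_apply, TwistedSelf.smul_equiv] }
  exact hU.of_retract i π (LinearMap.ext fun y ↦ by simp [i, π, hg])

/-- Let `R ↪ S` be a finite local homomorphism of Noetherian local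
rings of prime characteristic `p` such that `R` is an `R`-module direct summand of `S`.
If `S` has finite F-representation type, then so does `R`. -/
theorem stmt19 {R S : Type u} [CommRing R] [CommRing S]
    [IsNoetherianRing R] [IsNoetherianRing S] [IsLocalRing R] [IsLocalRing S]
    (p : ℕ) (hp : p.Prime) [CharP R p] [CharP S p]
    [Algebra R S]
    -- `R ↪ S` is injective, finite and local:
    (hinj : Function.Injective (algebraMap R S))
    [Module.Finite R S]
    (hloc : IsLocalHom (algebraMap R S))
    -- `R` is an `R`-module direct summand of `S`:
    (hsplit : ∃ g : S →ₗ[R] R, ∀ r : R, g (algebraMap R S r) = r)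
    (hS : HasFFRT p S) :
    HasFFRT p R := by
  obtain ⟨⟨s, N, hN, decomp⟩⟩ := hS
  obtain ⟨g, hg⟩ := hsplit
  let (i : Fin s) : Module R (N i) := Module.compHom (N i) (algebraMap R S)
  have (i : Fin s) : IsScalarTower R S (N i) :=
    .of_algebraMap_smul fun _ _ ↦ rfl
  have (i : Fin s) : Module.Finite R (N i) := .trans S (N i)
  obtain ⟨t, n, X, hX⟩ := exists_finite_generators_of_isPowerRetract R (Π i, N i)
  refine ⟨⟨t, fun i ↦ X i, fun i ↦ inferInstance, fun e ↦ ?_⟩⟩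
  obtain ⟨k, ψ, hψ⟩ := decomp e
  have : Fact p.Prime := ⟨hp⟩
  let φ := iterateFrobenius R p e
  have : IsScalarTower R S (⨁ i, (Fin (k i) → N i)) :=
    .of_algebraMap_smul fun r u ↦ DFinsupp.ext fun i ↦ funext fun l ↦ rfl
  obtain ⟨m, ⟨θ⟩⟩ := hX (TwistedSelf φ) <|
    isPowerRetract_twistedSelf g hg φ (p ^ e) (iterateFrobenius_def p e)
      (isPowerRetract_directSum N k) ψ hψ
  refine ⟨m, (TwistedSelf.equiv φ).trans θ.toAddEquiv, fun r y ↦ ?_⟩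
  exact (congrArg θ (congrArg (TwistedSelf.equiv φ)
    (congrArg (· * y) (iterateFrobenius_def p e r).symm))).trans
    (θ.map_smul r (TwistedSelf.equiv φ y))
end
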